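/- Let P be a frame polyomino. Then the coordinate ring K[P]=S_P/I_P is a normal Cohen–Macaulay integral domain. -/

import Mathlib

noncomputable section

open scoped BigOperators

/-! ## Polyominoes -/

/-- Two cells of `ℤ²` (identified with their lower left corners) share an edge. -/
def cellAdj (c d : ℤ × ℤ) : Prop :=
  (c.1 = d.1 ∧ (d.2 = c.2 + 1 ∨ c.2 = d.2 + 1)) ∨
  (c.2 = d.2 ∧ (d.1 = c.1 + 1 ∨ c.1 = d.1 + 1))

/-- A polyomino: a nonempty finite collection of cells of `ℤ²` any two of which are
connected by a path of cells of the collection in which consecutive cells share an edge. -/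
structure Polyomino : Type where
  cells : Finset (ℤ × ℤ)
  nonempty : cells.Nonempty
  connected : ∀ c ∈ cells, ∀ d ∈ cells,
    Relation.ReflTransGen (fun u v => u ∈ cells ∧ v ∈ cells ∧ cellAdj u v) c d

/-- The four vertices of the cell with lower left corner `c`. -/
def cellVertices (c : ℤ × ℤ) : Finset (ℤ × ℤ) :=
  {c, (c.1 + 1, c.2), (c.1, c.2 + 1), (c.1 + 1, c.2 + 1)}

/-- The vertex set `V(P)` of a polyomino. -/
def Polyomino.vertexSet (P : Polyomino) : Finset (ℤ × ℤ) :=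
  P.cells.biUnion cellVertices

/-- The rank of `P`: the number of its cells. -/
def Polyomino.rank (P : Polyomino) : ℕ := P.cells.card

/-- The cell with lower left corner `c` is contained in the interval `[a, b]` of `ℤ²`. -/
def cellInInterval (a b c : ℤ × ℤ) : Prop :=
  a.1 ≤ c.1 ∧ c.1 + 1 ≤ b.1 ∧ a.2 ≤ c.2 ∧ c.2 + 1 ≤ b.2

/-- `[a, b]` is an inner interval of the polyomino `P`: it is a proper interval all of whose
cells belong to `P`. -/
def IsInnerInterval (P : Polyomino) (a b : ℤ × ℤ) : Prop :=
  a.1 < b.1 ∧ a.2 < b.2 ∧ ∀ c : ℤ × ℤ, cellInInterval a b c → c ∈ P.cells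

/-! ## North-east paths, parallelogram and frame polyominoes -/

/-- A north-east path: consecutive points form east or north steps. -/
def IsNEPath (L : List (ℤ × ℤ)) : Prop :=
  L ≠ [] ∧ L.Chain' (fun u v => v = (u.1 + 1, u.2) ∨ v = (u.1, u.2 + 1))

/-- The path `L` contains the east step from `(x, h)` to `(x + 1, h)`. -/
def eastStepOf (L : List (ℤ × ℤ)) (x h : ℤ) : Prop :=
  ((x, h), (x + 1, h)) ∈ L.zip L.tail

/-- The cell with lower left corner `c` lies (strictly) below the north-east path `L`. -/
def cellBelowPath (L : List (ℤ × ℤ)) (c : ℤ × ℤ) : Prop :=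
  ∃ h, eastStepOf L c.1 h ∧ c.2 < h

/-- The cell with lower left corner `c` lies (weakly) above the north-east path `L`. -/
def cellAbovePath (L : List (ℤ × ℤ)) (c : ℤ × ℤ) : Prop :=
  ∃ h, eastStepOf L c.1 h ∧ h ≤ c.2

/-- The interior points of a path (all points except the two endpoints). -/
def interiorPts (L : List (ℤ × ℤ)) : List (ℤ × ℤ) := (L.drop 1).dropLast

/-- `S1` lies above `S2`. -/
def LiesAbove (S1 S2 : List (ℤ × ℤ)) : Prop :=
  ∀ p ∈ interiorPts S1, ∀ q ∈ interiorPts S2, p.1 = q.1 → q.2 < p.2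

/-- The combinatorial data of a pair of north-east paths with the same endpoints,
the first lying above the second. -/
structure ParallelogramOn (S1 S2 : List (ℤ × ℤ)) : Prop where
  ne1 : IsNEPath S1
  ne2 : IsNEPath S2
  headEq : S1.head? = S2.head?
  lastEq : S1.getLast? = S2.getLast?
  above : LiesAbove S1 S2

/-- The cells of the region bounded above by `S1` and below by `S2`. -/
def parCells (S1 S2 : List (ℤ × ℤ)) : Set (ℤ × ℤ) :=
  {c | cellBelowPath S1 c ∧ cellAbovePath S2 c}

/-- `P` is a parallelogram polyomino. -/
def IsParallelogram (P : Polyomino) : Prop :=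
  ∃ S1 S2 : List (ℤ × ℤ), ParallelogramOn S1 S2 ∧
    (↑P.cells : Set (ℤ × ℤ)) = parCells S1 S2

/-- The data defining a frame polyomino: a rectangle `[(1,1),(m,n)]` and a parallelogram
polyomino determined by `S1, S2` with endpoints `(a0, b0)` and `(ak, bk)`. -/
structure FrameData : Type where
  m : ℤ
  n : ℤ
  S1 : List (ℤ × ℤ)
  S2 : List (ℤ × ℤ)
  a0 : ℤ
  b0 : ℤ
  ak : ℤ
  bk : ℤ
  par : ParallelogramOn S1 S2
  head1 : S1.head? = some (a0, b0)
  last1 : S1.getLast? = some (ak, bk)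
  ha0 : 1 < a0
  hak : a0 < ak
  ham : ak < m
  hb0 : 1 < b0
  hbk : b0 < bk
  hbn : bk < n

/-- The cells of the hole of a frame polyomino. -/
def FrameData.holeCells (D : FrameData) : Set (ℤ × ℤ) := parCells D.S1 D.S2

/-- The cells of the ambient rectangle `[(1,1),(m,n)]`. -/
def FrameData.rectCells (D : FrameData) : Set (ℤ × ℤ) :=
  {c | 1 ≤ c.1 ∧ c.1 + 1 ≤ D.m ∧ 1 ≤ c.2 ∧ c.2 + 1 ≤ D.n}

/-- `P` is the frame polyomino determined by the data `D`. -/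
def IsFrame (P : Polyomino) (D : FrameData) : Prop :=
  (↑P.cells : Set (ℤ × ℤ)) = D.rectCells \ D.holeCells

/-! ## The polyomino ideal -/

/-- The order on the variables: `x_(i,j) > x_(k,l)` iff `j > l`, or `j = l` and `i > k`.
`varlt u v` says that the variable `x_u` is smaller than `x_v`. -/
def varlt (u v : ℤ × ℤ) : Prop := u.2 < v.2 ∨ (u.2 = v.2 ∧ u.1 < v.1)

/-- The vertices of `P`, as a type. -/
abbrev PVertex (P : Polyomino) : Type := {v : ℤ × ℤ // v ∈ P.vertexSet}

/-- The polynomial ring `S_P = K[x_v : v ∈ V(P)]`. -/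
abbrev PolyRing (K : Type) [Field K] (P : Polyomino) : Type := MvPolynomial (PVertex P) K

/-- The set of inner 2-minors of `P`. -/
def innerMinors (K : Type) [Field K] (P : Polyomino) : Set (PolyRing K P) :=
  { f | ∃ a b c d : PVertex P,
      IsInnerInterval P a.1 b.1 ∧ c.1 = (a.1.1, b.1.2) ∧ d.1 = (b.1.1, a.1.2) ∧
      f = MvPolynomial.X a * MvPolynomial.X b - MvPolynomial.X c * MvPolynomial.X d }

/-- The polyomino ideal `I_P`. -/
def polyIdeal (K : Type) [Field K] (P : Polyomino) : Ideal (PolyRing K P) :=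
  Ideal.span (innerMinors K P)

/-- The coordinate ring `K[P] = S_P / I_P`. -/
abbrev CoordRing (K : Type) [Field K] (P : Polyomino) : Type :=
  PolyRing K P ⧸ polyIdeal K P

/-! ## Monomial orders, initial ideals and Gröbner bases -/

/-- The (degree) reverse lexicographic order on monomials induced by the
variable order `vlt`: first compare total degrees; for equal total degrees,
`m₁ < m₂` iff the smallest variable whose exponents differ has a larger exponent in `m₁`. -/
def revlexLT {α : Type} (vlt : α → α → Prop) (m₁ m₂ : α →₀ ℕ) : Prop :=
  (m₁.sum fun _ e => e) < (m₂.sum fun _ e => e) ∨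
  ((m₁.sum fun _ e => e) = (m₂.sum fun _ e => e) ∧
    ∃ v, m₂ v < m₁ v ∧ ∀ w, vlt w v → m₁ w = m₂ w)

/-- The monomial order `<` on `S_P`. -/
def pmonLT (P : Polyomino) : (PVertex P →₀ ℕ) → (PVertex P →₀ ℕ) → Prop :=
  revlexLT fun u v => varlt u.1 v.1

/-- `m` is the leading monomial of `f` with respect to the monomial order `lt`. -/
def IsLeadMon {α K : Type} [CommSemiring K] (lt : (α →₀ ℕ) → (α →₀ ℕ) → Prop)
    (f : MvPolynomial α K) (m : α →₀ ℕ) : Prop :=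
  m ∈ f.support ∧ ∀ m' ∈ f.support, m' ≠ m → lt m' m

/-- The initial ideal of `I` with respect to the monomial order `lt`: the ideal generated by
the leading monomials of the nonzero elements of `I`. -/
def initialIdeal {α K : Type} [CommSemiring K] (lt : (α →₀ ℕ) → (α →₀ ℕ) → Prop)
    (I : Ideal (MvPolynomial α K)) : Ideal (MvPolynomial α K) :=
  Ideal.span { g | ∃ f ∈ I, f ≠ 0 ∧ ∃ m, IsLeadMon lt f m ∧ g = MvPolynomial.monomial m 1 }

/-- The initial ideal `in_<(I_P)`. -/
def inIdeal (K : Type) [Field K] (P : Polyomino) : Ideal (PolyRing K P) :=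
  initialIdeal (pmonLT P) (polyIdeal K P)

/-- `G` is a Gröbner basis of `I` with respect to `lt`. -/
def IsGroebnerBasis {α K : Type} [CommSemiring K] (lt : (α →₀ ℕ) → (α →₀ ℕ) → Prop)
    (G : Set (MvPolynomial α K)) (I : Ideal (MvPolynomial α K)) : Prop :=
  G ⊆ (I : Set (MvPolynomial α K)) ∧
  initialIdeal lt I =
    Ideal.span { g | ∃ f ∈ G, ∃ m, IsLeadMon lt f m ∧ g = MvPolynomial.monomial m 1 }

/-- `G` is the reduced Gröbner basis of `I` with respect to `lt`: it is a Gröbner basis,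
each element is monic, and no monomial occurring in an element of `G` is divisible by the
leading monomial of a different element of `G`. -/
def IsReducedGroebnerBasis {α K : Type} [CommSemiring K] (lt : (α →₀ ℕ) → (α →₀ ℕ) → Prop)
    (G : Set (MvPolynomial α K)) (I : Ideal (MvPolynomial α K)) : Prop :=
  IsGroebnerBasis lt G I ∧
  (∀ f ∈ G, ∃ m, IsLeadMon lt f m ∧ MvPolynomial.coeff m f = 1) ∧
  (∀ f ∈ G, ∀ m ∈ (f : MvPolynomial α K).support, ∀ f' ∈ G, f' ≠ f →
    ∀ m', IsLeadMon lt f' m' → ¬ m' ≤ m)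

/-! ## The simplicial complex Δ(P) -/

/-- The squarefree exponent vector supported on `W ∩ V(P)`. -/
def expOf (P : Polyomino) (W : Finset (ℤ × ℤ)) : PVertex P →₀ ℕ :=
  ∑ v ∈ P.vertexSet.attach, if v.1 ∈ W then Finsupp.single v 1 else 0

/-- `W` is a face of the simplicial complex `Δ(P)` whose Stanley–Reisner ideal is
`in_<(I_P)`: `W ⊆ V(P)` and the product of the variables indexed by `W` is not in
`in_<(I_P)`. -/
def IsFace (K : Type) [Field K] (P : Polyomino) (W : Finset (ℤ × ℤ)) : Prop :=
  (↑W : Set (ℤ × ℤ)) ⊆ (↑P.vertexSet : Set (ℤ × ℤ)) ∧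
  MvPolynomial.monomial (expOf P W) (1 : K) ∉ inIdeal K P

/-- `W` is a facet (maximal face) of `Δ(P)`. -/
def IsFacet (K : Type) [Field K] (P : Polyomino) (W : Finset (ℤ × ℤ)) : Prop :=
  IsFace K P W ∧ ∀ W' : Finset (ℤ × ℤ), IsFace K P W' → W ⊆ W' → W = W'

/-- `{p, q, r}` is a step of the face `W`, with lower right corner `q`. -/
def IsStep (P : Polyomino) (W : Finset (ℤ × ℤ)) (p q r : ℤ × ℤ) : Prop :=
  p ∈ W ∧ q ∈ W ∧ r ∈ W ∧
  p.2 = q.2 ∧ q.1 = r.1 ∧ p.1 < q.1 ∧ q.2 < r.2 ∧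
  (∀ w ∈ W, w.2 = p.2 → p.1 < w.1 → w.1 < q.1 → False) ∧
  (∀ w ∈ W, w.1 = q.1 → q.2 < w.2 → w.2 < r.2 → False) ∧
  (q.1 - 1, q.2) ∈ P.cells

/-- The number of steps of a face `W`. -/
def stepCount (P : Polyomino) (W : Finset (ℤ × ℤ)) : ℕ :=
  Set.ncard { t : (ℤ × ℤ) × (ℤ × ℤ) × (ℤ × ℤ) | IsStep P W t.1 t.2.1 t.2.2 }

/-- The simplicial complex generated by a collection of subsets. -/
def genComplex (F : Set (Finset (ℤ × ℤ))) : Set (Finset (ℤ × ℤ)) :=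
  { W | ∃ G ∈ F, W ⊆ G }

/-- The lexicographic order on facets: `flexLT F G` iff, listing the elements of `F` and `G`
in decreasing order with respect to the total order on `V(P)`, at the first position where
the lists differ the element of `F` is greater.  Equivalently, the largest element of the
symmetric difference belongs to `F`. -/
def flexLT (F G : Finset (ℤ × ℤ)) : Prop :=
  ∃ v, v ∈ F ∧ v ∉ G ∧ ∀ w, varlt v w → (w ∈ F ↔ w ∈ G)

/-- The facet `F₀` of `Δ(P)`. -/
def FrameData.F0 (D : FrameData) : Finset (ℤ × ℤ) :=
  Finset.Icc ((1 : ℤ), (1 : ℤ)) (1, D.n) ∪ Finset.Icc ((1 : ℤ), D.n) (D.m, D.n) ∪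
    (D.S2.toFinset \ {(D.a0, D.b0), (D.ak, D.bk)})

/-! ## Edge intervals -/

/-- The horizontal unit edge from `(x, y)` to `(x + 1, y)` is an edge of a cell of `P`. -/
def hEdge (P : Polyomino) (x y : ℤ) : Prop :=
  (x, y) ∈ P.cells ∨ (x, y - 1) ∈ P.cells

/-- The vertical unit edge from `(x, y)` to `(x, y + 1)` is an edge of a cell of `P`. -/
def vEdge (P : Polyomino) (x y : ℤ) : Prop :=
  (x, y) ∈ P.cells ∨ (x - 1, y) ∈ P.cells

/-- `[(i, j), (k, j)]` is a maximal horizontal edge interval of `P`. -/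
def IsMaxHEdgeInterval (P : Polyomino) (i k j : ℤ) : Prop :=
  i < k ∧ (∀ l, i ≤ l → l < k → hEdge P l j) ∧ ¬ hEdge P (i - 1) j ∧ ¬ hEdge P k j

/-- `[(x, j), (x, l)]` is a maximal vertical edge interval of `P`. -/
def IsMaxVEdgeInterval (P : Polyomino) (x j l : ℤ) : Prop :=
  j < l ∧ (∀ y, j ≤ y → y < l → vEdge P x y) ∧ ¬ vEdge P x (j - 1) ∧ ¬ vEdge P x l

/-- The vertex set of the collection of cells of `P` contained in the interval `[a, b]`. -/
def boxVertexSet (P : Polyomino) (a b : ℤ × ℤ) : Set (ℤ × ℤ) :=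
  { v | ∃ c ∈ P.cells, cellInInterval a b c ∧ v ∈ cellVertices c }

/-! ## Rook configurations -/

/-- Two (distinct) cells of `P` are in attacking position: they belong to the same row or
the same column of cells of `P`. -/
def attacking (P : Polyomino) (c d : ℤ × ℤ) : Prop :=
  c ≠ d ∧
  ((c.2 = d.2 ∧ ∀ x, min c.1 d.1 ≤ x → x ≤ max c.1 d.1 → (x, c.2) ∈ P.cells) ∨
   (c.1 = d.1 ∧ ∀ y, min c.2 d.2 ≤ y → y ≤ max c.2 d.2 → (c.1, y) ∈ P.cells))

/-- `R` is a configuration of pairwise non-attacking rooks placed on cells of `P`. -/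
def IsRookConfig (P : Polyomino) (R : Finset (ℤ × ℤ)) : Prop :=
  (↑R : Set (ℤ × ℤ)) ⊆ (↑P.cells : Set (ℤ × ℤ)) ∧ ∀ c ∈ R, ∀ d ∈ R, ¬ attacking P c d

/-- Two cells are the diagonal cells of an inner interval of `P`. -/
def diagPair (P : Polyomino) (c d : ℤ × ℤ) : Prop :=
  ∃ a b : ℤ × ℤ, IsInnerInterval P a b ∧
    ((c = a ∧ d = (b.1 - 1, b.2 - 1)) ∨ (d = a ∧ c = (b.1 - 1, b.2 - 1)))

/-- Two cells are the anti-diagonal cells of an inner interval of `P`. -/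
def antiDiagPair (P : Polyomino) (c d : ℤ × ℤ) : Prop :=
  ∃ a b : ℤ × ℤ, IsInnerInterval P a b ∧
    ((c = (a.1, b.2 - 1) ∧ d = (b.1 - 1, a.2)) ∨ (d = (a.1, b.2 - 1) ∧ c = (b.1 - 1, a.2)))

/-- One switch: replace two rooks placed on the diagonal cells of an inner interval by rooks
on its anti-diagonal cells, or vice versa. -/
def switchStep (P : Polyomino) (R R' : Finset (ℤ × ℤ)) : Prop :=
  ∃ a b : ℤ × ℤ, IsInnerInterval P a b ∧
    ((a ∈ R ∧ (b.1 - 1, b.2 - 1) ∈ R ∧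
      R' = insert (a.1, b.2 - 1) (insert (b.1 - 1, a.2)
        ((R.erase a).erase (b.1 - 1, b.2 - 1)))) ∨
     ((a.1, b.2 - 1) ∈ R ∧ (b.1 - 1, a.2) ∈ R ∧
      R' = insert a (insert (b.1 - 1, b.2 - 1)
        ((R.erase (a.1, b.2 - 1)).erase (b.1 - 1, a.2)))))

/-- A canonical configuration: no two rooks are in anti-diagonal position. -/
def IsCanonical (P : Polyomino) (R : Finset (ℤ × ℤ)) : Prop :=
  ∀ c ∈ R, ∀ d ∈ R, ¬ antiDiagPair P c d

/-- The `k`-rook configurations of `P`, as a type. -/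
def RookConfigType (P : Polyomino) (k : ℕ) : Type :=
  { R : Finset (ℤ × ℤ) // IsRookConfig P R ∧ R.card = k }

/-- `r̃_k`: the number of equivalence classes of `k`-rook configurations of `P` under the
equivalence generated by switches. -/
def rtil (P : Polyomino) (k : ℕ) : ℕ :=
  Nat.card (Quot fun R S : RookConfigType P k => switchStep P R.1 S.1)

/-- The rook number of `P`: the maximum number of pairwise non-attacking rooks in `P`. -/
def rookNumber (P : Polyomino) : ℕ :=
  sSup { k | ∃ R : Finset (ℤ × ℤ), IsRookConfig P R ∧ R.card = k }

/-! ## Hilbert functions -/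

/-- The Hilbert function of the standard graded algebra `K[P]`. -/
def hilbertFunction (K : Type) [Field K] (P : Polyomino) (k : ℕ) : ℕ :=
  Module.finrank K
    (Submodule.map (Ideal.Quotient.mkₐ K (polyIdeal K P)).toLinearMap
      (MvPolynomial.homogeneousSubmodule (PVertex P) K k))

/-- The Hilbert–Poincaré series of `K[P]`, as a power series over `ℤ`. -/
def hilbertSeries (K : Type) [Field K] (P : Polyomino) : PowerSeries ℤ :=
  PowerSeries.mk fun k => (hilbertFunction K P k : ℤ)

set_option synthInstance.maxHeartbeats 1000000 in
/-- `K[P]` is Cohen–Macaulay: there exists a regular sequence, consisting of elements of the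
irrelevant maximal ideal, whose length equals the Krull dimension of `K[P]`. -/
def IsCMCoordRing (K : Type) [Field K] (P : Polyomino) : Prop :=
  ∃ rs : List (CoordRing K P),
    RingTheory.Sequence.IsRegular (CoordRing K P) rs ∧
    (∀ r ∈ rs, r ∈ Ideal.map (Ideal.Quotient.mk (polyIdeal K P))
      (Ideal.span (Set.range (MvPolynomial.X : PVertex P → PolyRing K P)))) ∧
    (rs.length : WithBot (WithTop ℕ)) = ringKrullDim (CoordRing K P)

/-! ## Maximal chains and descents (for parallelogram polyominoes) -/

/-- `C` is a maximal chain of the poset `V(P)` (with the componentwise order). -/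
def IsMaximalChainOn (P : Polyomino) (C : Finset (ℤ × ℤ)) : Prop :=
  (↑C : Set (ℤ × ℤ)) ⊆ (↑P.vertexSet : Set (ℤ × ℤ)) ∧
  IsChain (· ≤ ·) (↑C : Set (ℤ × ℤ)) ∧
  ∀ C' : Finset (ℤ × ℤ), (↑C' : Set (ℤ × ℤ)) ⊆ (↑P.vertexSet : Set (ℤ × ℤ)) →
    IsChain (· ≤ ·) (↑C' : Set (ℤ × ℤ)) → C ⊆ C' → C = C'

/-- The chain `C` has a descent at the cell of `P` with lower left corner `c`. -/
def descentAt (P : Polyomino) (C : Finset (ℤ × ℤ)) (c : ℤ × ℤ) : Prop :=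
  c ∈ P.cells ∧ c ∈ C ∧ (c.1 + 1, c.2) ∈ C ∧ (c.1 + 1, c.2 + 1) ∈ C

/-- The number of descents of the chain `C`. -/
def descentCount (P : Polyomino) (C : Finset (ℤ × ℤ)) : ℕ :=
  Set.ncard { c : ℤ × ℤ | descentAt P C c }

/-! ## Minimal graded free resolutions and Castelnuovo–Mumford regularity -/

/-- A finite minimal graded free resolution of `S_P / I` over `S_P`:
`F_d = ⊕_{i} S_P(-tw d i)` with `F_0 = S_P`, differentials given by matrices of homogeneous
polynomials of the appropriate degrees with entries in the irrelevant maximal ideal,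
exact away from homological degree `0` and with image `I` in homological degree `0`. -/
structure MinimalGradedFreeResolution (K : Type) [Field K] (P : Polyomino)
    (I : Ideal (PolyRing K P)) : Type where
  len : ℕ
  t : ℕ → ℕ
  tw : (d : ℕ) → Fin (t d) → ℤ
  mat : (d : ℕ) → Matrix (Fin (t d)) (Fin (t (d + 1))) (PolyRing K P)
  t0 : t 0 = 1
  tw0 : ∀ i, tw 0 i = 0
  finite : ∀ d, len < d → t d = 0
  graded : ∀ d i j, mat d i j = 0 ∨
    ∃ e : ℕ, (e : ℤ) = tw (d + 1) j - tw d i ∧ (mat d i j).IsHomogeneous e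
  minimal : ∀ d i j, MvPolynomial.coeff 0 (mat d i j) = 0
  aug : LinearMap.range (mat 0).mulVecLin =
    Submodule.pi Set.univ (fun _ : Fin (t 0) => I)
  isexact : ∀ d, LinearMap.range (mat (d + 1)).mulVecLin = LinearMap.ker (mat d).mulVecLin

end


open RingTheory.Sequence in
lemma mvX_isRegular (K : Type*) [Field K] (N : ℕ) :
    IsRegular (MvPolynomial (Fin N) K)
      (List.ofFn (fun i : Fin N => (MvPolynomial.X i : MvPolynomial (Fin N) K))) := by
  have key : ∀ k : ℕ, k ≤ N → Ideal.ofList ((List.ofFn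
      (fun i : Fin N => (MvPolynomial.X i : MvPolynomial (Fin N) K))).take k)
      = Ideal.span (MvPolynomial.X '' {j : Fin N | j.1 < k}) := by
    intro k hk
    unfold Ideal.ofList
    congr 1
    ext p
    simp only [Set.mem_setOf_eq, List.mem_take_iff_getElem, Set.mem_image, List.length_ofFn,
      List.getElem_ofFn]
    constructor
    · rintro ⟨i, hi, rfl⟩
      exact ⟨⟨i, by omega⟩, by simp; omega, rfl⟩
    · rintro ⟨j, hj, rfl⟩
      exact ⟨j.1, by omega, rfl⟩
  refine ⟨⟨fun i h => ?_⟩, ?_⟩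
  · have hi : i < N := by simpa using h
    rw [isSMulRegular_quotient_iff_mem_of_smul_mem, key i hi.le]
    intro f hf
    simp only [smul_eq_mul, List.getElem_ofFn, Ideal.mul_top] at hf ⊢
    rw [MvPolynomial.mem_ideal_span_X_image] at hf ⊢
    intro m hm
    obtain ⟨j, hj, hne⟩ := hf (m + Finsupp.single ⟨i, hi⟩ 1) (by
      rw [MvPolynomial.mem_support_iff, add_comm, MvPolynomial.coeff_X_mul]
      exact MvPolynomial.mem_support_iff.mp hm)
    refine ⟨j, hj, ?_⟩
    have : (⟨i, hi⟩ : Fin N) ≠ j := by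
      rintro rfl; simp at hj
    simpa [Finsupp.single_apply, this] using hne
  · have h2 := key N le_rfl
    rw [List.take_of_length_le (by simp)] at h2
    rw [h2]
    intro htop
    have h1 : (1 : MvPolynomial (Fin N) K) ∈ Ideal.span (MvPolynomial.X '' {j : Fin N | j.1 < N}) := by
      have : (1 : MvPolynomial (Fin N) K) ∈ (⊤ : Ideal (MvPolynomial (Fin N) K)) := trivial
      rw [htop] at this
      simpa using this
    rw [MvPolynomial.mem_ideal_span_X_image] at h1
    obtain ⟨j, _, hj⟩ := h1 0 (by simp)
    simp at hj

lemma krull_of_finite_free (A R : Type*) [CommRing A] [CommRing R] [Algebra A R]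
    [Module.Free A R] [Module.Finite A R] [Nontrivial R] [Nontrivial A] :
    ringKrullDim R = ringKrullDim A := by
  have hint : Algebra.IsIntegral A R := inferInstance
  have hinj : FaithfulSMul A R := inferInstance
  apply le_antisymm
  · apply Order.krullDim_le_of_strictMono (PrimeSpectrum.comap (algebraMap A R))
    intro p q hpq
    exact Ideal.IsIntegral.comap_lt_comap (R := A) (A := R) (I := p.asIdeal) (J := q.asIdeal) hpq
  · refine iSup_le fun p => ?_
    obtain ⟨⟨Q, hQ, hQ'⟩⟩ := Ideal.nonempty_primesOver (S := R) p.last.asIdeal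
    obtain ⟨L, hL, -⟩ := Ideal.exists_ltSeries_of_hasGoingDown (S := R) p Q
    rw [← hL]
    exact le_iSup (fun (L : LTSeries (PrimeSpectrum R)) => (L.length : WithBot ℕ∞)) L

open RingTheory.Sequence in
lemma cm_of_free {K R : Type*} [Field K] [CommRing R] [Nontrivial R] {N : ℕ}
    [Algebra (MvPolynomial (Fin N) K) R] [Module.Free (MvPolynomial (Fin N) K) R]
    [Module.Finite (MvPolynomial (Fin N) K) R] :
    IsRegular R (List.ofFn fun i : Fin N => algebraMap (MvPolynomial (Fin N) K) R (.X i)) ∧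
      ringKrullDim R = N := by
  constructor
  · have := (mvX_isRegular K N).of_faithfullyFlat (S := R)
    rwa [List.map_ofFn] at this
  · rw [krull_of_finite_free (MvPolynomial (Fin N) K) R,
      MvPolynomial.ringKrullDim_of_isNoetherianRing]
    simp


lemma unitri_bijective {ι K V : Type*} [Field K] [AddCommGroup V] [Module K V]
    (b : Module.Basis ι K V) (ρ : ι → ℕ) (T : V →ₗ[K] V)
    (h : ∀ i, T (b i) - b i ∈ Submodule.span K (b '' {j | ρ j < ρ i})) :
    Function.Bijective T := by
  set F : ℕ → Submodule K V := fun n => Submodule.span K (b '' {j | ρ j < n}) with hF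
  have hmono : ∀ {m n}, m ≤ n → F m ≤ F n := fun {m n} hmn =>
    Submodule.span_mono (Set.image_mono fun j (hj : ρ j < m) => lt_of_lt_of_le hj hmn)
  set ν : Module.End K V := 1 - T with hν
  have hstep : ∀ n, ∀ x ∈ F (n+1), ν x ∈ F n := by
    intro n x hx
    have : F (n+1) ≤ (F n).comap ν := by
      rw [hF, Submodule.span_le]
      rintro _ ⟨j, hj, rfl⟩
      have h1 := h j
      have h2 : ν (b j) = -(T (b j) - b j) := by simp [hν]
      show ν (b j) ∈ F n
      rw [h2]
      exact (F n).neg_mem (hmono (Nat.lt_succ_iff.mp hj) h1)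
    exact this hx
  have hF0 : F 0 = ⊥ := by simp [hF]
  have hnil : ∀ n, ∀ x ∈ F n, (ν ^ n) x = 0 := by
    intro n
    induction n with
    | zero => intro x hx; rw [hF0] at hx; simpa using hx
    | succ n ih =>
      intro x hx
      rw [pow_succ, Module.End.mul_apply]
      exact ih _ (hstep n x hx)
  have hall : ∀ x, ∃ n, x ∈ F n := by
    intro x
    have hx : x ∈ Submodule.span K (Set.range b) := by rw [b.span_eq]; trivial
    induction hx using Submodule.span_induction with
    | zero => exact ⟨0, zero_mem _⟩
    | mem x hx =>
      obtain ⟨i, rfl⟩ := hx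
      exact ⟨ρ i + 1, Submodule.subset_span ⟨i, Nat.lt_succ_self _, rfl⟩⟩
    | add x y _ _ hx hy =>
      obtain ⟨m, hm⟩ := hx
      obtain ⟨n, hn⟩ := hy
      exact ⟨max m n, add_mem (hmono (le_max_left _ _) hm) (hmono (le_max_right _ _) hn)⟩
    | smul c x _ hx =>
      obtain ⟨m, hm⟩ := hx
      exact ⟨m, Submodule.smul_mem _ _ hm⟩
  have hT : T = 1 - ν := by simp [hν]
  constructor
  · rw [← LinearMap.ker_eq_bot, LinearMap.ker_eq_bot']
    intro x hx
    have h1 : ν x = x := by simp [hν, hx]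
    have h2 : ∀ n, (ν ^ n) x = x := by
      intro n
      induction n with
      | zero => simp
      | succ n ih => rw [pow_succ, Module.End.mul_apply, h1, ih]
    obtain ⟨n, hn⟩ := hall x
    rw [← h2 n, hnil n x hn]
  · intro x
    obtain ⟨n, hn⟩ := hall x
    refine ⟨(∑ i ∈ Finset.range n, ν ^ i) x, ?_⟩
    have := mul_neg_geom_sum ν n
    rw [← hT] at this
    rw [← Module.End.mul_apply, this]
    simp [hnil n x hn]

lemma finsupp_step_induction {σ : Type*} {p : (σ →₀ ℕ) → Prop} (h0 : p 0)
    (hs : ∀ γ i, p γ → p (γ + Finsupp.single i 1)) (γ : σ →₀ ℕ) : p γ := by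
  classical
  induction γ using Finsupp.induction with
  | zero => exact h0
  | single_add a n f _ _ ih =>
    clear * - ih hs
    induction n with
    | zero => simpa using ih
    | succ n ih2 =>
      have := hs _ a ih2
      have h3 : Finsupp.single a n + f + Finsupp.single a 1 = Finsupp.single a (n+1) + f := by
        rw [Finsupp.single_add]; abel
      rwa [h3] at this

theorem free_of_unitri {K R S : Type*} [Field K] [CommRing R] [Algebra K R] [Finite S] {N : ℕ}
    (b : Module.Basis (S × (Fin N → ℕ)) K R) (ρ : S × (Fin N → ℕ) → ℕ)
    (θ : Fin N → R) (k : S → Fin N → ℕ) (hk : ∀ s i, 0 < k s i) (Λ : ℕ)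
    (hρ : ∀ s α i, ρ (s, α + Pi.single i (k s i)) = ρ (s, α) + Λ)
    (hθ : ∀ s α i, θ i * b (s, α) - b (s, α + Pi.single i (k s i)) ∈
      Submodule.span K (b '' {j | ρ j < ρ (s, α) + Λ}))
    [Algebra (MvPolynomial (Fin N) K) R] [IsScalarTower K (MvPolynomial (Fin N) K) R]
    (halg : ∀ i, algebraMap (MvPolynomial (Fin N) K) R (.X i) = θ i) :
    Module.Free (MvPolynomial (Fin N) K) R ∧ Module.Finite (MvPolynomial (Fin N) K) R := by
  classical
  set F : ℕ → Submodule K R := fun n => Submodule.span K (b '' {j | ρ j < n}) with hF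
  have hmono : ∀ {m n}, m ≤ n → F m ≤ F n := fun {m n} hmn =>
    Submodule.span_mono (Set.image_mono fun j (hj : ρ j < m) => lt_of_lt_of_le hj hmn)
  have hmul : ∀ i n, ∀ x ∈ F n, θ i * x ∈ F (n + Λ) := by
    intro i n x hx
    have : F n ≤ (F (n + Λ)).comap (LinearMap.mulLeft K (θ i)) := by
      rw [hF, Submodule.span_le]
      rintro _ ⟨⟨s, α⟩, hj, rfl⟩
      have hj : ρ (s, α) < n := hj
      show θ i * b (s, α) ∈ F (n + Λ)
      rw [← sub_add_cancel (θ i * b (s, α)) (b (s, α + Pi.single i (k s i)))]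
      refine add_mem (hmono (by omega) (hθ s α i)) (Submodule.subset_span ⟨_, ?_, rfl⟩)
      show ρ _ < _
      rw [hρ]; omega
    exact this hx
  -- action of a monomial
  set Ψ : S → (Fin N → ℕ) → (Fin N →₀ ℕ) → (S × (Fin N → ℕ)) := fun s r γ =>
    (s, fun i => r i + k s i * γ i) with hΨ
  have hstepρ : ∀ s r γ i, ρ (Ψ s r (γ + Finsupp.single i 1)) = ρ (Ψ s r γ) + Λ ∧
      Ψ s r (γ + Finsupp.single i 1) = (s, (Ψ s r γ).2 + Pi.single i (k s i)) := by
    intro s r γ i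
    have : Ψ s r (γ + Finsupp.single i 1) = (s, (Ψ s r γ).2 + Pi.single i (k s i)) := by
      simp only [hΨ]
      congr 1
      ext j
      by_cases hij : i = j
      · subst hij; simp; ring
      · simp [Finsupp.single_apply, Pi.single_apply, hij, Ne.symm hij]
    refine ⟨?_, this⟩
    rw [this, hρ]
  have hmain : ∀ s r γ, algebraMap (MvPolynomial (Fin N) K) R (MvPolynomial.monomial γ 1)
      * b (s, r) - b (Ψ s r γ) ∈ F (ρ (Ψ s r γ)) := by
    intro s r γ
    induction γ using finsupp_step_induction with
    | h0 => simp [hΨ]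
    | hs γ i ih =>
      have h1 : (MvPolynomial.monomial (γ + Finsupp.single i 1) (1 : K))
          = MvPolynomial.X i * MvPolynomial.monomial γ 1 := by
        rw [MvPolynomial.X, MvPolynomial.monomial_mul, add_comm, one_mul]
      obtain ⟨h2, h3⟩ := hstepρ s r γ i
      rw [h2, h1, map_mul, halg, h3]
      have h4 := hmul i _ _ ih
      have h5 := hθ s (Ψ s r γ).2 i
      have h6 := add_mem h4 h5
      convert h6 using 1
      have h7 : Ψ s r γ = (s, (Ψ s r γ).2) := rfl
      rw [← h7]; ring
  let J := {p : S × (Fin N → ℕ) // ∀ i, p.2 i < k p.1 i}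
  have hJ : Finite J := by
    let f : J → S × ((i : Fin N) → ℕ) := fun p => p.1
    have : Set.Finite {p : S × (Fin N → ℕ) | ∀ i, p.2 i < k p.1 i} := by
      have h8 : {p : S × (Fin N → ℕ) | ∀ i, p.2 i < k p.1 i} ⊆
          ⋃ s : S, (fun r => (s, r)) '' (Set.pi Set.univ fun i => Set.Iio (k s i)) := by
        rintro ⟨s, r⟩ h
        simp only [Set.mem_iUnion]
        exact ⟨s, r, fun i _ => h i, rfl⟩
      exact (Set.finite_iUnion fun s => (Set.Finite.pi fun i => Set.finite_Iio _).image _).subset h8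
    exact this
  let E : (Σ _ : J, Fin N →₀ ℕ) ≃ S × (Fin N → ℕ) :=
    { toFun := fun x => Ψ x.1.1.1 x.1.1.2 x.2
      invFun := fun p => ⟨⟨(p.1, fun i => p.2 i % k p.1 i), fun i => Nat.mod_lt _ (hk _ _)⟩,
        Finsupp.equivFunOnFinite.symm fun i => p.2 i / k p.1 i⟩
      left_inv := by
        rintro ⟨⟨⟨s, r⟩, hr⟩, γ⟩
        have h1 : (fun i => (r i + k s i * γ i) % k s i) = r := by
          ext i; rw [Nat.add_mul_mod_self_left, Nat.mod_eq_of_lt (hr i)]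
        have h2 : Finsupp.equivFunOnFinite.symm (fun i => (r i + k s i * γ i) / k s i) = γ := by
          ext i
          simp [Nat.add_mul_div_left _ _ (hk s i), Nat.div_eq_of_lt (hr i)]
        simp only [hΨ, h2]
        congr 1
        exact Subtype.ext (Prod.ext rfl h1)
      right_inv := by
        rintro ⟨s, α⟩
        simp [hΨ, Nat.mod_add_div] }
  let A := MvPolynomial (Fin N) K
  let Φ : (J →₀ A) →ₗ[A] R := Finsupp.linearCombination A fun j : J => b j.1
  let B := Finsupp.basis (fun _ : J => MvPolynomial.basisMonomials (Fin N) K)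
  let T : R →ₗ[K] R := b.constr K fun p =>
    Φ (B (E.symm p))
  have hT : Function.Bijective T := by
    apply unitri_bijective b ρ
    intro p
    obtain ⟨⟨j, γ⟩, rfl⟩ := E.surjective p
    have h1 : T (b (E ⟨j, γ⟩)) = algebraMap (MvPolynomial (Fin N) K) R (MvPolynomial.monomial γ 1)
      * b (j.1.1, j.1.2) := by
      simp only [T, Module.Basis.constr_basis, Equiv.symm_apply_apply, B, Finsupp.coe_basis, Φ]
      rw [Finsupp.linearCombination_single, Algebra.smul_def, MvPolynomial.coe_basisMonomials]
    rw [h1]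
    exact hmain _ _ _
  have hΦ : Function.Bijective Φ := by
    have h1 : (Φ.restrictScalars K) = T ∘ₗ (B.equiv b E).toLinearMap := by
      apply B.ext
      intro x
      simp [T]
    have h2 : (Φ : (J →₀ A) → R) = T ∘ (B.equiv b E) := by
      funext x
      exact congrArg (fun f => f x) h1
    rw [h2]
    exact hT.comp (B.equiv b E).bijective
  let Φe := LinearEquiv.ofBijective Φ hΦ
  exact ⟨Module.Free.of_equiv Φe, Module.Finite.equiv Φe⟩


lemma isIntegrallyClosed_of_retract {A T : Type*} [CommRing A] [CommRing T] [IsDomain A]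
    [IsDomain T] [IsIntegrallyClosed T] (f : A →+* T) (hf : Function.Injective f)
    (r : T → A) (hr1 : r 1 = 1) (hr : ∀ a t, r (f a * t) = a * r t) : IsIntegrallyClosed A := by
  rw [isIntegrallyClosed_iff (FractionRing A)]
  intro x hx
  obtain ⟨a, b, hb, rfl⟩ := IsFractionRing.div_surjective (A := A) x
  let L := FractionRing T
  let g : A →+* L := (algebraMap T L).comp f
  have hg : Function.Injective g := (IsFractionRing.injective T L).comp hf
  let F : FractionRing A →+* L := IsFractionRing.lift hg
  have hFa : ∀ c, F (algebraMap A _ c) = algebraMap T L (f c) := fun c =>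
    IsFractionRing.lift_algebraMap hg c
  have hint : IsIntegral T (F (algebraMap A _ a / algebraMap A _ b)) := by
    refine IsIntegral.map_of_comp_eq f F ?_ hx
    ext c
    simp [hFa]
  obtain ⟨t, ht⟩ := (isIntegrallyClosed_iff L).mp inferInstance hint
  have hb0 : b ≠ 0 := nonZeroDivisors.ne_zero hb
  have hfb : algebraMap T L (f b) ≠ 0 := by
    rw [Ne, IsFractionRing.to_map_eq_zero_iff, map_eq_zero_iff f hf]; exact hb0
  rw [map_div₀, hFa, hFa, eq_div_iff hfb, ← map_mul] at ht
  have h1 : t * f b = f a := IsFractionRing.injective T L ht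
  have h2 : a = b * r t := by
    have h3 := hr a 1
    rw [mul_one, hr1, mul_one, ← h1, mul_comm, hr] at h3
    exact h3.symm
  refine ⟨r t, ?_⟩
  have hb1 : algebraMap A (FractionRing A) b ≠ 0 := by
    rw [Ne, IsFractionRing.to_map_eq_zero_iff]; exact hb0
  rw [eq_div_iff hb1, ← map_mul, mul_comm, ← h2]

theorem normal_of_slack {K M E : Type*} [Field K] [AddCommMonoid M]
    (s : M →+ (E →₀ ℕ)) (hs : Function.Injective s)
    (hfull : ∀ h u h', s h + u = s h' → u ∈ Set.range s) :
    IsDomain (AddMonoidAlgebra K M) ∧ IsIntegrallyClosed (AddMonoidAlgebra K M) := by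
  classical
  let f : AddMonoidAlgebra K M →+* MvPolynomial E K := AddMonoidAlgebra.mapDomainRingHom K s
  have hf : Function.Injective f := AddMonoidAlgebra.mapDomain_injective hs
  have hdom : IsDomain (AddMonoidAlgebra K M) := hf.isDomain
  refine ⟨hdom, ?_⟩
  let B := MvPolynomial.basisMonomials E K
  let r : MvPolynomial E K →ₗ[K] AddMonoidAlgebra K M := B.constr K fun u =>
    if h : u ∈ Set.range s then AddMonoidAlgebra.single h.choose 1 else 0
  have hrs : ∀ h, r (MvPolynomial.monomial (s h) 1) = AddMonoidAlgebra.single h 1 := by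
    intro h
    have h0 : MvPolynomial.monomial (s h) (1:K) = B (s h) := by simp [B]
    have h1 : s h ∈ Set.range s := ⟨h, rfl⟩
    rw [h0, Module.Basis.constr_basis, dif_pos h1, hs h1.choose_spec]
  have hrn : ∀ u, u ∉ Set.range s → r (MvPolynomial.monomial u 1) = 0 := by
    intro u hu
    have h0 : MvPolynomial.monomial u (1:K) = B u := by simp [B]
    rw [h0, Module.Basis.constr_basis, dif_neg hu]
  have hfs : ∀ h, f (AddMonoidAlgebra.single h 1) = MvPolynomial.monomial (s h) (1:K) := by
    intro h
    exact AddMonoidAlgebra.mapDomain_single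
  refine isIntegrallyClosed_of_retract f hf r ?_ ?_
  · have := hrs 0
    rw [map_zero] at this
    exact this
  · intro a t
    have key : ∀ h u, r (f (AddMonoidAlgebra.single h 1) * MvPolynomial.monomial u 1)
        = AddMonoidAlgebra.single h 1 * r (MvPolynomial.monomial u 1) := by
      intro h u
      rw [hfs, MvPolynomial.monomial_mul, one_mul]
      by_cases hu : u ∈ Set.range s
      · obtain ⟨h', rfl⟩ := hu
        rw [← map_add, hrs, hrs, AddMonoidAlgebra.single_mul_single, one_mul]
      · rw [hrn u hu, mul_zero, hrn]
        rintro ⟨h', hh⟩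
        exact hu (hfull h u h' hh.symm)
    induction a using AddMonoidAlgebra.induction_linear with
    | zero => simp
    | add a a' ha ha' => simp only [map_add, add_mul, ha, ha']
    | single h c =>
      have hc : (AddMonoidAlgebra.single h c : AddMonoidAlgebra K M)
          = c • AddMonoidAlgebra.single h 1 := by simp
      have hfc : f (c • AddMonoidAlgebra.single h 1) = c • f (AddMonoidAlgebra.single h 1) := by
        rw [hfs, ← hc, MvPolynomial.smul_monomial, smul_eq_mul, mul_one]
        exact AddMonoidAlgebra.mapDomain_single
      rw [hc, hfc, smul_mul_assoc, smul_mul_assoc, map_smul]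
      congr 1
      have hlin : r ∘ₗ LinearMap.mulLeft K (f (AddMonoidAlgebra.single h 1))
          = LinearMap.mulLeft K (AddMonoidAlgebra.single h 1) ∘ₗ r := by
        apply B.ext
        intro u
        have h0 : B u = MvPolynomial.monomial u (1:K) := by simp [B]
        rw [h0]
        exact key h u
      exact congrArg (fun g => g t) hlin


/-- Shift-invariant data on `D × ℤ`: a total order `o` and a sub-relation `C`. -/
structure AffSys (D : Type) where
  o : D × ℤ → D × ℤ → Prop
  irrefl : ∀ q, ¬ o q q
  trans : ∀ {p q r}, o p q → o q r → o p r
  tri : ∀ p q, o p q ∨ p = q ∨ o q p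
  shift : ∀ {d e s t} (u : ℤ), o (d, s) (e, t) → o (d, s + u) (e, t + u)
  succ : ∀ d t, o (d, t) (d, t + 1)
  C : D × ℤ → D × ℤ → Prop
  C_o : ∀ {p q}, C p q → o p q
  C_shift : ∀ {d e s t} (u : ℤ), C (d, s) (e, t) → C (d, s + u) (e, t + u)
  W : ℤ
  W_pos : 1 ≤ W
  far : ∀ d e s t, s + W ≤ t → C (d, s) (e, t)
  d0 : D

namespace AffSys

variable {D : Type} (A : AffSys D)

/-- Shift-invariant total orders containing `C`. -/
@[ext]
structure Ord where
  lt : D × ℤ → D × ℤ → Prop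
  irrefl : ∀ q, ¬ lt q q
  trans : ∀ {p q r}, lt p q → lt q r → lt p r
  tri : ∀ p q, lt p q ∨ p = q ∨ lt q p
  shift : ∀ {d e s t} (u : ℤ), lt (d, s) (e, t) → lt (d, s + u) (e, t + u)
  succ : ∀ d t, lt (d, t) (d, t + 1)
  C_lt : ∀ {p q}, A.C p q → lt p q

variable {A}

namespace Ord

variable (s : A.Ord)

lemma asymm {p q} (h : s.lt p q) : ¬ s.lt q p := fun h' => s.irrefl _ (s.trans h h')

lemma lt_same {d : D} {t u : ℤ} : s.lt (d, t) (d, u) ↔ t < u := by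
  have key : ∀ n : ℕ, s.lt (d, t) (d, t + (n + 1 : ℕ)) := by
    intro n
    induction n with
    | zero => simpa using s.succ d t
    | succ n ih =>
      have := s.trans ih (s.succ d _)
      convert this using 2
      push_cast; ring
  have key2 : ∀ t u : ℤ, (∀ n : ℕ, s.lt (d, t) (d, t + (n + 1 : ℕ))) → t < u →
      s.lt (d, t) (d, u) := by
    intro t u h htu
    have := h (u - t - 1).toNat
    convert this using 2
    push_cast
    rw [Int.toNat_of_nonneg (by omega)]; ring
  constructor
  · intro h
    by_contra hc
    rcases lt_or_eq_of_le (not_lt.mp hc) with h1 | h1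
    · refine s.asymm h (key2 u t ?_ h1)
      intro n
      induction n with
      | zero => simpa using s.succ d u
      | succ n ih =>
        have := s.trans ih (s.succ d _)
        convert this using 2
        push_cast; ring
    · subst h1; exact s.irrefl _ h
  · exact key2 t u key

lemma exists_c (r : D) (q : D × ℤ) : ∃ c : ℤ, ∀ t, s.lt (r, t) q ↔ t < c := by
  obtain ⟨c, hc, hmin⟩ := Int.exists_least_of_bdd (P := fun t => ¬ s.lt (r, t) q)
    ⟨q.2 - A.W, fun z hz => by
      by_contra hlt
      exact hz (s.C_lt (A.far r q.1 z q.2 (by omega)))⟩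
    ⟨q.2 + A.W, s.asymm (s.C_lt (A.far q.1 r q.2 _ le_rfl))⟩
  refine ⟨c, fun t => ⟨fun h => ?_, fun h => ?_⟩⟩
  · by_contra hle
    rcases lt_or_eq_of_le (not_lt.mp hle) with h1 | h1
    · exact hc (s.trans (s.lt_same.mpr h1) h)
    · subst h1; exact hc h
  · by_contra hn
    exact absurd (hmin t hn) (by omega)

noncomputable def c (r : D) (q : D × ℤ) : ℤ := (s.exists_c r q).choose

lemma lt_iff_c (r : D) (q : D × ℤ) (t : ℤ) : s.lt (r, t) q ↔ t < s.c r q :=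
  (s.exists_c r q).choose_spec t

lemma c_self (d : D) (t : ℤ) : s.c d (d, t) = t := by
  have h1 := s.lt_iff_c d (d, t) t
  have h2 := s.lt_iff_c d (d, t) (t - 1)
  rw [s.lt_same] at h1 h2
  omega

lemma shift_iff {d e : D} {a b : ℤ} (u : ℤ) :
    s.lt (d, a + u) (e, b + u) ↔ s.lt (d, a) (e, b) := by
  refine ⟨fun h => ?_, s.shift u⟩
  have := s.shift (-u) h
  simpa using this

lemma c_shift (r d : D) (t u : ℤ) : s.c r (d, t + u) = s.c r (d, t) + u := by
  have h1 : ∀ x, x + u < s.c r (d, t + u) ↔ x < s.c r (d, t) := by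
    intro x
    rw [← s.lt_iff_c, ← s.lt_iff_c, s.shift_iff]
  have h2 := h1 (s.c r (d, t))
  have h3 := h1 (s.c r (d, t) - 1)
  omega

variable [Fintype D]

noncomputable def sig0 (q : D × ℤ) : ℤ := ∑ r : D, s.c r q

lemma sig0_shift (d : D) (t u : ℤ) :
    s.sig0 (d, t + u) = s.sig0 (d, t) + Fintype.card D * u := by
  simp [sig0, c_shift, Finset.sum_add_distrib]

lemma sig0_mono {p q} (h : s.lt p q) : s.sig0 p < s.sig0 q := by
  apply Finset.sum_lt_sum
  · intro r _
    by_contra hlt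
    have h1 : s.lt (r, s.c r q) p := by rw [s.lt_iff_c]; omega
    have h2 := (s.lt_iff_c r q _).mp (s.trans h1 h)
    omega
  · refine ⟨p.1, Finset.mem_univ _, ?_⟩
    have h1 : s.c p.1 p = p.2 := s.c_self p.1 p.2
    rw [h1]
    exact (s.lt_iff_c p.1 q p.2).mp h

noncomputable def shf : ℤ := ∑ d : D, s.sig0 (d, 0) / (Fintype.card D : ℤ)

noncomputable def sig (q : D × ℤ) : ℤ := s.sig0 q - s.shf

lemma sig_shift (d : D) (t u : ℤ) :
    s.sig (d, t + u) = s.sig (d, t) + Fintype.card D * u := by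
  rw [sig, sig, sig0_shift]; ring

lemma sig_mono {p q} (h : s.lt p q) : s.sig p < s.sig q := by
  have := s.sig0_mono h
  unfold sig; omega

lemma sig_lt_iff {p q} : s.sig p < s.sig q ↔ s.lt p q := by
  refine ⟨fun h => ?_, s.sig_mono⟩
  rcases s.tri p q with h1 | h1 | h1
  · exact h1
  · subst h1; omega
  · have := s.sig_mono h1; omega

lemma sig_inj {p q} (h : s.sig p = s.sig q) : p = q := by
  rcases s.tri p q with h1 | h1 | h1
  · have := s.sig_mono h1; omega
  · exact h1
  · have := s.sig_mono h1; omega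



lemma card_pos' (_ : A.Ord) : 0 < Fintype.card D := Fintype.card_pos_iff.mpr ⟨A.d0⟩

/-- residue of `sig0 (d,0) - κ`. -/
noncomputable def res (κ : ℤ) (d : D) : Fin (Fintype.card D) :=
  ⟨((s.sig0 (d, 0) - κ) % (Fintype.card D : ℤ)).toNat, by
    have h := s.card_pos'
    have h1 := Int.emod_lt_of_pos (s.sig0 (d, 0) - κ) (b := (Fintype.card D : ℤ)) (by omega)
    have h2 := Int.emod_nonneg (s.sig0 (d, 0) - κ) (b := (Fintype.card D : ℤ)) (by omega)
    omega⟩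

lemma res_val (κ : ℤ) (d : D) :
    ((s.res κ d : ℕ) : ℤ) = (s.sig0 (d, 0) - κ) % (Fintype.card D : ℤ) := by
  have h := s.card_pos'
  have h2 := Int.emod_nonneg (s.sig0 (d, 0) - κ) (b := (Fintype.card D : ℤ)) (by omega)
  simp [res, h2]

lemma res_bij (κ : ℤ) : Function.Bijective (s.res κ) := by
  rw [Fintype.bijective_iff_injective_and_card]
  refine ⟨fun d e hde => ?_, by simp⟩
  have h1 : ((s.res κ d : ℕ) : ℤ) = s.res κ e := by rw [hde]
  rw [res_val, res_val] at h1
  obtain ⟨u, hu⟩ := Int.ModEq.dvd h1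
  have h2 : s.sig0 (e, 0) = s.sig0 (d, 0 + u) := by rw [sig0_shift]; linarith
  have h3 : s.sig (e, 0) = s.sig (d, 0 + u) := by rw [sig, sig, h2]
  exact (congrArg Prod.fst (s.sig_inj h3)).symm

lemma sum_floor0 (κ : ℤ) : ∑ d : D, (s.sig0 (d, 0) - κ) / (Fintype.card D : ℤ) = s.shf - κ := by
  have hN := s.card_pos'
  have key : ∀ κ : ℤ, (Fintype.card D : ℤ) * ∑ d : D, (s.sig0 (d, 0) - κ) / (Fintype.card D : ℤ)
      = ∑ d : D, s.sig0 (d, 0) - (Fintype.card D : ℤ) * κ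
        - ∑ i : Fin (Fintype.card D), ((i : ℕ) : ℤ) := by
    intro κ
    rw [← (s.res_bij κ).sum_comp (fun i : Fin (Fintype.card D) => ((i : ℕ) : ℤ))]
    rw [Finset.mul_sum]
    have : ∑ d : D, s.sig0 (d, 0) - (Fintype.card D : ℤ) * κ
        = ∑ d : D, (s.sig0 (d, 0) - κ) := by
      simp [Finset.sum_sub_distrib]
    rw [this, ← Finset.sum_sub_distrib]
    apply Finset.sum_congr rfl
    intro d _
    rw [res_val]
    have := Int.mul_ediv_add_emod (s.sig0 (d, 0) - κ) (Fintype.card D : ℤ)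
    linarith
  have h1 := key κ
  have h0 := key 0
  simp only [sub_zero, mul_zero] at h0
  have h0' : (Fintype.card D : ℤ) * s.shf = _ := h0
  have : (Fintype.card D : ℤ) * ∑ d : D, (s.sig0 (d, 0) - κ) / (Fintype.card D : ℤ)
    = (Fintype.card D : ℤ) * (s.shf - κ) := by rw [mul_sub]; linarith
  exact mul_left_cancel₀ (by omega) this

lemma sum_floor (κ : ℤ) : ∑ d : D, (s.sig (d, 0) - κ) / (Fintype.card D : ℤ) = - κ := by
  have := s.sum_floor0 (s.shf + κ)
  simp only [sig]
  rw [show (-κ) = s.shf - (s.shf + κ) by ring, ← this]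
  apply Finset.sum_congr rfl
  intro d _
  congr 1; ring

lemma sig_surj : Function.Surjective s.sig := by
  intro k
  have hN := s.card_pos'
  obtain ⟨d, hd⟩ := (s.res_bij (k + s.shf)).2 ⟨0, hN⟩
  have h1 := s.res_val (k + s.shf) d
  rw [hd] at h1
  have h2 := Int.mul_ediv_add_emod (s.sig0 (d, 0) - (k + s.shf)) (Fintype.card D : ℤ)
  rw [← h1] at h2
  refine ⟨(d, 0 + -((s.sig0 (d, 0) - (k + s.shf)) / (Fintype.card D : ℤ))), ?_⟩
  rw [sig_shift, sig]
  push_cast at h2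
  linarith

noncomputable def ppi (k : ℤ) : D × ℤ := (s.sig_surj k).choose

@[simp] lemma sig_ppi (k : ℤ) : s.sig (s.ppi k) = k := (s.sig_surj k).choose_spec

@[simp] lemma ppi_sig (q : D × ℤ) : s.ppi (s.sig q) = q := s.sig_inj (by simp)

lemma ppi_add (k u : ℤ) : s.ppi (k + Fintype.card D * u) = ((s.ppi k).1, (s.ppi k).2 + u) := by
  apply s.sig_inj
  rw [sig_ppi, sig_shift]
  simp

lemma ppi_lt {k l : ℤ} (h : k < l) : s.lt (s.ppi k) (s.ppi l) := by
  rw [← s.sig_lt_iff]; simpa using h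

end Ord
end AffSys


namespace AffSys

variable {D : Type} (A : AffSys D)

/-- The monoid of affine P-partitions. -/
def M : AddSubmonoid (D × ℤ → ℤ) where
  carrier := {h | h (A.d0, 0) = 0 ∧ (∀ d t, h (d, t) = h (d, 0) + t * h (A.d0, 1)) ∧
    ∀ p q, A.C p q → h p ≤ h q}
  zero_mem' := by simp
  add_mem' := by
    rintro g h ⟨g1, g2, g3⟩ ⟨h1, h2, h3⟩
    refine ⟨by simp [g1, h1], fun d t => ?_, fun p q hpq => add_le_add (g3 p q hpq) (h3 p q hpq)⟩
    simp only [Pi.add_apply]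
    rw [g2 d t, h2 d t]; ring

variable {A}

/-- degree -/
def deg (h : A.M) : ℤ := h.1 (A.d0, 1)

lemma M_zero (h : A.M) : h.1 (A.d0, 0) = 0 := h.2.1

lemma M_shift (h : A.M) (d : D) (t u : ℤ) : h.1 (d, t + u) = h.1 (d, t) + u * deg h := by
  rw [h.2.2.1 d (t + u), h.2.2.1 d t, deg]; ring

lemma M_C (h : A.M) {p q} (hpq : A.C p q) : h.1 p ≤ h.1 q := h.2.2.2 p q hpq

lemma deg_nonneg (h : A.M) : 0 ≤ deg h := by
  have h1 := M_C h (A.far A.d0 A.d0 0 (0 + A.W) le_rfl)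
  rw [M_shift] at h1
  have := A.W_pos
  nlinarith

lemma deg_add (g h : A.M) : deg (g + h) = deg g + deg h := rfl

lemma M_add_apply (g h : A.M) (q : D × ℤ) : (g + h).1 q = g.1 q + h.1 q := rfl

lemma M_nsmul_apply (n : ℕ) (h : A.M) (q : D × ℤ) : (n • h).1 q = n * h.1 q := by
  simp

/-- The total order attached to `h`. -/
def ltH (h : A.M) : A.Ord where
  lt p q := h.1 p < h.1 q ∨ (h.1 p = h.1 q ∧ A.o p q)
  irrefl q := by
    rintro (h1 | h1)
    · exact lt_irrefl _ h1
    · exact A.irrefl _ h1.2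
  trans := by
    rintro p q r (h1 | ⟨h1, h1'⟩) (h2 | ⟨h2, h2'⟩)
    · left; omega
    · left; omega
    · left; omega
    · exact Or.inr ⟨by omega, A.trans h1' h2'⟩
  tri p q := by
    rcases lt_trichotomy (h.1 p) (h.1 q) with h1 | h1 | h1
    · exact Or.inl (Or.inl h1)
    · rcases A.tri p q with h2 | h2 | h2
      · exact Or.inl (Or.inr ⟨h1, h2⟩)
      · exact Or.inr (Or.inl h2)
      · exact Or.inr (Or.inr (Or.inr ⟨h1.symm, h2⟩))
    · exact Or.inr (Or.inr (Or.inl h1))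
  shift := by
    rintro d e s t u (h1 | ⟨h1, h2⟩)
    · left; rw [M_shift, M_shift]; omega
    · right; rw [M_shift, M_shift]; exact ⟨by omega, A.shift u h2⟩
  succ d t := by
    rw [M_shift]
    have := deg_nonneg h
    rcases this.lt_or_eq with h1 | h1
    · left; omega
    · right; exact ⟨by omega, A.succ d t⟩
  C_lt := by
    intro p q hpq
    rcases (M_C h hpq).lt_or_eq with h1 | h1
    · exact Or.inl h1
    · exact Or.inr ⟨h1, A.C_o hpq⟩

/-- `h` is monotone for the order `s` -/
def MonoFor (s : A.Ord) (h : A.M) : Prop := ∀ p q, s.lt p q → h.1 p ≤ h.1 q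

lemma monoFor_ltH (h : A.M) : MonoFor (ltH h) h := by
  rintro p q (h1 | h1)
  · exact h1.le
  · exact h1.1.le

lemma Ord.eq_of_le {s t : A.Ord} (h : ∀ p q, s.lt p q → t.lt p q) : s = t := by
  ext p q
  refine ⟨h p q, fun h1 => ?_⟩
  rcases s.tri p q with h2 | h2 | h2
  · exact h2
  · subst h2; exact absurd h1 (t.irrefl _)
  · exact absurd (h _ _ h2) (t.asymm h1)

variable [Fintype D]

/-- The fundamental elements. -/
noncomputable def vv (s : A.Ord) (κ : ℤ) : A.M :=
  ⟨fun q => (s.sig q - κ) / (Fintype.card D : ℤ) - (s.sig (A.d0, 0) - κ) / (Fintype.card D : ℤ), by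
    have hN := s.card_pos'
    have hN' : (Fintype.card D : ℤ) ≠ 0 := by omega
    have hsh : ∀ d t, (s.sig (d, t) - κ) / (Fintype.card D : ℤ)
        = (s.sig (d, 0) - κ) / (Fintype.card D : ℤ) + t := by
      intro d t
      have := s.sig_shift d 0 t
      rw [zero_add] at this
      rw [this, show s.sig (d, 0) + (Fintype.card D : ℤ) * t - κ
        = (s.sig (d, 0) - κ) + (Fintype.card D : ℤ) * t by ring, Int.add_mul_ediv_left _ _ hN']
    refine ⟨by simp, fun d t => ?_, fun p q hpq => ?_⟩
    · simp only
      rw [hsh d t, hsh A.d0 1]; ring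
    · have := s.sig_mono (s.C_lt hpq)
      simp only
      have h2 : (s.sig p - κ) / (Fintype.card D : ℤ) ≤ (s.sig q - κ) / (Fintype.card D : ℤ) :=
        Int.ediv_le_ediv (by omega) (by omega)
      omega⟩

lemma vv_apply (s : A.Ord) (κ : ℤ) (q : D × ℤ) : (vv s κ).1 q =
  (s.sig q - κ) / (Fintype.card D : ℤ) - (s.sig (A.d0, 0) - κ) / (Fintype.card D : ℤ) := rfl

lemma vv_mono (s : A.Ord) (κ : ℤ) : MonoFor s (vv s κ) := by
  intro p q hpq
  have := s.sig_mono hpq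
  have hN := s.card_pos'
  rw [vv_apply, vv_apply]
  have h2 : (s.sig p - κ) / (Fintype.card D : ℤ) ≤ (s.sig q - κ) / (Fintype.card D : ℤ) :=
    Int.ediv_le_ediv (by omega) (by omega)
  omega

lemma vv_deg (s : A.Ord) (κ : ℤ) : deg (vv s κ) = 1 := by
  have hN := s.card_pos'
  have hN' : (Fintype.card D : ℤ) ≠ 0 := by omega
  rw [deg, vv_apply]
  have := s.sig_shift A.d0 0 1
  rw [zero_add] at this
  rw [this, show s.sig (A.d0, 0) + (Fintype.card D : ℤ) * 1 - κ
        = (s.sig (A.d0, 0) - κ) + (Fintype.card D : ℤ) * 1 by ring, Int.add_mul_ediv_left _ _ hN']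
  ring

lemma vv_period (s : A.Ord) (κ u : ℤ) : vv s (κ + Fintype.card D * u) = vv s κ := by
  have hN := s.card_pos'
  have hN' : (Fintype.card D : ℤ) ≠ 0 := by omega
  apply Subtype.ext
  funext q
  rw [vv_apply, vv_apply]
  have : ∀ x : ℤ, (x - (κ + Fintype.card D * u)) / (Fintype.card D : ℤ)
      = (x - κ) / (Fintype.card D : ℤ) - u := by
    intro x
    rw [show x - (κ + Fintype.card D * u) = (x - κ) + (Fintype.card D : ℤ) * (-u) by ring,
      Int.add_mul_ediv_left _ _ hN']
    ring
  rw [this, this]; ring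

/-- colour -/
def color (v : A.M) : ℤ := (- ∑ d : D, v.1 (d, 0)) % (Fintype.card D : ℤ)

lemma color_vv (s : A.Ord) (κ : ℤ) : color (vv s κ) = κ % (Fintype.card D : ℤ) := by
  unfold color
  simp only [vv_apply, Finset.sum_sub_distrib, s.sum_floor]
  simp

lemma eq_vv_of_mono (s : A.Ord) (v : A.M) (hd : deg v = 1) (hm : MonoFor s v) :
    ∃ κ, v = vv s κ := by
  have hN := s.card_pos'
  have hNz : (0:ℤ) < Fintype.card D := by omega
  set f : ℤ → ℤ := fun k => v.1 (s.ppi k) with hf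
  have hfs : ∀ k u, f (k + Fintype.card D * u) = f k + u := by
    intro k u
    simp only [hf]
    rw [s.ppi_add, M_shift, hd]; simp
  have hmono : ∀ {k l}, k ≤ l → f k ≤ f l := by
    intro k l hkl
    rcases hkl.lt_or_eq with h | h
    · exact hm _ _ (s.ppi_lt h)
    · rw [h]
  obtain ⟨κ, hκ, hmin⟩ := Int.exists_least_of_bdd (P := fun k => 0 ≤ f k)
    ⟨0 + Fintype.card D * (-(f 0) - 1), fun z hz => by
      by_contra hlt
      have h1 := hmono (not_le.mp hlt).le
      rw [hfs] at h1
      omega⟩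
    ⟨0 + Fintype.card D * (-(f 0)), by rw [hfs]; simp⟩
  have hiff : ∀ k j, j ≤ f k ↔ j ≤ (k - κ) / (Fintype.card D : ℤ) := by
    intro k j
    have h1 : f (k + Fintype.card D * (-j)) = f k + -j := hfs k (-j)
    rw [Int.le_ediv_iff_mul_le hNz]
    constructor
    · intro h
      have := hmin _ (show 0 ≤ f (k + Fintype.card D * (-j)) by omega)
      nlinarith
    · intro h
      have h2 := hmono (show κ ≤ k + Fintype.card D * (-j) by nlinarith)
      omega
  have heq : ∀ k, f k = (k - κ) / (Fintype.card D : ℤ) := fun k =>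
    le_antisymm ((hiff k _).mp le_rfl) ((hiff k _).mpr le_rfl)
  have hv : ∀ q, v.1 q = (s.sig q - κ) / (Fintype.card D : ℤ) := by
    intro q
    have := heq (s.sig q)
    simpa [hf] using this
  refine ⟨κ, Subtype.ext (funext fun q => ?_)⟩
  rw [vv_apply, ← hv, ← hv, M_zero]; simp

lemma eq_vv_color (s : A.Ord) (v : A.M) (hd : deg v = 1) (hm : MonoFor s v) :
    v = vv s (color v) := by
  obtain ⟨κ, rfl⟩ := eq_vv_of_mono s v hd hm
  rw [color_vv]
  have h := Int.emod_add_mul_ediv κ (Fintype.card D : ℤ)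
  conv_lhs => rw [← h]
  rw [vv_period]

/-- jumps -/
noncomputable def del (s : A.Ord) (h : A.M) (κ : ℤ) : ℤ := h.1 (s.ppi κ) - h.1 (s.ppi (κ - 1))

lemma del_add (s : A.Ord) (g h : A.M) (κ : ℤ) : del s (g + h) κ = del s g κ + del s h κ := by
  simp only [del, M_add_apply]; ring

lemma del_nsmul (s : A.Ord) (n : ℕ) (h : A.M) (κ : ℤ) : del s (n • h) κ = n * del s h κ := by
  simp only [del, M_nsmul_apply]; ring

lemma floor_step {N x : ℤ} (hN : 0 < N) : x / N - (x - 1) / N = if x % N = 0 then 1 else 0 := by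
  have h1 := Int.mul_ediv_add_emod x N
  have h2 := Int.emod_nonneg x hN.ne'
  have h3 := Int.emod_lt_of_pos x hN
  split_ifs with h
  · have : (x - 1) / N = x / N - 1 := by
      rw [Int.ediv_eq_iff_of_pos hN] 
      constructor <;> nlinarith
    omega
  · have : (x - 1) / N = x / N := by
      rw [Int.ediv_eq_iff_of_pos hN]
      have : 1 ≤ x % N := by omega
      constructor <;> nlinarith
    omega

lemma del_vv (s : A.Ord) (κ l : ℤ) :
    del s (vv s κ) l = if (l - κ) % (Fintype.card D : ℤ) = 0 then 1 else 0 := by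
  have hN := s.card_pos'
  rw [← floor_step (by omega), del, vv_apply, vv_apply, s.sig_ppi, s.sig_ppi]
  rw [show l - 1 - κ = l - κ - 1 by ring]; ring

lemma del_nonneg (s : A.Ord) (h : A.M) (hm : MonoFor s h) (κ : ℤ) : 0 ≤ del s h κ := by
  have := hm _ _ (s.ppi_lt (show κ - 1 < κ by omega))
  unfold del; omega

lemma del_period (s : A.Ord) (h : A.M) (κ u : ℤ) :
    del s h (κ + Fintype.card D * u) = del s h κ := by
  unfold del
  rw [show κ + Fintype.card D * u - 1 = (κ - 1) + Fintype.card D * u by ring, s.ppi_add,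
    s.ppi_add, M_shift, M_shift]
  ring

lemma eq_of_del (s : A.Ord) (g h : A.M) (hd : ∀ κ, del s g κ = del s h κ) : g = h := by
  have key : ∀ k, (g.1 (s.ppi k) - h.1 (s.ppi k)) = (g.1 (s.ppi 0) - h.1 (s.ppi 0)) := by
    intro k
    induction k using Int.induction_on with
    | zero => rfl
    | succ k ih =>
      have := hd (k + 1)
      unfold del at this
      rw [show (k:ℤ) + 1 - 1 = k by ring] at this
      omega
    | pred k ih =>
      have := hd (-k)
      unfold del at this
      omega
  have h0 := key (s.sig (A.d0, 0))
  rw [s.ppi_sig, M_zero, M_zero] at h0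
  apply Subtype.ext
  funext q
  have := key (s.sig q)
  rw [s.ppi_sig] at this
  omega

/-- linear combination of fundamental elements -/
noncomputable def LL (s : A.Ord) (c : Fin (Fintype.card D) → ℕ) : A.M :=
  ∑ i, c i • vv s ((i : ℕ) : ℤ)

lemma del_LL (s : A.Ord) (c : Fin (Fintype.card D) → ℕ) (j : Fin (Fintype.card D)) :
    del s (LL s c) ((j : ℕ) : ℤ) = c j := by
  have hsum : ∀ (T : Finset (Fin (Fintype.card D))) (κ : ℤ),
      del s (∑ i ∈ T, c i • vv s ((i : ℕ) : ℤ)) κ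
        = ∑ i ∈ T, (c i : ℤ) * del s (vv s ((i : ℕ) : ℤ)) κ := by
    classical
    intro T κ
    induction T using Finset.induction_on with
    | empty => simp [del]
    | insert a T ha ih => rw [Finset.sum_insert ha, Finset.sum_insert ha, del_add, del_nsmul, ih]
  rw [LL, hsum, Finset.sum_eq_single j]
  · rw [del_vv]; simp
  · intro i _ hij
    rw [del_vv, if_neg, mul_zero]
    intro h0
    obtain ⟨u, hu⟩ := Int.dvd_of_emod_eq_zero h0
    apply hij
    have h1 := i.2
    have h2 := j.2
    have : u = 0 := by
      by_contra hu0
      rcases lt_or_gt_of_ne hu0 with h | h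
      · have : u ≤ -1 := by omega
        nlinarith
      · have : 1 ≤ u := by omega
        nlinarith
    subst this
    apply Fin.ext
    omega
  · simp

lemma del_emod (s : A.Ord) (h : A.M) (κ : ℤ) :
    del s h κ = del s h (κ % (Fintype.card D : ℤ)) := by
  have h1 := Int.emod_add_mul_ediv κ (Fintype.card D : ℤ)
  conv_lhs => rw [← h1]
  rw [del_period]

lemma exists_fin_emod (s : A.Ord) (κ : ℤ) :
    ∃ j : Fin (Fintype.card D), κ % (Fintype.card D : ℤ) = ((j : ℕ) : ℤ) := by
  have hN := s.card_pos'
  have h1 := Int.emod_lt_of_pos κ (b := (Fintype.card D : ℤ)) (by omega)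
  have h2 := Int.emod_nonneg κ (b := (Fintype.card D : ℤ)) (by omega)
  exact ⟨⟨(κ % (Fintype.card D : ℤ)).toNat, by omega⟩, by simp [h2]⟩

lemma eq_LL (s : A.Ord) (h : A.M) (c : Fin (Fintype.card D) → ℕ)
    (hc : ∀ j : Fin (Fintype.card D), del s h ((j : ℕ) : ℤ) = c j) : h = LL s c := by
  apply eq_of_del s
  intro κ
  obtain ⟨j, hj⟩ := exists_fin_emod s κ
  rw [del_emod, del_emod s (LL s c), hj, hc, del_LL]

open Classical in
/-- descents of `s` relative to the base order -/
noncomputable def eps (s : A.Ord) (κ : ℤ) : ℕ := if A.o (s.ppi (κ - 1)) (s.ppi κ) then 0 else 1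

lemma eps_period (s : A.Ord) (κ u : ℤ) : eps s (κ + Fintype.card D * u) = eps s κ := by
  unfold eps
  rw [show κ + Fintype.card D * u - 1 = (κ - 1) + Fintype.card D * u by ring, s.ppi_add,
    s.ppi_add]
  congr 1
  apply propext
  constructor
  · intro h
    simpa using A.shift (-u) h
  · exact A.shift u

lemma eps_emod (s : A.Ord) (κ : ℤ) : eps s κ = eps s (κ % (Fintype.card D : ℤ)) := by
  have h1 := Int.emod_add_mul_ediv κ (Fintype.card D : ℤ)
  conv_lhs => rw [← h1]
  rw [eps_period]

lemma ltH_eq_of_del (s : A.Ord) (h : A.M) (hd : ∀ κ, (eps s κ : ℤ) ≤ del s h κ) : ltH h = s := by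
  symm
  apply Ord.eq_of_le
  have step : ∀ k, (ltH h).lt (s.ppi (k - 1)) (s.ppi k) := by
    intro k
    have h1 := hd k
    unfold del eps at h1
    split_ifs at h1 with h2
    · rcases (show h.1 (s.ppi (k-1)) ≤ h.1 (s.ppi k) by push_cast at h1; omega).lt_or_eq with h3 | h3
      · exact Or.inl h3
      · exact Or.inr ⟨h3, h2⟩
    · left; push_cast at h1; omega
  have many : ∀ (n : ℕ) k, (ltH h).lt (s.ppi k) (s.ppi (k + (n + 1 : ℕ))) := by
    intro n k
    induction n with
    | zero =>
      have := step (k + 1)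
      simpa using this
    | succ n ih =>
      have := step (k + (n + 1 : ℕ) + 1)
      rw [show k + ((n + 1 : ℕ) : ℤ) + 1 - 1 = k + (n + 1 : ℕ) by ring] at this
      have h2 := (ltH h).trans ih this
      convert h2 using 2
      push_cast; ring
  intro p q hpq
  have h1 := s.sig_mono hpq
  have h2 := many (s.sig q - s.sig p - 1).toNat (s.sig p)
  rw [s.ppi_sig, show s.sig p + (((s.sig q - s.sig p - 1).toNat + 1 : ℕ) : ℤ) = s.sig q by
    push_cast; rw [Int.toNat_of_nonneg (by omega)]; ring, s.ppi_sig] at h2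
  exact h2

lemma eps_le_del (h : A.M) (κ : ℤ) : (eps (ltH h) κ : ℤ) ≤ del (ltH h) h κ := by
  have := (ltH h).ppi_lt (show κ - 1 < κ by omega)
  unfold del eps
  rcases this with h1 | ⟨h1, h2⟩
  · split_ifs <;> push_cast <;> omega
  · rw [if_pos h2]; push_cast; omega

/-- The parametrisation of `M`. -/
noncomputable def ee (s : A.Ord) (α : Fin (Fintype.card D) → ℕ) : A.M :=
  LL s fun j => eps s ((j : ℕ) : ℤ) + α j

lemma ltH_ee (s : A.Ord) (α) : ltH (ee s α) = s := by
  apply ltH_eq_of_del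
  intro κ
  obtain ⟨j, hj⟩ := exists_fin_emod s κ
  rw [del_emod, eps_emod, hj, ee, del_LL]
  push_cast; omega

noncomputable def eeEquiv : A.Ord × (Fin (Fintype.card D) → ℕ) ≃ A.M :=
  Equiv.ofBijective (fun x => ee x.1 x.2) (by
    constructor
    · rintro ⟨s, α⟩ ⟨s', α'⟩ h
      simp only at h
      have h1 : s = s' := by rw [← ltH_ee s α, h, ltH_ee]
      subst h1
      congr 1
      funext j
      have h2 := del_LL s (fun j => eps s ((j : ℕ) : ℤ) + α j) j
      have h3 := del_LL s (fun j => eps s ((j : ℕ) : ℤ) + α' j) j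
      change del s (ee s α) _ = _ at h2
      change del s (ee s α') _ = _ at h3
      rw [h, h3] at h2
      push_cast at h2
      omega
    · intro h
      refine ⟨(ltH h, fun j => (del (ltH h) h ((j : ℕ) : ℤ)).toNat - eps (ltH h) ((j : ℕ) : ℤ)), ?_⟩
      symm
      apply eq_LL
      intro j
      have := eps_le_del h ((j : ℕ) : ℤ)
      push_cast
      omega)

lemma eeEquiv_apply (s : A.Ord) (α) : eeEquiv (s, α) = ee s α := rfl

lemma ee_add_single (s : A.Ord) (α) (i : Fin (Fintype.card D)) (k : ℕ) :
    ee s (α + Pi.single i k) = ee s α + k • vv s ((i : ℕ) : ℤ) := by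
  classical
  unfold ee LL
  have hk : k • vv s ((i : ℕ) : ℤ)
      = ∑ j : Fin (Fintype.card D), if j = i then k • vv s ((j : ℕ) : ℤ) else 0 := by simp
  rw [hk, ← Finset.sum_add_distrib]
  apply Finset.sum_congr rfl
  intro j _
  by_cases hij : j = i
  · subst hij; simp [add_smul, add_assoc]
  · simp [hij]

/-- near pairs determine the order, so there are finitely many -/
instance finite_Ord : Finite A.Ord := by
  let f : A.Ord → (D → D → Set.Icc (-A.W) A.W → Prop) := fun s d e t => s.lt (d, 0) (e, t.1)
  apply Finite.of_injective f
  intro s s' h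
  have key : ∀ (s s' : A.Ord), f s = f s' → ∀ p q, s.lt p q → s'.lt p q := by
    rintro s s' h ⟨d, a⟩ ⟨e, b⟩ h1
    have hW := A.W_pos
    rcases lt_or_ge (b - a) (-A.W) with h2 | h2
    · exact absurd h1 (s.asymm (s.C_lt (A.far _ _ _ _ (by omega))))
    rcases lt_or_ge A.W (b - a) with h3 | h3
    · exact s'.C_lt (A.far _ _ _ _ (by omega))
    have h4 := congrFun (congrFun (congrFun h d) e) ⟨b - a, h2, h3⟩
    simp only [f] at h4
    have h5 := (s.shift_iff (d := d) (e := e) (a := 0) (b := b - a) a)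
    have h6 := (s'.shift_iff (d := d) (e := e) (a := 0) (b := b - a) a)
    simp only [zero_add, sub_add_cancel] at h5 h6
    rw [h6, ← h4, ← h5]
    exact h1
  exact Ord.eq_of_le (key s s' h)

end AffSys


namespace AffSys

variable {D : Type} {A : AffSys D}

/-- near pairs in `C` -/
abbrev NearC (A : AffSys D) : Type :=
  {x : D × D × Set.Icc (-A.W) A.W // A.C (x.1, 0) (x.2.1, x.2.2.1)}

noncomputable def slack [Fintype D] (A : AffSys D) : A.M →+ (A.NearC →₀ ℕ) where
  toFun h := Finsupp.equivFunOnFinite.symm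
    fun x => (h.1 (x.1.2.1, x.1.2.2.1) - h.1 (x.1.1, 0)).toNat
  map_zero' := by
    ext x; simp
  map_add' g h := by
    ext x
    have h1 := M_C g x.2
    have h2 := M_C h x.2
    simp only [Finsupp.equivFunOnFinite_symm_apply_apply, Finsupp.add_apply, M_add_apply]
    omega

lemma slack_apply [Fintype D] (h : A.M) (x : A.NearC) :
    ((slack A h x : ℕ) : ℤ) = h.1 (x.1.2.1, x.1.2.2.1) - h.1 (x.1.1, 0) := by
  have h1 := M_C h x.2
  have : slack A h x = (h.1 (x.1.2.1, x.1.2.2.1) - h.1 (x.1.1, 0)).toNat := rfl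
  omega

lemma slack_injective [Fintype D] : Function.Injective (slack A) := by
  intro g h hgh
  have hW := A.W_pos
  have key : ∀ e, g.1 (e, 0) + A.W * deg g = h.1 (e, 0) + A.W * deg h := by
    intro e
    let x : A.NearC := ⟨(A.d0, e, ⟨A.W, by omega, le_rfl⟩), A.far _ _ _ _ (by simp)⟩
    have h1 := slack_apply g x
    have h2 := slack_apply h x
    rw [hgh] at h1
    simp only [x, M_zero] at h1 h2
    have h3 := M_shift g e 0 A.W
    have h4 := M_shift h e 0 A.W
    rw [zero_add] at h3 h4
    omega
  have hd : deg g = deg h := by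
    have := key A.d0
    rw [M_zero, M_zero] at this
    have : A.W * (deg g - deg h) = 0 := by linarith
    rcases mul_eq_zero.mp this with h | h <;> omega
  apply Subtype.ext
  funext ⟨e, t⟩
  have h3 := M_shift g e 0 t
  have h4 := M_shift h e 0 t
  have := key e
  rw [zero_add] at h3 h4
  rw [hd] at this h3
  omega

lemma slack_full [Fintype D] (h : A.M) (u : A.NearC →₀ ℕ) (h' : A.M)
    (hu : slack A h + u = slack A h') : u ∈ Set.range (slack A) := by
  have hW := A.W_pos
  let g : D × ℤ → ℤ := fun q => h'.1 q - h.1 q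
  have near : ∀ x : A.NearC, ((u x : ℕ) : ℤ) = g (x.1.2.1, x.1.2.2.1) - g (x.1.1, 0) := by
    intro x
    have h1 := slack_apply h x
    have h2 := slack_apply h' x
    rw [← hu, Finsupp.add_apply] at h2
    push_cast at h2
    simp only [g]
    omega
  have g0 : g (A.d0, 0) = 0 := by simp [g, M_zero]
  have gsh : ∀ d t u, g (d, t + u) = g (d, t) + u * g (A.d0, 1) := by
    intro d t u
    simp only [g]
    rw [M_shift, M_shift]
    simp only [deg]
    ring
  have hnear : ∀ d e t, -A.W ≤ t → t ≤ A.W → A.C (d, 0) (e, t) → g (d, 0) ≤ g (e, t) := by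
    intro d e t h1 h2 h3
    have := near ⟨(d, e, ⟨t, h1, h2⟩), h3⟩
    simp only at this
    omega
  have gd : 0 ≤ g (A.d0, 1) := by
    have h1 := hnear A.d0 A.d0 A.W (by omega) le_rfl (A.far _ _ _ _ (by simp))
    have h2 := gsh A.d0 0 A.W
    rw [zero_add] at h2
    rw [h2] at h1
    nlinarith
  have hC : ∀ p q, A.C p q → g p ≤ g q := by
    rintro ⟨d, a⟩ ⟨e, b⟩ hpq
    have hsh : A.C (d, 0) (e, b - a) := by
      have := A.C_shift (-a) hpq
      simpa [sub_eq_add_neg] using this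
    have e1 := gsh d 0 a
    have e2 := gsh e (b - a) a
    rw [zero_add] at e1
    rw [sub_add_cancel] at e2
    rw [e1, e2]
    apply add_le_add_left
    rcases lt_or_ge (b - a) (-A.W) with h2 | h2
    · exact absurd (A.trans (A.C_o hpq) (A.C_o (A.far e d b a (by omega)))) (A.irrefl _)
    rcases lt_or_ge A.W (b - a) with h3 | h3
    · have h4 := hnear d e A.W (by omega) le_rfl (A.far _ _ _ _ (by simp))
      have h5 := gsh e A.W (b - a - A.W)
      rw [add_sub_cancel] at h5
      rw [h5]
      nlinarith
    · exact hnear d e _ h2 h3 hsh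
  refine ⟨⟨g, g0, fun d t => ?_, hC⟩, ?_⟩
  · have := gsh d 0 t
    rwa [zero_add] at this
  · ext x
    have h1 := slack_apply ⟨g, g0, fun d t => by simpa using gsh d 0 t, hC⟩ x
    rw [← near x] at h1
    exact_mod_cast h1

theorem normal_M [Fintype D] (K : Type) [Field K] :
    IsDomain (AddMonoidAlgebra K A.M) ∧ IsIntegrallyClosed (AddMonoidAlgebra K A.M) :=
  normal_of_slack (slack A) slack_injective slack_full

end AffSys


namespace AffSys

variable {D : Type} {A : AffSys D} [Fintype D]

/-- near pairs -/
abbrev Near (A : AffSys D) : Type := D × D × Set.Icc (-A.W) A.W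

abbrev Near.p (x : A.Near) : D × ℤ := (x.1, 0)
abbrev Near.q (x : A.Near) : D × ℤ := (x.2.1, x.2.2.1)

noncomputable instance : Fintype A.Near := by
  unfold Near; infer_instance

noncomputable def cost (h : A.M) : ℕ :=
  (deg h).toNat + ∑ x : A.Near, (h.1 x.p - h.1 x.q).natAbs

open Classical in
noncomputable def invset (h : A.M) : Finset A.Near :=
  Finset.univ.filter fun x => A.o x.p x.q ∧ h.1 x.q < h.1 x.p

noncomputable def rk (h : A.M) : ℕ :=
  (Fintype.card A.Near + 1) * cost h + (Fintype.card A.Near - (invset h).card)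

lemma mem_invset (h : A.M) (x : A.Near) :
    x ∈ invset h ↔ A.o x.p x.q ∧ h.1 x.q < h.1 x.p := by
  simp [invset]

lemma invset_card_le (h : A.M) : (invset h).card ≤ Fintype.card A.Near := Finset.card_le_univ _

lemma cost_add_le (g h : A.M) : cost (g + h) ≤ cost g + cost h := by
  unfold cost
  have h1 : ∑ x : A.Near, ((g + h).1 x.p - (g + h).1 x.q).natAbs ≤
      ∑ x : A.Near, (g.1 x.p - g.1 x.q).natAbs + ∑ x : A.Near, (h.1 x.p - h.1 x.q).natAbs := by
    rw [← Finset.sum_add_distrib]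
    apply Finset.sum_le_sum
    intro x _
    rw [M_add_apply, M_add_apply]
    omega
  have := deg_add g h
  have := deg_nonneg g
  have := deg_nonneg h
  omega

lemma cost_add_eq (g h : A.M)
    (H : ∀ p q, ¬ (g.1 p < g.1 q ∧ h.1 q < h.1 p)) : cost (g + h) = cost g + cost h := by
  unfold cost
  have h1 : ∑ x : A.Near, ((g + h).1 x.p - (g + h).1 x.q).natAbs =
      ∑ x : A.Near, (g.1 x.p - g.1 x.q).natAbs + ∑ x : A.Near, (h.1 x.p - h.1 x.q).natAbs := by
    rw [← Finset.sum_add_distrib]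
    apply Finset.sum_congr rfl
    intro x _
    rw [M_add_apply, M_add_apply]
    have := H x.p x.q
    have := H x.q x.p
    omega
  have := deg_add g h
  have := deg_nonneg g
  have := deg_nonneg h
  omega

lemma cost_add_cases (g h : A.M) : cost (g + h) < cost g + cost h ∨
    (cost (g + h) = cost g + cost h ∧
      ∀ x : A.Near, ((g + h).1 x.p - (g + h).1 x.q).natAbs =
        (g.1 x.p - g.1 x.q).natAbs + (h.1 x.p - h.1 x.q).natAbs) := by
  rcases (cost_add_le g h).lt_or_eq with h1 | h1
  · exact Or.inl h1
  · right
    refine ⟨h1, ?_⟩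
    by_contra hc
    push Not at hc
    obtain ⟨x, hx⟩ := hc
    have h2 : ∑ x : A.Near, ((g + h).1 x.p - (g + h).1 x.q).natAbs <
      ∑ x : A.Near, (g.1 x.p - g.1 x.q).natAbs + ∑ x : A.Near, (h.1 x.p - h.1 x.q).natAbs := by
      rw [← Finset.sum_add_distrib]
      apply Finset.sum_lt_sum
      · intro x _
        rw [M_add_apply, M_add_apply]
        omega
      · refine ⟨x, Finset.mem_univ _, ?_⟩
        rw [M_add_apply, M_add_apply] at hx ⊢
        omega
    unfold cost at h1
    have := deg_add g h
    have := deg_nonneg g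
    have := deg_nonneg h
    omega

lemma cost_nsmul (n : ℕ) (h : A.M) : cost (n • h) = n * cost h := by
  induction n with
  | zero =>
    rw [zero_smul, zero_mul]
    simp [cost, deg]
  | succ n ih =>
    rw [add_smul, one_smul, cost_add_eq, ih]
    · ring
    · rintro p q ⟨h1, h2⟩
      rw [M_nsmul_apply, M_nsmul_apply] at h1
      nlinarith

lemma cost_pos (h : A.M) (hd : deg h = 1) : 0 < cost h := by
  unfold cost; omega

/-- An incompatibility can be moved to a near pair. -/
lemma near_of_not_mono (s : A.Ord) (v : A.M) (h : ¬ MonoFor s v) :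
    ∃ x : A.Near, s.lt x.p x.q ∧ v.1 x.q < v.1 x.p := by
  unfold MonoFor at h
  push Not at h
  obtain ⟨⟨d, a⟩, ⟨e, b⟩, h1, h2⟩ := h
  have hW := A.W_pos
  rcases lt_or_ge (b - a) (-A.W) with h3 | h3
  · exact absurd h1 (s.asymm (s.C_lt (A.far _ _ _ _ (by omega))))
  rcases lt_or_ge A.W (b - a) with h4 | h4
  · exact absurd (M_C v (A.far d e a b (by omega))) (by omega)
  refine ⟨(d, e, ⟨b - a, h3, h4⟩), ?_, ?_⟩
  · have := s.shift (-a) h1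
    simpa [sub_eq_add_neg, Near.p, Near.q] using this
  · have e1 := M_shift v d a (-a)
    have e2 := M_shift v e b (-a)
    simp only [Near.p, Near.q]
    rw [add_neg_cancel] at e1
    rw [← sub_eq_add_neg] at e2
    omega

lemma rk_eq (h : A.M) (κ : ℤ) (k : ℕ) :
    rk (h + k • vv (ltH h) κ) =
      rk h + (Fintype.card A.Near + 1) * (k * cost (vv (ltH h) κ)) := by
  set v := vv (ltH h) κ with hv
  have hm : MonoFor (ltH h) v := vv_mono _ _
  have hm' : ∀ p q, (ltH h).lt p q → (k • v).1 p ≤ (k • v).1 q := by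
    intro p q hpq
    rw [M_nsmul_apply, M_nsmul_apply]
    exact mul_le_mul_of_nonneg_left (hm p q hpq) (by positivity)
  have hinv : invset (h + k • v) = invset h := by
    ext x
    rw [mem_invset, mem_invset, M_add_apply, M_add_apply]
    refine and_congr_right fun ho => ?_
    constructor
    · intro h1
      by_contra h2
      push Not at h2
      have : (ltH h).lt x.p x.q := by
        rcases h2.lt_or_eq with h3 | h3
        · exact Or.inl h3
        · exact Or.inr ⟨h3, ho⟩
      have := hm' _ _ this
      omega
    · intro h1
      have := hm' _ _ (show (ltH h).lt x.q x.p from Or.inl h1)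
      omega
  have hcost : cost (h + k • v) = cost h + k * cost v := by
    rw [cost_add_eq, cost_nsmul]
    rintro p q ⟨h1, h2⟩
    have := hm' _ _ (show (ltH h).lt p q from Or.inl h1)
    omega
  unfold rk
  rw [hinv, hcost]
  ring

lemma rk_lt (h v : A.M) (k : ℕ) (hk : 0 < k) (hv : ¬ MonoFor (ltH h) v) :
    rk (h + k • v) < rk h + (Fintype.card A.Near + 1) * (k * cost v) := by
  obtain ⟨x, hx1, hx2⟩ := near_of_not_mono _ _ hv
  have hx2' : (k • v).1 x.q < (k • v).1 x.p := by
    rw [M_nsmul_apply, M_nsmul_apply]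
    exact mul_lt_mul_of_pos_left hx2 (by exact_mod_cast hk)
  have i1 := invset_card_le (h + k • v)
  have i2 := invset_card_le h
  rw [← cost_nsmul]
  unfold rk
  rcases cost_add_cases h (k • v) with h1 | ⟨h1, h2⟩
  · have : (Fintype.card A.Near + 1) * (cost (h + k • v) + 1)
      ≤ (Fintype.card A.Near + 1) * (cost h + cost (k • v)) := Nat.mul_le_mul_left _ h1
    rw [mul_add, mul_add] at this
    omega
  · rw [h1]
    have hlt : (invset h).card < (invset (h + k • v)).card := by
      apply Finset.card_lt_card
      refine ⟨?_, ?_⟩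
      · intro y hy
        rw [mem_invset] at hy ⊢
        refine ⟨hy.1, ?_⟩
        have := h2 y
        rw [M_add_apply, M_add_apply] at this ⊢
        have := hy.2
        omega
      · intro hsub
        have h3 := h2 x
        rw [M_add_apply, M_add_apply] at h3
        rcases hx1 with h4 | ⟨h4, h5⟩
        · omega
        · have := hsub ((mem_invset _ x).mpr ⟨h5, by rw [M_add_apply, M_add_apply]; omega⟩)
          rw [mem_invset] at this
          omega
    rw [mul_add]
    omega

end AffSys


namespace AffSys

variable {D : Type} {A : AffSys D} [Fintype D]

/-- compatible elements -/
def Compat (g h : A.M) : Prop := ∀ p q, ¬ (g.1 p < g.1 q ∧ h.1 q < h.1 p)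

lemma cost_lt_of_not_compat (g h : A.M) (H : ¬ Compat g h) : cost (g + h) < cost g + cost h := by
  unfold Compat at H
  push Not at H
  obtain ⟨⟨d, a⟩, ⟨e, b⟩, h1, h2⟩ := H
  rcases cost_add_cases g h with h3 | ⟨_, h3⟩
  · exact h3
  exfalso
  have hW := A.W_pos
  rcases lt_or_ge (b - a) (-A.W) with h4 | h4
  · exact absurd (M_C g (A.far e d b a (by omega))) (by omega)
  rcases lt_or_ge A.W (b - a) with h5 | h5
  · exact absurd (M_C h (A.far d e a b (by omega))) (by omega)
  have h6 := h3 (d, e, ⟨b - a, h4, h5⟩)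
  simp only [Near.p, Near.q, M_add_apply] at h6
  have e1 := M_shift g d a (-a)
  have e2 := M_shift g e b (-a)
  have e3 := M_shift h d a (-a)
  have e4 := M_shift h e b (-a)
  rw [add_neg_cancel] at e1 e3
  rw [← sub_eq_add_neg] at e2 e4
  omega

section straight

variable {V : Type} (vm : V → A.M)

/-- total value of a monomial -/
noncomputable def SS : (V →₀ ℕ) →+ A.M :=
  Finsupp.liftAddHom fun v => (multiplesHom A.M) (vm v)

lemma SS_single (v : V) (n : ℕ) : SS vm (Finsupp.single v n) = n • vm v := by
  simp [SS]

lemma SS_apply (m : V →₀ ℕ) : SS vm m = ∑ v ∈ m.support, m v • vm v := by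
  simp [SS, Finsupp.sum]

noncomputable def wt : (V →₀ ℕ) →+ ℕ :=
  Finsupp.liftAddHom fun v => (multiplesHom ℕ) (cost (vm v))

lemma wt_single (v : V) (n : ℕ) : wt vm (Finsupp.single v n) = n * cost (vm v) := by
  simp [wt]

def CompatM (m : V →₀ ℕ) : Prop := ∀ v ∈ m.support, ∀ w ∈ m.support, Compat (vm v) (vm w)

lemma SS_fun (m : V →₀ ℕ) (q : D × ℤ) :
    (SS vm m).1 q = ∑ v ∈ m.support, (m v : ℤ) * (vm v).1 q := by
  rw [SS_apply]
  rw [AddSubmonoid.coe_finset_sum, Finset.sum_apply]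
  simp

lemma compatM_mono (m : V →₀ ℕ) (hm : CompatM vm m) (v : V) (hv : v ∈ m.support) :
    MonoFor (ltH (SS vm m)) (vm v) := by
  intro p q hpq
  by_contra hc
  push Not at hc
  have hlt : (SS vm m).1 q < (SS vm m).1 p := by
    rw [SS_fun, SS_fun]
    apply Finset.sum_lt_sum
    · intro w hw
      apply mul_le_mul_of_nonneg_left _ (by positivity)
      have := hm v hv w hw q p
      omega
    · refine ⟨v, hv, mul_lt_mul_of_pos_left hc ?_⟩
      have := Finsupp.mem_support_iff.mp hv
      positivity
  rcases hpq with h | h <;> omega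

lemma del_SS (s : A.Ord) (m : V →₀ ℕ) (κ : ℤ) :
    del s (SS vm m) κ = ∑ v ∈ m.support, (m v : ℤ) * del s (vm v) κ := by
  unfold del
  rw [SS_fun, SS_fun, ← Finset.sum_sub_distrib]
  apply Finset.sum_congr rfl
  intro v _
  ring

lemma compatM_count (hinj : Function.Injective vm) (hdeg : ∀ v, deg (vm v) = 1)
    (m : V →₀ ℕ) (hm : CompatM vm m) (v : V)
    (hv : MonoFor (ltH (SS vm m)) (vm v)) :
    (m v : ℤ) = del (ltH (SS vm m)) (SS vm m) (color (vm v)) := by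
  classical
  set s := ltH (SS vm m) with hs
  rw [del_SS]
  have hN := s.card_pos'
  have h1 : ∀ w ∈ m.support, (m w : ℤ) * del s (vm w) (color (vm v))
      = if w = v then (m v : ℤ) else 0 := by
    intro w hw
    have hw' := compatM_mono vm m hm w hw
    split_ifs with h
    · subst h
      rw [eq_vv_color s (vm w) (hdeg w) hw', color_vv, del_vv, if_pos, mul_one]
      simp [Int.sub_emod]
    · rw [eq_vv_color s (vm w) (hdeg w) hw', del_vv, if_neg, mul_zero]
      intro h2
      apply h
      apply hinj
      rw [eq_vv_color s (vm w) (hdeg w) hw', eq_vv_color s (vm v) (hdeg v) hv]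
      have h3 := Int.mul_ediv_add_emod (color (vm v) - color (vm w)) (Fintype.card D : ℤ)
      rw [h2, add_zero] at h3
      rw [show color (vm v) = color (vm w)
        + (Fintype.card D : ℤ) * ((color (vm v) - color (vm w)) / (Fintype.card D : ℤ)) by
          omega, vv_period]
  rw [Finset.sum_congr rfl h1, Finset.sum_ite_eq']
  split_ifs with h
  · rfl
  · simpa using h

lemma compatM_unique (hinj : Function.Injective vm) (hdeg : ∀ v, deg (vm v) = 1)
    (m m' : V →₀ ℕ) (hm : CompatM vm m) (hm' : CompatM vm m') (h : SS vm m = SS vm m') :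
    m = m' := by
  ext v
  by_cases hv : MonoFor (ltH (SS vm m)) (vm v)
  · have h1 := compatM_count vm hinj hdeg m hm v hv
    have h2 := compatM_count vm hinj hdeg m' hm' v (h ▸ hv)
    rw [h, ← h2] at h1
    exact_mod_cast h1
  · have h1 : m v = 0 := by
      by_contra hc
      exact hv (compatM_mono vm m hm v (Finsupp.mem_support_iff.mpr hc))
    have h2 : m' v = 0 := by
      by_contra hc
      exact hv (h ▸ compatM_mono vm m' hm' v (Finsupp.mem_support_iff.mpr hc))
    rw [h1, h2]

variable (K : Type) [Field K]

noncomputable def phi : MvPolynomial V K →ₐ[K] AddMonoidAlgebra K A.M :=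
  MvPolynomial.aeval fun v => AddMonoidAlgebra.single (vm v) 1

lemma phi_monomial (m : V →₀ ℕ) :
    phi vm K (MvPolynomial.monomial m 1) = AddMonoidAlgebra.single (SS vm m) 1 := by
  unfold phi
  rw [MvPolynomial.aeval_monomial, map_one, one_mul]
  induction m using Finsupp.induction_linear with
  | zero => simp [AddMonoidAlgebra.one_def]
  | add f g hf hg =>
    rw [Finsupp.prod_add_index' (by simp) (by intros; rw [pow_add]), hf, hg, map_add,
      AddMonoidAlgebra.single_mul_single, one_mul]
  | single v n =>
    rw [SS_single]
    simp [AddMonoidAlgebra.single_pow]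

lemma SS_surj (hsurj : ∀ h : A.M, deg h = 1 → ∃ v, vm v = h) (h : A.M) : ∃ m, SS vm m = h := by
  choose f hf using fun κ : ℤ => hsurj (vv (ltH h) κ) (vv_deg _ κ)
  obtain ⟨⟨s, α⟩, rfl⟩ := (eeEquiv (A := A)).surjective h
  rw [eeEquiv_apply] at *
  refine ⟨∑ i : Fin (Fintype.card D), Finsupp.single (f ((i : ℕ) : ℤ))
    (eps s ((i : ℕ) : ℤ) + α i), ?_⟩
  rw [map_sum]
  unfold ee LL
  apply Finset.sum_congr rfl
  intro i _
  rw [SS_single, hf, ltH_ee]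

lemma straighten (I : Ideal (MvPolynomial V K))
    (hA : I ≤ RingHom.ker (phi vm K))
    (hB : ∀ v w, ¬ Compat (vm v) (vm w) → ∃ u z, Compat (vm u) (vm z) ∧
      (MvPolynomial.X v * MvPolynomial.X w - MvPolynomial.X u * MvPolynomial.X z
        : MvPolynomial V K) ∈ I) (n : ℕ) :
    ∀ m : V →₀ ℕ, wt vm m = n → ∃ m', SS vm m' = SS vm m ∧ CompatM vm m' ∧
      (MvPolynomial.monomial m 1 - MvPolynomial.monomial m' 1 : MvPolynomial V K) ∈ I := by
  classical
  induction n using Nat.strong_induction_on with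
  | _ n ih =>
  intro m hn
  by_cases hm : CompatM vm m
  · exact ⟨m, rfl, hm, by simp⟩
  unfold CompatM at hm
  push Not at hm
  obtain ⟨v, hv, w, hw, hvw⟩ := hm
  obtain ⟨u, z, huz, hmem⟩ := hB v w hvw
  have hne : v ≠ w := by
    rintro rfl
    exact hvw fun p q h => by omega
  obtain ⟨m0, rfl⟩ : ∃ m0, m = m0 + (Finsupp.single v 1 + Finsupp.single w 1) := by
    refine ⟨m - (Finsupp.single v 1 + Finsupp.single w 1), (tsub_add_cancel_of_le ?_).symm⟩
    intro x
    have h1 := Nat.pos_of_ne_zero (Finsupp.mem_support_iff.mp hv)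
    have h2 := Nat.pos_of_ne_zero (Finsupp.mem_support_iff.mp hw)
    simp only [Finsupp.add_apply, Finsupp.single_apply]
    split_ifs with h3 h4 h4
    · exact absurd (h3.trans h4.symm) hne
    · subst h3; omega
    · subst h4; omega
    · omega
  have hX : ∀ a b : V, (MvPolynomial.X a * MvPolynomial.X b : MvPolynomial V K)
      = MvPolynomial.monomial (Finsupp.single a 1 + Finsupp.single b 1) 1 := by
    intro a b
    simp [MvPolynomial.X, MvPolynomial.monomial_mul]
  have hsum : vm v + vm w = vm u + vm z := by
    have h1 := hA hmem
    rw [RingHom.mem_ker, map_sub, hX, hX, sub_eq_zero, phi_monomial, phi_monomial] at h1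
    simp only [map_add, SS_single, one_smul] at h1
    exact AddMonoidAlgebra.single_left_injective one_ne_zero h1
  have hcost : cost (vm u) + cost (vm z) < cost (vm v) + cost (vm w) := by
    rw [← cost_add_eq _ _ huz, ← hsum]
    exact cost_lt_of_not_compat _ _ hvw
  obtain ⟨m', h1, h2, h3⟩ := ih (wt vm (m0 + (Finsupp.single u 1 + Finsupp.single z 1))) (by
    rw [← hn]
    simp only [map_add, wt_single, one_mul]
    omega) _ rfl
  refine ⟨m', ?_, h2, ?_⟩
  · rw [h1]
    simp only [map_add, SS_single, one_smul, hsum]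
  · have h4 : (MvPolynomial.monomial (m0 + (Finsupp.single v 1 + Finsupp.single w 1)) 1
        - MvPolynomial.monomial (m0 + (Finsupp.single u 1 + Finsupp.single z 1)) 1
          : MvPolynomial V K) ∈ I := by
      have : ∀ x : V →₀ ℕ, (MvPolynomial.monomial (m0 + x) 1 : MvPolynomial V K)
          = MvPolynomial.monomial m0 1 * MvPolynomial.monomial x 1 := by
        intro x; simp [MvPolynomial.monomial_mul]
      rw [this, this, ← mul_sub, ← hX, ← hX]
      exact I.mul_mem_left _ hmem
    have := I.add_mem h4 h3
    simpa using this

theorem straight_equiv (hinj : Function.Injective vm) (hdeg : ∀ v, deg (vm v) = 1)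
    (hsurj : ∀ h : A.M, deg h = 1 → ∃ v, vm v = h)
    (I : Ideal (MvPolynomial V K))
    (hA : I ≤ RingHom.ker (phi vm K))
    (hB : ∀ v w, ¬ Compat (vm v) (vm w) → ∃ u z, Compat (vm u) (vm z) ∧
      (MvPolynomial.X v * MvPolynomial.X w - MvPolynomial.X u * MvPolynomial.X z
        : MvPolynomial V K) ∈ I) :
    ∃ e : (MvPolynomial V K ⧸ I) ≃ₐ[K] AddMonoidAlgebra K A.M,
      ∀ v, e (Ideal.Quotient.mk I (MvPolynomial.X v)) = AddMonoidAlgebra.single (vm v) 1 := by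
  have hex : ∀ h : A.M, ∃ m, SS vm m = h ∧ CompatM vm m := by
    intro h
    obtain ⟨m, rfl⟩ := SS_surj vm hsurj h
    obtain ⟨m', h1, h2, _⟩ := straighten vm K I hA hB _ m rfl
    exact ⟨m', h1, h2⟩
  choose nf hnf1 hnf2 using hex
  let b := AddMonoidAlgebra.basis A.M K
  let psi : AddMonoidAlgebra K A.M →ₗ[K] (MvPolynomial V K ⧸ I) :=
    b.constr K fun h => Ideal.Quotient.mk I (MvPolynomial.monomial (nf h) 1)
  have hpsi : ∀ h, psi (AddMonoidAlgebra.single h 1)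
      = Ideal.Quotient.mk I (MvPolynomial.monomial (nf h) 1) := by
    intro h
    have := b.constr_basis K (fun h => Ideal.Quotient.mk I (MvPolynomial.monomial (nf h) 1)) h
    rwa [AddMonoidAlgebra.basis_apply] at this
  have hcomp : psi ∘ₗ (phi vm K).toLinearMap = (Ideal.Quotient.mkₐ K I).toLinearMap := by
    apply MvPolynomial.basisMonomials V K |>.ext
    intro m
    rw [MvPolynomial.coe_basisMonomials]
    simp only [LinearMap.comp_apply, AlgHom.toLinearMap_apply, phi_monomial, hpsi,
      Ideal.Quotient.mkₐ_eq_mk]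
    obtain ⟨m', h1, h2, h3⟩ := straighten vm K I hA hB _ m rfl
    have : nf (SS vm m) = m' :=
      compatM_unique vm hinj hdeg _ _ (hnf2 _) h2 (by rw [hnf1, h1])
    rw [this]
    exact ((Ideal.Quotient.mk_eq_mk_iff_sub_mem _ _).mpr h3).symm
  have hker : I = RingHom.ker (phi vm K) := by
    apply le_antisymm hA
    intro f hf
    have h1 := LinearMap.congr_fun hcomp f
    simp only [LinearMap.comp_apply, AlgHom.toLinearMap_apply] at h1
    rw [RingHom.mem_ker] at hf
    rw [hf, map_zero] at h1
    exact Ideal.Quotient.eq_zero_iff_mem.mp h1.symm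
  have hphis : Function.Surjective (phi vm K) := by
    intro x
    induction x using AddMonoidAlgebra.induction_linear with
    | zero => exact ⟨0, map_zero _⟩
    | add f g hf hg =>
      obtain ⟨a, rfl⟩ := hf
      obtain ⟨c, rfl⟩ := hg
      exact ⟨a + c, map_add _ _ _⟩
    | single h r =>
      refine ⟨r • MvPolynomial.monomial (nf h) 1, ?_⟩
      rw [map_smul, phi_monomial, hnf1]
      simp
  refine ⟨(Ideal.quotientEquivAlgOfEq K hker).trans
    (Ideal.quotientKerAlgEquivOfSurjective hphis), ?_⟩
  intro v
  change phi vm K (MvPolynomial.X v) = _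
  simp [phi]

end straight

end AffSys


namespace AffSys

variable {D : Type} {A : AffSys D} [Fintype D]

theorem main_abstract {V : Type} [Fintype V] (vm : V → A.M) (K : Type) [Field K]
    (hinj : Function.Injective vm) (hdeg : ∀ v, deg (vm v) = 1)
    (hsurj : ∀ h : A.M, deg h = 1 → ∃ v, vm v = h)
    (I : Ideal (MvPolynomial V K))
    (hA : I ≤ RingHom.ker (phi vm K))
    (hB : ∀ v w, ¬ Compat (vm v) (vm w) → ∃ u z, Compat (vm u) (vm z) ∧
      (MvPolynomial.X v * MvPolynomial.X w - MvPolynomial.X u * MvPolynomial.X z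
        : MvPolynomial V K) ∈ I) :
    IsDomain (MvPolynomial V K ⧸ I) ∧ IsIntegrallyClosed (MvPolynomial V K ⧸ I) ∧
    ∃ rs : List (MvPolynomial V K ⧸ I),
      RingTheory.Sequence.IsRegular (MvPolynomial V K ⧸ I) rs ∧
      (∀ r ∈ rs, r ∈ Ideal.map (Ideal.Quotient.mk I)
        (Ideal.span (Set.range (MvPolynomial.X : V → MvPolynomial V K)))) ∧
      (rs.length : WithBot (WithTop ℕ)) = ringKrullDim (MvPolynomial V K ⧸ I) := by
  classical
  obtain ⟨e, he⟩ := straight_equiv vm K hinj hdeg hsurj I hA hB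
  obtain ⟨hdom, hnor⟩ := normal_M (A := A) K
  have hdomR : IsDomain (MvPolynomial V K ⧸ I) := e.toRingEquiv.toMulEquiv.isDomain _
  refine ⟨hdomR, IsIntegrallyClosed.of_equiv e.toRingEquiv.symm, ?_⟩
  let L : ℕ := ∏ v, cost (vm v)
  let kk : A.M → ℕ := fun h => L / cost h
  have hL : 0 < L := Finset.prod_pos fun v _ => cost_pos _ (hdeg v)
  have hkk : ∀ h : A.M, deg h = 1 → kk h * cost h = L := by
    intro h hh
    obtain ⟨v, rfl⟩ := hsurj h hh
    exact Nat.div_mul_cancel (Finset.dvd_prod_of_mem (fun v => cost (vm v)) (Finset.mem_univ v))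
  have hkpos : ∀ h : A.M, deg h = 1 → 0 < kk h := by
    intro h hh
    have := hkk h hh
    by_contra hc
    have h0 : kk h = 0 := by omega
    rw [h0, zero_mul] at this
    omega
  let N := Fintype.card D
  let θ : Fin N → MvPolynomial V K ⧸ I := fun i =>
    ∑ v ∈ Finset.univ.filter (fun v => color (vm v) = ((i : ℕ) : ℤ)),
      (Ideal.Quotient.mk I (MvPolynomial.X v)) ^ kk (vm v)
  let b : Module.Basis (A.Ord × (Fin N → ℕ)) K (MvPolynomial V K ⧸ I) :=
    ((AddMonoidAlgebra.basis A.M K).map e.symm.toLinearEquiv).reindex eeEquiv.symm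
  have hb : ∀ s α, b (s, α) = e.symm (AddMonoidAlgebra.single (ee s α) 1) := by
    intro s α
    simp [b, AddMonoidAlgebra.basis_apply]
    rfl
  have hb' : ∀ h : A.M, e.symm (AddMonoidAlgebra.single h 1) = b (eeEquiv.symm h) := by
    intro h
    have := hb (eeEquiv.symm h).1 (eeEquiv.symm h).2
    rw [← eeEquiv_apply] at this
    simpa using this.symm
  letI : Algebra (MvPolynomial (Fin N) K) (MvPolynomial V K ⧸ I) :=
    (MvPolynomial.aeval θ : MvPolynomial (Fin N) K →ₐ[K] _).toRingHom.toAlgebra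
  haveI : IsScalarTower K (MvPolynomial (Fin N) K) (MvPolynomial V K ⧸ I) :=
    IsScalarTower.of_algebraMap_eq' (by
      ext x
      exact ((MvPolynomial.aeval θ : MvPolynomial (Fin N) K →ₐ[K] _).commutes x).symm)
  have halg : ∀ i, algebraMap (MvPolynomial (Fin N) K) (MvPolynomial V K ⧸ I) (.X i) = θ i := by
    intro i
    exact MvPolynomial.aeval_X θ i
  have hmul : ∀ i s α, θ i * b (s, α) =
      ∑ v ∈ Finset.univ.filter (fun v => color (vm v) = ((i : ℕ) : ℤ)),
        b (eeEquiv.symm (ee s α + kk (vm v) • vm v)) := by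
    intro i s α
    simp only [θ]
    rw [Finset.sum_mul]
    apply Finset.sum_congr rfl
    intro v _
    rw [← hb', hb, ← e.symm_apply_apply (Ideal.Quotient.mk I (MvPolynomial.X v)), he,
      ← map_pow, ← map_mul, AddMonoidAlgebra.single_pow, AddMonoidAlgebra.single_mul_single,
      one_pow, one_mul, add_comm]
  obtain ⟨hfree, hfin⟩ := free_of_unitri b (fun x => rk (ee x.1 x.2)) θ
    (fun s i => kk (vv s ((i : ℕ) : ℤ))) (fun s i => hkpos _ (vv_deg _ _))
    ((Fintype.card A.Near + 1) * L)
    (by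
      intro s α i
      simp only
      rw [ee_add_single]
      have := rk_eq (ee s α) ((i : ℕ) : ℤ) (kk (vv s ((i : ℕ) : ℤ)))
      rw [ltH_ee, hkk _ (vv_deg _ _)] at this
      exact this)
    (by
      intro s α i
      obtain ⟨v', hv'⟩ := hsurj (vv s ((i : ℕ) : ℤ)) (vv_deg _ _)
      have hcol : color (vm v') = ((i : ℕ) : ℤ) := by
        rw [hv', color_vv]
        apply Int.emod_eq_of_lt <;> have := i.2 <;> omega
      have hmem : v' ∈ Finset.univ.filter (fun v => color (vm v) = ((i : ℕ) : ℤ)) := by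
        simp [hcol]
      rw [hmul, ← Finset.add_sum_erase _ _ hmem]
      have h1 : (eeEquiv.symm (ee s α + kk (vm v') • vm v'))
          = (s, α + Pi.single i (kk (vv s ((i : ℕ) : ℤ)))) := by
        rw [Equiv.symm_apply_eq, eeEquiv_apply, ee_add_single, hv']
      rw [h1, add_sub_cancel_left]
      apply Submodule.sum_mem
      intro v hv
      rw [Finset.mem_erase, Finset.mem_filter] at hv
      apply Submodule.subset_span
      refine ⟨_, ?_, rfl⟩
      change rk (eeEquiv (eeEquiv.symm (ee s α + kk (vm v) • vm v))) < _
      rw [Equiv.apply_symm_apply, ← hkk (vm v) (hdeg v)]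
      apply rk_lt _ _ _ (hkpos _ (hdeg v))
      rw [ltH_ee]
      intro hm
      apply hv.1
      apply hinj
      rw [hv', eq_vv_color s (vm v) (hdeg v) hm, hv.2.2])
    halg
  obtain ⟨hreg, hdim⟩ := cm_of_free (K := K) (R := MvPolynomial V K ⧸ I) (N := N)
  refine ⟨_, hreg, ?_, ?_⟩
  · intro r hr
    rw [List.mem_ofFn] at hr
    obtain ⟨i, rfl⟩ := hr
    rw [halg]
    apply Ideal.sum_mem
    intro v _
    apply Ideal.pow_mem_of_mem _ _ _ (hkpos _ (hdeg v))
    exact Ideal.mem_map_of_mem _ (Ideal.subset_span ⟨v, rfl⟩)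
  · rw [hdim, List.length_ofFn]
    rfl

end AffSys


/-- ceiling of `x / p` -/
def cl (x p : ℤ) : ℤ := -((-x) / p)

lemma cl_le {x p k : ℤ} (hp : 0 < p) : cl x p ≤ k ↔ x ≤ k * p := by
  unfold cl
  rw [neg_le, Int.le_ediv_iff_mul_le hp]
  constructor <;> intro h <;> linarith

lemma cl_add {x p k : ℤ} (hp : 0 < p) : cl (x + k * p) p = cl x p + k := by
  apply eq_of_forall_ge_iff
  intro c
  rw [cl_le hp, show cl x p + k ≤ c ↔ cl x p ≤ c - k by constructor <;> intro h <;> linarith,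
    cl_le hp]
  constructor <;> intro h <;> linarith

lemma cl_mono {x y p : ℤ} (hp : 0 < p) (h : x ≤ y) : cl x p ≤ cl y p := by
  rw [cl_le hp]
  exact h.trans ((cl_le hp).mp le_rfl)

lemma lt_cl {x p k : ℤ} (hp : 0 < p) : k < cl x p ↔ k * p < x := by
  rw [← not_le, cl_le hp, not_le]

lemma cl_fun (p : ℤ) (hp : 0 < p) (f : ℤ → ℤ) (hm : Monotone f)
    (hf : ∀ x, f (x + p) = f x + 1) : ∃ ξ, ∀ X, f X = cl (X - ξ) p := by
  have hfk : ∀ (k : ℕ) x, f (x + k * p) = f x + k := by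
    intro k
    induction k with
    | zero => simp
    | succ k ih =>
      intro x
      have := hf (x + k * p)
      rw [ih] at this
      push_cast
      rw [← add_assoc, ← this]
      congr 1
      ring
  have hfz : ∀ (k : ℤ) x, f (x + k * p) = f x + k := by
    intro k x
    obtain ⟨n, rfl | rfl⟩ := k.eq_nat_or_neg
    · exact hfk n x
    · have := hfk n (x + -(n : ℤ) * p)
      rw [show x + -(n : ℤ) * p + n * p = x by ring] at this
      linarith
  obtain ⟨c, hc, hmin⟩ := Int.exists_least_of_bdd (P := fun t => 0 < f t)
    ⟨(-f 0) * p, fun z hz => by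
      by_contra hlt
      have h1 := hm (le_of_lt (not_le.mp hlt))
      have h2 := hfz (-f 0) 0
      rw [zero_add] at h2
      omega⟩
    ⟨(-f 0 + 1) * p, by
      have h2 := hfz (-f 0 + 1) 0
      rw [zero_add] at h2
      omega⟩
  have h0 : ∀ X, f X ≤ 0 ↔ X ≤ c - 1 := by
    intro X
    constructor
    · intro h
      by_contra hX
      have := hm (show c ≤ X by omega)
      omega
    · intro h
      by_contra hX
      have := hmin X (by omega)
      omega
  refine ⟨c - 1, fun X => ?_⟩
  apply eq_of_forall_ge_iff
  intro k
  rw [cl_le hp]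
  have h1 := hfz (-k) X
  have h2 := h0 (X + -k * p)
  rw [h1] at h2
  constructor
  · intro h
    have := h2.mp (by omega)
    linarith
  · intro h
    have := h2.mpr (by linarith)
    omega

/-- A periodic two-sided ladder. -/
structure Ladder where
  p1 : ℕ
  p2 : ℕ
  p1_pos : 0 < p1
  p2_pos : 0 < p2
  low : ℤ → ℤ
  up : ℤ → ℤ
  low_mono : Monotone low
  up_mono : Monotone up
  low_per : ∀ x, low (x + p1) = low x + p2
  up_per : ∀ x, up (x + p1) = up x + p2
  low_up : ∀ x, low x ≤ up (x - 1)
  width : ∀ x, up x ≤ low x + p2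

namespace Ladder

variable (L : Ladder)

lemma per_mul {f : ℤ → ℤ} {p q : ℤ} (hf : ∀ x, f (x + p) = f x + q) (k x : ℤ) :
    f (x + k * p) = f x + k * q := by
  have hfk : ∀ (k : ℕ) x, f (x + k * p) = f x + k * q := by
    intro k
    induction k with
    | zero => simp
    | succ k ih =>
      intro x
      have := hf (x + k * p)
      rw [ih] at this
      push_cast
      rw [show x + ((k : ℤ) + 1) * p = x + k * p + p by ring, this]
      ring
  obtain ⟨n, rfl | rfl⟩ := k.eq_nat_or_neg
  · exact hfk n x
  · have := hfk n (x + -(n : ℤ) * p)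
    rw [show x + -(n : ℤ) * p + n * p = x by ring] at this
    linarith

lemma hp1 : (0 : ℤ) < L.p1 := by exact_mod_cast L.p1_pos
lemma hp2 : (0 : ℤ) < L.p2 := by exact_mod_cast L.p2_pos

/-- The fundamental domain. -/
def Om : Set (ℤ × ℤ) := {ω | 1 ≤ ω.1 ∧ ω.1 ≤ L.p1 ∧ L.low ω.1 ≤ ω.2 ∧ ω.2 ≤ L.up ω.1}

abbrev DD : Type := Fin L.p1 ⊕ Fin L.p2

/-- position of a cut -/
def pos : L.DD → ℤ → ℤ
  | .inl i, t => (i : ℕ) + 1 + t * L.p1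
  | .inr j, t => (j : ℕ) + 1 + t * L.p2

def key : L.DD × ℤ → ℤ
  | (.inl i, t) => 2 * L.up (L.pos (.inl i) t - 1) + 1
  | (.inr j, t) => 2 * L.pos (.inr j) t

def hh (ω : ℤ × ℤ) : L.DD × ℤ → ℤ
  | (.inl i, t) => cl (L.pos (.inl i) t - ω.1) L.p1
  | (.inr j, t) => cl (L.pos (.inr j) t - ω.2) L.p2

lemma exists_inl (X : ℤ) : ∃ i t, L.pos (.inl i) t = X := by
  have h0 := L.hp1
  have h1 := Int.emod_lt_of_pos (X - 1) h0
  have h2 := Int.emod_nonneg (X - 1) h0.ne'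
  refine ⟨⟨((X - 1) % L.p1).toNat, by omega⟩, (X - 1) / L.p1, ?_⟩
  have := Int.emod_add_mul_ediv (X - 1) L.p1
  simp only [pos]
  rw [Int.toNat_of_nonneg h2]
  linarith

lemma exists_inr (X : ℤ) : ∃ i t, L.pos (.inr i) t = X := by
  have h0 := L.hp2
  have h1 := Int.emod_lt_of_pos (X - 1) h0
  have h2 := Int.emod_nonneg (X - 1) h0.ne'
  refine ⟨⟨((X - 1) % L.p2).toNat, by omega⟩, (X - 1) / L.p2, ?_⟩
  have := Int.emod_add_mul_ediv (X - 1) L.p2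
  simp only [pos]
  rw [Int.toNat_of_nonneg h2]
  linarith

lemma pos_inl_inj {i j : Fin L.p1} {s t : ℤ} (h : L.pos (.inl i) s = L.pos (.inl j) t) :
    i = j ∧ s = t := by
  simp only [pos] at h
  have hi := i.2
  have hj := j.2
  have h0 := L.hp1
  have : s = t := by
    rcases lt_trichotomy s t with h1 | h1 | h1
    · nlinarith
    · exact h1
    · nlinarith
  subst this
  exact ⟨by ext; omega, rfl⟩

lemma pos_inr_inj {i j : Fin L.p2} {s t : ℤ} (h : L.pos (.inr i) s = L.pos (.inr j) t) :
    i = j ∧ s = t := by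
  simp only [pos] at h
  have hi := i.2
  have hj := j.2
  have h0 := L.hp2
  have : s = t := by
    rcases lt_trichotomy s t with h1 | h1 | h1
    · nlinarith
    · exact h1
    · nlinarith
  subst this
  exact ⟨by ext; omega, rfl⟩

lemma key_shift (d : L.DD) (s u : ℤ) : L.key (d, s + u) = L.key (d, s) + 2 * L.p2 * u := by
  rcases d with i | j
  · simp only [key, pos]
    rw [show ((i : ℕ) : ℤ) + 1 + (s + u) * L.p1 - 1 = ((i : ℕ) + 1 + s * L.p1 - 1) + u * L.p1 by
      ring, per_mul L.up_per]
    ring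
  · simp only [key, pos]; ring

lemma hh_shift (ω) (d : L.DD) (s u : ℤ) : L.hh ω (d, s + u) = L.hh ω (d, s) + u := by
  rcases d with i | j
  · simp only [hh, pos]
    rw [← cl_add L.hp1]; congr 1; ring
  · simp only [hh, pos]
    rw [← cl_add L.hp2]; congr 1; ring

/-- the base order -/
def oo (p q : L.DD × ℤ) : Prop :=
  L.key p < L.key q ∨ (L.key p = L.key q ∧ L.pos p.1 p.2 < L.pos q.1 q.2)

lemma key_parity_l (i : Fin L.p1) (t) : L.key (.inl i, t) % 2 = 1 := by
  simp only [key]; omega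

lemma key_parity_r (i : Fin L.p2) (t) : L.key (.inr i, t) % 2 = 0 := by
  simp only [key]; omega

def BB : ℕ := L.p2 + (L.low 1).natAbs + 2 * (L.up 0).natAbs + 2 * (L.up L.p1).natAbs + 2

lemma key_bound (d : L.DD) : -(L.BB : ℤ) ≤ L.key (d, 0) ∧ L.key (d, 0) ≤ 2 * L.BB := by
  unfold BB
  rcases d with i | j
  · simp only [key, pos]
    have h1 := L.up_mono (show (0 : ℤ) ≤ ((i : ℕ) : ℤ) + 1 + 0 * L.p1 - 1 by omega)
    have h2 := L.up_mono (show ((i : ℕ) : ℤ) + 1 + 0 * L.p1 - 1 ≤ L.p1 by have := i.2; omega)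
    omega
  · simp only [key, pos]
    have := j.2
    omega

lemma hh_bound (d : L.DD) (ω) (hω : ω ∈ L.Om) :
    -(L.BB : ℤ) ≤ L.hh ω (d, 0) ∧ L.hh ω (d, 0) ≤ L.BB := by
  obtain ⟨h1, h2, h3, h4⟩ := hω
  have h5 := L.low_mono h1
  have h6 := L.up_mono h2
  have p1 := L.hp1
  have p2 := L.hp2
  rcases d with i | j
  · have hi := i.2
    simp only [hh, pos]
    constructor
    · suffices -1 < cl (((i : ℕ) : ℤ) + 1 + 0 * L.p1 - ω.1) L.p1 by unfold BB; omega
      rw [lt_cl p1]; omega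
    · suffices cl (((i : ℕ) : ℤ) + 1 + 0 * L.p1 - ω.1) L.p1 ≤ 1 by unfold BB; omega
      rw [cl_le p1]; omega
  · have hi := j.2
    have hB : (L.BB : ℤ) ≤ L.BB * L.p2 := le_mul_of_one_le_right (by positivity) (by omega)
    have hB2 : (L.BB : ℤ) = L.p2 + (L.low 1).natAbs + 2 * (L.up 0).natAbs
      + 2 * (L.up L.p1).natAbs + 2 := by unfold BB; push_cast; ring
    simp only [hh, pos]
    constructor
    · suffices -(L.BB : ℤ) - 1 < cl (((j : ℕ) : ℤ) + 1 + 0 * L.p2 - ω.2) L.p2 by omega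
      rw [lt_cl p2]
      rw [sub_mul, neg_mul]
      omega
    · rw [cl_le p2]; omega

/-- The affine system of a ladder. -/
def sys : AffSys L.DD where
  o := L.oo
  irrefl q := by unfold oo; omega
  trans := by
    intro p q r h1 h2
    unfold oo at *; omega
  tri := by
    rintro ⟨p, s⟩ ⟨q, t⟩
    unfold oo
    rcases lt_trichotomy (L.key (p, s)) (L.key (q, t)) with h | h | h
    · exact Or.inl (Or.inl h)
    · rcases lt_trichotomy (L.pos p s) (L.pos q t) with h' | h' | h'
      · exact Or.inl (Or.inr ⟨h, h'⟩)
      · right; left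
        rcases p with i | i <;> rcases q with j | j
        · obtain ⟨rfl, rfl⟩ := L.pos_inl_inj h'; rfl
        · have h1 := L.key_parity_l i s
          have h2 := L.key_parity_r j t
          omega
        · have h1 := L.key_parity_r i s
          have h2 := L.key_parity_l j t
          omega
        · obtain ⟨rfl, rfl⟩ := L.pos_inr_inj h'; rfl
      · exact Or.inr (Or.inr (Or.inr ⟨h.symm, h'⟩))
    · exact Or.inr (Or.inr (Or.inl h))
  shift := by
    intro p q s t u h
    unfold oo at *
    rw [key_shift, key_shift]
    rcases h with h | ⟨h, h'⟩
    · left; omega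
    · right
      refine ⟨by omega, ?_⟩
      rcases p with i | i <;> rcases q with j | j
      · simp only [pos] at *
        linarith
      · have h1 := L.key_parity_l i s
        have h2 := L.key_parity_r j t
        omega
      · have h1 := L.key_parity_r i s
        have h2 := L.key_parity_l j t
        omega
      · simp only [pos] at *
        linarith
  succ := by
    intro d t
    left
    rw [key_shift]
    have := L.hp2
    omega
  C p q := L.oo p q ∧ ∀ ω ∈ L.Om, L.hh ω p ≤ L.hh ω q
  C_o h := h.1
  C_shift := by
    rintro d e s t u ⟨h1, h2⟩
    refine ⟨?_, fun ω hω => ?_⟩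
    · unfold oo at *
      rw [key_shift, key_shift]
      rcases h1 with h | ⟨h, h'⟩
      · left; omega
      · right
        refine ⟨by omega, ?_⟩
        rcases d with i | i <;> rcases e with j | j
        · simp only [pos] at *
          linarith
        · have h1 := L.key_parity_l i s
          have h2 := L.key_parity_r j t
          omega
        · have h1 := L.key_parity_r i s
          have h2 := L.key_parity_l j t
          omega
        · simp only [pos] at *
          linarith
    · rw [hh_shift, hh_shift]
      have := h2 ω hω
      omega
  W := 3 * L.BB + 1
  W_pos := by omega
  far := by
    intro d e s t h
    constructor
    · left
      have h1 := L.key_shift d 0 s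
      have h2 := L.key_shift e 0 t
      rw [zero_add] at h1 h2
      rw [h1, h2]
      have h3 := L.key_bound d
      have h4 := L.key_bound e
      have h5 : (2 * L.p2 : ℤ) * (3 * L.BB + 1) ≤ 2 * L.p2 * (t - s) :=
        mul_le_mul_of_nonneg_left (by omega) (by positivity)
      have h6 : (2 * 1 : ℤ) * (3 * L.BB + 1) ≤ 2 * L.p2 * (3 * L.BB + 1) := by
        have := L.hp2
        apply mul_le_mul_of_nonneg_right (by omega) (by positivity)
      rw [mul_sub] at h5
      omega
    · intro ω hω
      have h1 := L.hh_shift ω d 0 s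
      have h2 := L.hh_shift ω e 0 t
      rw [zero_add] at h1 h2
      have h3 := L.hh_bound d ω hω
      have h4 := L.hh_bound e ω hω
      omega
  d0 := .inl ⟨0, L.p1_pos⟩

open AffSys

lemma hh_d0 (ω) (hω : ω ∈ L.Om) : L.hh ω (.inl ⟨0, L.p1_pos⟩, 0) = 0 := by
  obtain ⟨h1, h2, h3, h4⟩ := hω
  simp only [hh, pos]
  have p1 := L.hp1
  apply le_antisymm
  · rw [cl_le p1]; push_cast; omega
  · suffices -1 < cl (((0 : ℕ) : ℤ) + 1 + 0 * L.p1 - ω.1) L.p1 by omega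
    rw [lt_cl p1]; push_cast; omega

/-- the element attached to a point -/
def vmO (ω : L.Om) : L.sys.M := ⟨L.hh ω, by
  have h0 := L.hh_d0 ω ω.2
  refine ⟨h0, ?_, fun p q h => h.2 ω ω.2⟩
  intro d t
  have h1 := L.hh_shift ω d 0 t
  have h2 := L.hh_shift ω (.inl ⟨0, L.p1_pos⟩) 0 1
  rw [zero_add] at h1 h2
  change L.hh ω (d, t) = L.hh ω (d, 0) + t * L.hh ω (.inl ⟨0, L.p1_pos⟩, 1)
  rw [h1, h2, h0]; ring⟩

lemma vmO_deg (ω : L.Om) : deg (L.vmO ω) = 1 := by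
  have h0 := L.hh_d0 ω ω.2
  have h2 := L.hh_shift ω (.inl ⟨0, L.p1_pos⟩) 0 1
  rw [zero_add] at h2
  change L.hh ω (.inl ⟨0, L.p1_pos⟩, 1) = 1
  omega

lemma hh_inj {ω ω' : ℤ × ℤ} (h : L.hh ω = L.hh ω') : ω = ω' := by
  have p1 := L.hp1
  have p2 := L.hp2
  have h1 : ∀ X, cl (X - ω.1) L.p1 = cl (X - ω'.1) L.p1 := by
    intro X
    obtain ⟨i, t, rfl⟩ := L.exists_inl X
    exact congrFun h (.inl i, t)
  have h2 : ∀ X, cl (X - ω.2) L.p2 = cl (X - ω'.2) L.p2 := by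
    intro X
    obtain ⟨i, t, rfl⟩ := L.exists_inr X
    exact congrFun h (.inr i, t)
  have k1 : ∀ X, X ≤ ω.1 ↔ X ≤ ω'.1 := by
    intro X
    have a := cl_le (x := X - ω.1) (k := 0) p1
    have b := cl_le (x := X - ω'.1) (k := 0) p1
    rw [h1] at a
    omega
  have k2 : ∀ X, X ≤ ω.2 ↔ X ≤ ω'.2 := by
    intro X
    have a := cl_le (x := X - ω.2) (k := 0) p2
    have b := cl_le (x := X - ω'.2) (k := 0) p2
    rw [h2] at a
    omega
  exact Prod.ext (eq_of_forall_le_iff k1) (eq_of_forall_le_iff k2)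

lemma vmO_inj : Function.Injective L.vmO := by
  intro ω ω' h
  apply Subtype.ext
  apply L.hh_inj
  exact congrArg Subtype.val h

lemma vmO_surj (h : L.sys.M) (hd : deg h = 1) : ∃ ω, L.vmO ω = h := by
  have p1 := L.hp1
  have p2 := L.hp2
  choose ci ct hc using L.exists_inl
  choose ei et he using L.exists_inr
  let f : ℤ → ℤ := fun X => h.1 (.inl (ci X), ct X)
  let g : ℤ → ℤ := fun X => h.1 (.inr (ei X), et X)
  have hf : ∀ i t, h.1 (.inl i, t) = f (L.pos (.inl i) t) := by
    intro i t
    obtain ⟨h1, h2⟩ := L.pos_inl_inj (hc (L.pos (.inl i) t))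
    simp only [f]
    rw [h1, h2]
  have hg : ∀ i t, h.1 (.inr i, t) = g (L.pos (.inr i) t) := by
    intro i t
    obtain ⟨h1, h2⟩ := L.pos_inr_inj (he (L.pos (.inr i) t))
    simp only [g]
    rw [h1, h2]
  have fper : ∀ x, f (x + L.p1) = f x + 1 := by
    intro x
    rw [show x + L.p1 = L.pos (.inl (ci x)) (ct x + 1) by
      conv_lhs => rw [← hc x]
      simp only [pos]; ring, ← hf, M_shift, hd, one_mul]
  have gper : ∀ x, g (x + L.p2) = g x + 1 := by
    intro x
    rw [show x + L.p2 = L.pos (.inr (ei x)) (et x + 1) by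
      conv_lhs => rw [← he x]
      simp only [pos]; ring, ← hg, M_shift, hd, one_mul]
  have fmono : Monotone f := by
    apply monotone_int_of_le_succ
    intro x
    apply M_C h
    constructor
    · unfold oo
      simp only [key]
      rw [hc, hc]
      have := L.up_mono (show x - 1 ≤ x + 1 - 1 by omega)
      omega
    · intro ω _
      simp only [hh]
      rw [hc, hc]
      exact cl_mono p1 (by omega)
  have gmono : Monotone g := by
    apply monotone_int_of_le_succ
    intro x
    apply M_C h
    constructor
    · unfold oo
      simp only [key]
      rw [he, he]
      omega
    · intro ω _
      simp only [hh]
      rw [he, he]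
      exact cl_mono p2 (by omega)
  obtain ⟨ξ, hξ⟩ := cl_fun L.p1 p1 f fmono fper
  obtain ⟨η, hη⟩ := cl_fun L.p2 p2 g gmono gper
  have hlow : ∀ x, g (L.low x) ≤ f x := by
    intro x
    apply M_C h
    constructor
    · left
      simp only [key]
      rw [hc, he]
      have := L.low_up x
      omega
    · rintro ω ⟨h1, h2, h3, h4⟩
      simp only [hh]
      rw [hc, he, cl_le p2]
      have h5 := (cl_le (x := x - ω.1) (k := cl (x - ω.1) L.p1) p1).mp le_rfl
      have h6 := L.low_mono (show x ≤ ω.1 + cl (x - ω.1) L.p1 * L.p1 by omega)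
      rw [per_mul L.low_per] at h6
      omega
  have hup : ∀ x, f (x + 1) ≤ g (L.up x + 1) := by
    intro x
    apply M_C h
    constructor
    · left
      simp only [key]
      rw [hc, he]
      simp only [add_sub_cancel_right]
      omega
    · rintro ω ⟨h1, h2, h3, h4⟩
      simp only [hh]
      rw [hc, he, cl_le p1]
      have h5 := (cl_le (x := L.up x + 1 - ω.2) (k := cl (L.up x + 1 - ω.2) L.p2) p2).mp le_rfl
      by_contra hcon
      have h6 := L.up_mono (show ω.1 + cl (L.up x + 1 - ω.2) L.p2 * L.p1 ≤ x by omega)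
      rw [per_mul L.up_per] at h6
      omega
  have f1 : f 1 = 0 := by
    have h0 := M_zero h
    change h.1 (.inl ⟨0, L.p1_pos⟩, 0) = 0 at h0
    rw [hf] at h0
    simpa [pos] using h0
  have f2 : f (1 + L.p1) = 1 := by rw [fper, f1]; rfl
  have hξ1 : 1 ≤ ξ := by
    have := (cl_le (x := 1 - ξ) (k := 0) p1).mp (by rw [← hξ, f1])
    omega
  have hξ2 : ξ ≤ L.p1 := by
    have := (lt_cl (x := 1 + L.p1 - ξ) (k := 0) p1).mp (by rw [← hξ, f2]; omega)
    omega
  have hη1 : L.low ξ ≤ η := by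
    have h1 := hlow ξ
    have h2 : f ξ ≤ 0 := by rw [hξ, cl_le p1]; omega
    have := (cl_le (x := L.low ξ - η) (k := 0) p2).mp (by rw [← hη]; omega)
    omega
  have hη2 : η ≤ L.up ξ := by
    have h1 := hup ξ
    have h2 : 0 < f (ξ + 1) := by rw [hξ, lt_cl p1]; omega
    have := (lt_cl (x := L.up ξ + 1 - η) (k := 0) p2).mp (by rw [← hη]; omega)
    omega
  refine ⟨⟨(ξ, η), hξ1, hξ2, hη1, hη2⟩, ?_⟩
  apply Subtype.ext
  funext q
  rcases q with ⟨i | i, t⟩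
  · rw [hf, hξ]; rfl
  · rw [hg, hη]; rfl

lemma compat_of {ω ω' : L.Om} (h1 : ω.1.1 ≤ ω'.1.1) (h2 : ω'.1.1 ≤ ω.1.1 + L.p1)
    (h3 : ω.1.2 ≤ ω'.1.2) (h4 : ω'.1.2 ≤ ω.1.2 + L.p2) :
    Compat (L.vmO ω) (L.vmO ω') ∧ Compat (L.vmO ω') (L.vmO ω) := by
  have p1 := L.hp1
  have p2 := L.hp2
  have key : ∀ q, L.hh ω' q ≤ L.hh ω q ∧ L.hh ω q ≤ L.hh ω' q + 1 := by
    rintro ⟨i | i, t⟩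
    · simp only [hh]
      refine ⟨cl_mono p1 (by omega), ?_⟩
      rw [← cl_add p1]
      exact cl_mono p1 (by omega)
    · simp only [hh]
      refine ⟨cl_mono p2 (by omega), ?_⟩
      rw [← cl_add p2]
      exact cl_mono p2 (by omega)
  constructor
  · rintro p q ⟨a, b⟩
    change L.hh ω p < L.hh ω q at a
    change L.hh ω' q < L.hh ω' p at b
    have := key p
    have := key q
    omega
  · rintro p q ⟨a, b⟩
    change L.hh ω' p < L.hh ω' q at a
    change L.hh ω q < L.hh ω p at b
    have := key p
    have := key q
    omega

theorem main {V : Type} [Fintype V] (ψ : V → ℤ × ℤ) (hψ : Function.Injective ψ)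
    (hmem : ∀ v, ψ v ∈ L.Om) (hsurj : ∀ ω ∈ L.Om, ∃ v, ψ v = ω)
    (K : Type) [Field K] (G : Set (MvPolynomial V K))
    (hA : ∀ f ∈ G, ∃ a b c d, ∃ k : ℤ, f = MvPolynomial.X a * MvPolynomial.X b
        - MvPolynomial.X c * MvPolynomial.X d ∧ (ψ a).1 = (ψ c).1 ∧ (ψ b).1 = (ψ d).1 ∧
        (ψ a).2 = (ψ d).2 + k * L.p2 ∧ (ψ b).2 = (ψ c).2 - k * L.p2)
    (hB1 : ∀ v w u z, (ψ v).1 < (ψ w).1 → (ψ w).2 < (ψ v).2 → ψ u = ((ψ v).1, (ψ w).2) →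
      ψ z = ((ψ w).1, (ψ v).2) → (MvPolynomial.X v * MvPolynomial.X w
        - MvPolynomial.X u * MvPolynomial.X z : MvPolynomial V K) ∈ Ideal.span G)
    (hB2 : ∀ v w u z, (ψ v).1 ≤ (ψ w).1 → (ψ v).2 + L.p2 < (ψ w).2 →
      ψ u = ((ψ w).1, (ψ v).2 + L.p2) → ψ z = ((ψ v).1, (ψ w).2 - L.p2) →
        (MvPolynomial.X v * MvPolynomial.X w
        - MvPolynomial.X u * MvPolynomial.X z : MvPolynomial V K) ∈ Ideal.span G) :
    IsDomain (MvPolynomial V K ⧸ Ideal.span G) ∧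
    IsIntegrallyClosed (MvPolynomial V K ⧸ Ideal.span G) ∧
    ∃ rs : List (MvPolynomial V K ⧸ Ideal.span G),
      RingTheory.Sequence.IsRegular (MvPolynomial V K ⧸ Ideal.span G) rs ∧
      (∀ r ∈ rs, r ∈ Ideal.map (Ideal.Quotient.mk (Ideal.span G))
        (Ideal.span (Set.range (MvPolynomial.X : V → MvPolynomial V K)))) ∧
      (rs.length : WithBot (WithTop ℕ)) = ringKrullDim (MvPolynomial V K ⧸ Ideal.span G) := by
  have p1 := L.hp1
  have p2 := L.hp2
  let vm : V → L.sys.M := fun v => L.vmO ⟨ψ v, hmem v⟩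
  apply AffSys.main_abstract vm K
  · intro v w h
    have := L.vmO_inj h
    exact hψ (congrArg Subtype.val this)
  · intro v; exact L.vmO_deg _
  · intro h hd
    obtain ⟨ω, rfl⟩ := L.vmO_surj h hd
    obtain ⟨v, hv⟩ := hsurj ω.1 ω.2
    exact ⟨v, by simp only [vm]; congr 1; exact Subtype.ext hv⟩
  · rw [Ideal.span_le]
    intro f hf
    obtain ⟨a, b, c, d, k, rfl, h1, h2, h3, h4⟩ := hA f hf
    rw [SetLike.mem_coe, RingHom.mem_ker, map_sub, map_mul, map_mul, sub_eq_zero]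
    simp only [phi, MvPolynomial.aeval_X, AddMonoidAlgebra.single_mul_single, one_mul]
    congr 1
    apply Subtype.ext
    funext q
    change L.hh (ψ a) q + L.hh (ψ b) q = L.hh (ψ c) q + L.hh (ψ d) q
    rcases q with ⟨i | i, t⟩
    · simp only [hh, h1, h2]
    · simp only [hh, h3, h4]
      have e1 := cl_add (x := L.pos (.inr i) t - ((ψ d).2 + k * L.p2)) (k := k) p2
      have e2 := cl_add (x := L.pos (.inr i) t - (ψ c).2) (k := k) p2
      rw [show L.pos (.inr i) t - ((ψ d).2 + k * L.p2) + k * L.p2 = L.pos (.inr i) t - (ψ d).2 by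
        ring] at e1
      rw [show L.pos (.inr i) t - ((ψ c).2 - k * L.p2) = L.pos (.inr i) t - (ψ c).2 + k * L.p2 by
        ring]
      omega
  · have wlog : ∀ v w, (ψ v).1 ≤ (ψ w).1 → (Compat (vm v) (vm w) ∧ Compat (vm w) (vm v)) ∨
        ∃ u z, Compat (vm u) (vm z) ∧
      (MvPolynomial.X v * MvPolynomial.X w - MvPolynomial.X u * MvPolynomial.X z
        : MvPolynomial V K) ∈ Ideal.span G := by
      intro v w h
      obtain ⟨a1, a2, a3, a4⟩ := hmem v
      obtain ⟨b1, b2, b3, b4⟩ := hmem w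
      have c1 := L.low_mono h
      have c2 := L.up_mono h
      have c3 := L.low_mono (show (ψ w).1 ≤ (ψ v).1 + L.p1 by omega)
      have c4 := L.up_mono (show (ψ w).1 ≤ (ψ v).1 + L.p1 by omega)
      rw [L.low_per] at c3
      rw [L.up_per] at c4
      have d1 := L.width (ψ v).1
      have d2 := L.width (ψ w).1
      rcases lt_or_ge (ψ w).2 (ψ v).2 with h1 | h1
      · rcases h.lt_or_eq with h2 | h2
        · right
          obtain ⟨u, hu⟩ := hsurj ((ψ v).1, (ψ w).2) ⟨a1, a2, by simp only; omega, by
            simp only; omega⟩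
          obtain ⟨z, hz⟩ := hsurj ((ψ w).1, (ψ v).2) ⟨b1, b2, by simp only; omega, by
            simp only; omega⟩
          refine ⟨u, z, ?_, hB1 v w u z h2 h1 hu hz⟩
          apply (L.compat_of _ _ _ _).1 <;> simp only [hu, hz] <;> omega
        · left
          apply And.symm
          apply L.compat_of <;> simp only <;> omega
      rcases lt_or_ge ((ψ v).2 + L.p2) (ψ w).2 with h2 | h2
      · right
        obtain ⟨u, hu⟩ := hsurj ((ψ w).1, (ψ v).2 + L.p2) ⟨b1, b2, by simp only; omega, by
            simp only; omega⟩
        obtain ⟨z, hz⟩ := hsurj ((ψ v).1, (ψ w).2 - L.p2) ⟨a1, a2, by simp only; omega, by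
            simp only; omega⟩
        refine ⟨u, z, ?_, hB2 v w u z h h2 hu hz⟩
        apply (L.compat_of _ _ _ _).2 <;> simp only [hu, hz] <;> omega
      · left
        apply L.compat_of <;> simp only <;> omega
    intro v w hvw
    rcases le_total (ψ v).1 (ψ w).1 with h | h
    · rcases wlog v w h with h1 | h1
      · exact absurd h1.1 hvw
      · exact h1
    · rcases wlog w v h with h1 | ⟨u, z, h1, h2⟩
      · exact absurd h1.2 hvw
      · exact ⟨u, z, h1, by rwa [mul_comm (MvPolynomial.X v)]⟩

end Ladder


/-- quasi-periodic extension -/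
def qext (p1 p2 : ℤ) (f : ℤ → ℤ) (x : ℤ) : ℤ := f ((x - 1) % p1 + 1) + (x - 1) / p1 * p2

lemma qext_eq {p1 p2 : ℤ} {f : ℤ → ℤ} {x : ℤ} (k : ℤ) (h1 : 1 ≤ x) (h2 : x ≤ p1) :
    qext p1 p2 f (x + k * p1) = f x + k * p2 := by
  unfold qext
  have hp : p1 ≠ 0 := by omega
  rw [show x + k * p1 - 1 = (x - 1) + k * p1 by ring, Int.add_mul_emod_self_right,
    Int.add_mul_ediv_right _ _ hp, Int.emod_eq_of_lt (by omega) (by omega),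
    Int.ediv_eq_zero_of_lt (by omega) (by omega)]
  simp

lemma qext_decomp {p1 : ℤ} (hp : 0 < p1) (x : ℤ) :
    ∃ x0 k, x = x0 + k * p1 ∧ 1 ≤ x0 ∧ x0 ≤ p1 := by
  refine ⟨(x - 1) % p1 + 1, (x - 1) / p1, ?_, ?_, ?_⟩
  · have := Int.emod_add_mul_ediv (x - 1) p1
    linarith
  · have := Int.emod_nonneg (x - 1) hp.ne'
    omega
  · have := Int.emod_lt_of_pos (x - 1) hp
    omega

lemma qext_per {p1 p2 : ℤ} {f : ℤ → ℤ} (hp : 0 < p1) (x : ℤ) :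
    qext p1 p2 f (x + p1) = qext p1 p2 f x + p2 := by
  obtain ⟨x0, k, rfl, h1, h2⟩ := qext_decomp hp x
  rw [show x0 + k * p1 + p1 = x0 + (k + 1) * p1 by ring, qext_eq _ h1 h2, qext_eq _ h1 h2]
  ring

lemma qext_rel {p1 p2 : ℤ} {f g : ℤ → ℤ} (hp : 0 < p1)
    (h1 : ∀ x, 1 ≤ x → x < p1 → f x ≤ g (x + 1)) (h2 : f p1 ≤ g 1 + p2) (x : ℤ) :
    qext p1 p2 f x ≤ qext p1 p2 g (x + 1) := by
  obtain ⟨x0, k, rfl, h3, h4⟩ := qext_decomp hp x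
  rw [qext_eq _ h3 h4]
  rcases h4.lt_or_eq with h5 | rfl
  · rw [show x0 + k * p1 + 1 = (x0 + 1) + k * p1 by ring, qext_eq _ (by omega) (by omega)]
    have := h1 x0 h3 h5
    omega
  · rw [show x0 + k * x0 + 1 = 1 + (k + 1) * x0 by ring, qext_eq _ (by omega) (by omega)]
    rw [add_mul]
    omega

/-- ladder from data on the fundamental interval -/
def Ladder.ofDom (p1 p2 : ℕ) (hp1 : 0 < p1) (hp2 : 0 < p2) (low0 up0 : ℤ → ℤ)
    (hl : ∀ x : ℤ, 1 ≤ x → x < p1 → low0 x ≤ low0 (x + 1))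
    (hu : ∀ x : ℤ, 1 ≤ x → x < p1 → up0 x ≤ up0 (x + 1))
    (hl1 : low0 p1 ≤ low0 1 + p2) (hu1 : up0 p1 ≤ up0 1 + p2)
    (hlu : ∀ x : ℤ, 1 ≤ x → x < p1 → low0 (x + 1) ≤ up0 x)
    (hlu1 : low0 1 + p2 ≤ up0 p1)
    (hw : ∀ x : ℤ, 1 ≤ x → x ≤ p1 → up0 x ≤ low0 x + p2) : Ladder where
  p1 := p1
  p2 := p2
  p1_pos := hp1
  p2_pos := hp2
  low := qext p1 p2 low0
  up := qext p1 p2 up0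
  low_mono := monotone_int_of_le_succ (qext_rel (by exact_mod_cast hp1) hl hl1)
  up_mono := monotone_int_of_le_succ (qext_rel (by exact_mod_cast hp1) hu hu1)
  low_per := qext_per (by exact_mod_cast hp1)
  up_per := qext_per (by exact_mod_cast hp1)
  low_up := by
    intro x
    have hp : (0 : ℤ) < p1 := by exact_mod_cast hp1
    obtain ⟨x0, k, hx, h3, h4⟩ := qext_decomp hp (x - 1)
    rw [show x = x - 1 + 1 by ring, hx, add_sub_cancel_right, qext_eq _ h3 h4]
    rcases h4.lt_or_eq with h5 | rfl
    · rw [show x0 + k * p1 + 1 = (x0 + 1) + k * p1 by ring, qext_eq _ (by omega) (by omega)]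
      have := hlu x0 h3 h5
      omega
    · rw [show (p1 : ℤ) + k * p1 + 1 = 1 + (k + 1) * p1 by ring, qext_eq _ (by omega) (by omega)]
      rw [add_mul]
      omega
  width := by
    intro x
    obtain ⟨x0, k, rfl, h3, h4⟩ := qext_decomp (show (0 : ℤ) < p1 by exact_mod_cast hp1) x
    rw [qext_eq _ h3 h4, qext_eq _ h3 h4]
    have := hw x0 h3 h4
    omega

lemma Ladder.mem_ofDom (p1 p2 hp1 hp2 low0 up0 hl hu hl1 hu1 hlu hlu1 hw) (ω : ℤ × ℤ) :
    ω ∈ (Ladder.ofDom p1 p2 hp1 hp2 low0 up0 hl hu hl1 hu1 hlu hlu1 hw).Om ↔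
    1 ≤ ω.1 ∧ ω.1 ≤ p1 ∧ low0 ω.1 ≤ ω.2 ∧ ω.2 ≤ up0 ω.1 := by
  unfold Om
  simp only [ofDom, Set.mem_ofPred_eq]
  refine and_congr_right fun h1 => and_congr_right fun h2 => ?_
  have e1 := qext_eq (f := low0) (p2 := p2) 0 h1 h2
  have e2 := qext_eq (f := up0) (p2 := p2) 0 h1 h2
  simp only [zero_mul, add_zero] at e1 e2
  rw [e1, e2]


/-- unit north-east step -/
def neStep (u v : ℤ × ℤ) : Prop := v = (u.1 + 1, u.2) ∨ v = (u.1, u.2 + 1)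

lemma east_cons {a b : ℤ × ℤ} {l : List (ℤ × ℤ)} {x h : ℤ} :
    eastStepOf (a :: b :: l) x h ↔ (a = (x, h) ∧ b = (x + 1, h)) ∨ eastStepOf (b :: l) x h := by
  unfold eastStepOf
  simp only [List.tail_cons, List.zip_cons_cons, List.mem_cons, Prod.mk.injEq]
  constructor
  · rintro (⟨h1, h2⟩ | h1)
    · exact Or.inl ⟨h1.symm, h2.symm⟩
    · exact Or.inr h1
  · rintro (⟨h1, h2⟩ | h1)
    · exact Or.inl ⟨h1.symm, h2.symm⟩
    · exact Or.inr h1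

lemma east_single {a : ℤ × ℤ} {x h : ℤ} : ¬ eastStepOf [a] x h := by
  simp [eastStepOf]

lemma east_mem {L : List (ℤ × ℤ)} {x h : ℤ} (H : eastStepOf L x h) :
    (x, h) ∈ L ∧ (x + 1, h) ∈ L := by
  have := List.of_mem_zip H
  exact ⟨this.1, List.mem_of_mem_tail this.2⟩

lemma neStep_le {u v : ℤ × ℤ} (h : neStep u v) : u.1 ≤ v.1 ∧ u.2 ≤ v.2 := by
  rcases h with rfl | rfl <;> simp

lemma path_ge (l : List (ℤ × ℤ)) : ∀ a, (a :: l).IsChain neStep →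
    ∀ p ∈ a :: l, a.1 ≤ p.1 ∧ a.2 ≤ p.2 := by
  induction l with
  | nil => intro a _ p hp; simp at hp; subst hp; simp
  | cons b l ih =>
    intro a hc p hp
    rw [List.isChain_cons_cons] at hc
    rcases List.mem_cons.1 hp with rfl | hp
    · simp
    · have h1 := ih b hc.2 p hp
      have h2 := neStep_le hc.1
      omega

lemma path_le (l : List (ℤ × ℤ)) (z : ℤ × ℤ) : ∀ a, (a :: l).IsChain neStep →
    (a :: l).getLast? = some z →
    ∀ p ∈ a :: l, p.1 ≤ z.1 ∧ p.2 ≤ z.2 := by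
  intro a hc hz p hp
  induction l generalizing a with
  | nil => simp at hp hz; subst hp hz; simp
  | cons b l ih =>
    rw [List.isChain_cons_cons] at hc
    rw [List.getLast?_cons_cons] at hz
    rcases List.mem_cons.1 hp with rfl | hp
    · have h1 := path_ge l b hc.2 z (List.mem_of_getLast? hz)
      have h2 := neStep_le hc.1
      omega
    · exact ih b hc.2 hz hp

lemma path_east (l : List (ℤ × ℤ)) : ∀ a, (a :: l).IsChain neStep →
    ∀ x h, eastStepOf (a :: l) x h → ∀ p ∈ a :: l,
      (p.1 ≤ x → p.2 ≤ h) ∧ (x + 1 ≤ p.1 → h ≤ p.2) := by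
  induction l with
  | nil => intro a _ x h hx; exact absurd hx east_single
  | cons b l ih =>
    intro a hc x h hx p hp
    rw [List.isChain_cons_cons] at hc
    rcases east_cons.1 hx with ⟨rfl, rfl⟩ | hx2
    · rcases List.mem_cons.1 hp with rfl | hp
      · simp
      · have := path_ge l _ hc.2 p hp
        simp only at this
        omega
    · rcases List.mem_cons.1 hp with rfl | hp
      · have h1 := path_ge l _ hc.2 _ (east_mem hx2).1
        have h2 := neStep_le hc.1
        simp only at h1
        omega
      · exact ih b hc.2 x h hx2 p hp

lemma path_exists (l : List (ℤ × ℤ)) (z : ℤ × ℤ) : ∀ a, (a :: l).IsChain neStep →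
    (a :: l).getLast? = some z → ∀ x, a.1 ≤ x → x < z.1 → ∃ h, eastStepOf (a :: l) x h := by
  induction l with
  | nil => intro a _ hz x h1 h2; simp at hz; subst hz; omega
  | cons b l ih =>
    intro a hc hz x h1 h2
    rw [List.isChain_cons_cons] at hc
    rw [List.getLast?_cons_cons] at hz
    by_cases hb : b.1 ≤ x
    · obtain ⟨h, hh⟩ := ih b hc.2 hz x hb h2
      exact ⟨h, east_cons.2 (Or.inr hh)⟩
    · rcases hc.1 with rfl | rfl
      · refine ⟨a.2, east_cons.2 (Or.inl ⟨?_, ?_⟩)⟩ <;> ext <;> simp at * <;> omega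
      · simp at hb; omega

lemma path_first (l : List (ℤ × ℤ)) (z a : ℤ × ℤ) (hc : (a :: l).IsChain neStep)
    (hz : (a :: l).getLast? = some z) (hne : a ≠ z) :
    eastStepOf (a :: l) a.1 a.2 ∨ (a.1, a.2 + 1) ∈ a :: l := by
  cases l with
  | nil => simp at hz; exact absurd hz hne
  | cons b l =>
    rw [List.isChain_cons_cons] at hc
    rcases hc.1 with rfl | rfl
    · exact Or.inl (east_cons.2 (Or.inl ⟨rfl, rfl⟩))
    · right; simp

lemma path_last (l : List (ℤ × ℤ)) (z : ℤ × ℤ) : ∀ a, (a :: l).IsChain neStep →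
    (a :: l).getLast? = some z → a ≠ z →
    eastStepOf (a :: l) (z.1 - 1) z.2 ∨ (z.1, z.2 - 1) ∈ a :: l := by
  induction l with
  | nil => intro a _ hz hne; simp at hz; exact absurd hz hne
  | cons b l ih =>
    intro a hc hz hne
    rw [List.isChain_cons_cons] at hc
    rw [List.getLast?_cons_cons] at hz
    by_cases hb : b = z
    · subst hb
      rcases hc.1 with rfl | rfl
      · left; apply east_cons.2; left; simp
      · right; simp
    · rcases ih b hc.2 hz hb with h | h
      · exact Or.inl (east_cons.2 (Or.inr h))
      · exact Or.inr (List.mem_cons_of_mem _ h)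

lemma mem_interiorPts_of {L : List (ℤ × ℤ)} {a z p : ℤ × ℤ} (ha : L.head? = some a)
    (hz : L.getLast? = some z) (hp : p ∈ L) (h1 : p ≠ a) (h2 : p ≠ z) : p ∈ interiorPts L := by
  cases L with
  | nil => simp at hp
  | cons b l =>
    simp at ha
    subst ha
    rcases List.mem_cons.1 hp with rfl | hp
    · exact absurd rfl h1
    · unfold interiorPts
      simp only [List.drop_one, List.tail_cons]
      have hl : l ≠ [] := List.ne_nil_of_mem hp
      rw [← List.dropLast_append_getLast hl] at hp
      have hzz : l.getLast hl = z := by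
        rw [List.getLast?_eq_getLast_of_ne_nil (by simp)] at hz
        simpa [List.getLast_cons hl] using hz
      rw [hzz] at hp
      simp at hp
      tauto

lemma path_height {L : List (ℤ × ℤ)} {a0 b0 ak bk : ℤ} (hL : IsNEPath L)
    (hh : L.head? = some (a0, b0)) (hz : L.getLast? = some (ak, bk)) (hak : a0 < ak) :
    ∃ h : ℤ → ℤ, (∀ x y, eastStepOf L x y ↔ a0 ≤ x ∧ x < ak ∧ y = h x) ∧ Monotone h ∧
      (∀ x, b0 ≤ h x ∧ h x ≤ bk) ∧
      (∀ x, a0 ≤ x → x < ak → (x, h x) ∈ L ∧ (x + 1, h x) ∈ L) ∧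
      (h a0 = b0 ∨ (a0, b0 + 1) ∈ L) ∧ (h (ak - 1) = bk ∨ (ak, bk - 1) ∈ L) := by
  obtain ⟨hne, hch⟩ := hL
  cases L with
  | nil => exact absurd rfl hne
  | cons a l =>
    simp only [List.head?_cons, Option.some.injEq] at hh
    subst hh
    have hc : ((a0, b0) :: l).IsChain neStep := hch
    have hex := path_exists l _ _ hc hz
    simp only at hex
    have hne' : ((a0, b0) : ℤ × ℤ) ≠ (ak, bk) := by
      intro h; simp at h; omega
    have hex2 : ∀ x, ∃ h, eastStepOf ((a0, b0) :: l) (max a0 (min x (ak - 1))) h := by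
      intro x; apply hex <;> omega
    choose h hh using hex2
    have huniq : ∀ x y y', eastStepOf ((a0, b0) :: l) x y → eastStepOf ((a0, b0) :: l) x y' →
        y = y' := by
      intro x y y' h1 h2
      have e1 := (path_east l _ hc x y h1 _ (east_mem h2).1).1
      have e2 := (path_east l _ hc x y' h2 _ (east_mem h1).1).1
      simp only at e1 e2
      have := e1 le_rfl
      have := e2 le_rfl
      omega
    have hin : ∀ x, a0 ≤ x → x < ak → max a0 (min x (ak - 1)) = x := by intros; omega
    have hst : ∀ x, a0 ≤ x → x < ak → eastStepOf ((a0, b0) :: l) x (h x) := by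
      intro x h1 h2
      have := hh x
      rwa [hin x h1 h2] at this
    have hiff : ∀ x y, eastStepOf ((a0, b0) :: l) x y ↔ a0 ≤ x ∧ x < ak ∧ y = h x := by
      intro x y
      constructor
      · intro H
        have e1 := path_ge l _ hc _ (east_mem H).1
        have e2 := path_le l _ _ hc hz _ (east_mem H).2
        simp only at e1 e2
        have i1 : x < ak := by omega
        exact ⟨e1.1, i1, huniq _ _ _ H (hst x e1.1 i1)⟩
      · rintro ⟨h1, h2, rfl⟩
        exact hst x h1 h2
    refine ⟨h, hiff, ?_, ?_, ?_, ?_, ?_⟩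
    · intro x y hxy
      rcases eq_or_lt_of_le (show max a0 (min x (ak - 1)) ≤ max a0 (min y (ak - 1)) by omega)
        with he | hlt
      · have h1 := hh x
        rw [he] at h1
        exact (huniq _ _ _ h1 (hh y)).le
      · have := (path_east l _ hc _ _ (hh y) _ (east_mem (hh x)).1).1
        exact this (le_of_lt hlt)
    · intro x
      have e1 := path_ge l _ hc _ (east_mem (hh x)).1
      have e2 := path_le l _ _ hc hz _ (east_mem (hh x)).2
      exact ⟨e1.2, e2.2⟩
    · intro x h1 h2
      exact east_mem (hst x h1 h2)
    · rcases path_first l _ _ hc hz hne' with h1 | h1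
      · left; exact ((hiff _ _).1 h1).2.2.symm
      · right; exact h1
    · rcases path_last l _ _ hc hz hne' with h1 | h1
      · left; exact ((hiff _ _).1 h1).2.2.symm
      · right; exact h1

/-- description of the hole -/
structure HoleShape (D : FrameData) (h1 h2 : ℤ → ℤ) : Prop where
  mem : ∀ c, c ∈ D.holeCells ↔ D.a0 ≤ c.1 ∧ c.1 < D.ak ∧ h2 c.1 ≤ c.2 ∧ c.2 < h1 c.1
  mono1 : Monotone h1
  mono2 : Monotone h2
  b1 : ∀ x, D.b0 ≤ h1 x ∧ h1 x ≤ D.bk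
  b2 : ∀ x, D.b0 ≤ h2 x ∧ h2 x ≤ D.bk
  lt : ∀ x, D.a0 ≤ x → x < D.ak → h2 x < h1 x
  lt' : ∀ x, D.a0 ≤ x → x + 1 < D.ak → h2 (x + 1) < h1 x
  start : h2 D.a0 = D.b0
  fin : h1 (D.ak - 1) = D.bk

theorem frame_shape (D : FrameData) : D.holeCells = ∅ ∨ ∃ h1 h2, HoleShape D h1 h2 := by
  have hd2 : D.S2.head? = some (D.a0, D.b0) := by rw [← D.par.headEq]; exact D.head1
  have hl2 : D.S2.getLast? = some (D.ak, D.bk) := by rw [← D.par.lastEq]; exact D.last1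
  have hak := D.hak
  have hbk := D.hbk
  obtain ⟨h1, i1, m1, b1, p1, s1, e1⟩ := path_height D.par.ne1 D.head1 D.last1 hak
  obtain ⟨h2, i2, m2, b2, p2, s2, e2⟩ := path_height D.par.ne2 hd2 hl2 hak
  have key : ∀ x y y', (x, y) ∈ D.S1 → (x, y') ∈ D.S2 → (x, y) ≠ (D.a0, D.b0) →
      (x, y) ≠ (D.ak, D.bk) → (x, y') ≠ (D.a0, D.b0) → (x, y') ≠ (D.ak, D.bk) → y' < y := by
    intro x y y' q1 q2 q3 q4 q5 q6
    exact D.par.above _ (mem_interiorPts_of D.head1 D.last1 q1 q3 q4) _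
      (mem_interiorPts_of hd2 hl2 q2 q5 q6) rfl
  have hmem : ∀ c, c ∈ D.holeCells ↔ D.a0 ≤ c.1 ∧ c.1 < D.ak ∧ h2 c.1 ≤ c.2 ∧ c.2 < h1 c.1 := by
    intro c
    unfold FrameData.holeCells parCells
    simp only [cellBelowPath, cellAbovePath, Set.mem_ofPred_eq, i1, i2]
    constructor
    · rintro ⟨⟨h, ⟨q1, q2, rfl⟩, q3⟩, ⟨h, ⟨q4, q5, rfl⟩, q6⟩⟩
      exact ⟨q1, q2, q6, q3⟩
    · rintro ⟨q1, q2, q3, q4⟩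
      exact ⟨⟨_, ⟨q1, q2, rfl⟩, q4⟩, ⟨_, ⟨q1, q2, rfl⟩, q3⟩⟩
  have hlt' : ∀ x, D.a0 ≤ x → x + 1 < D.ak → h2 (x + 1) < h1 x := by
    intro x q1 q2
    apply key (x + 1) _ _ (p1 x q1 (by omega)).2 (p2 (x + 1) (by omega) q2).1 <;>
    · intro h; simp only [Prod.mk.injEq] at h; omega
  by_cases hcase : ∀ x, D.a0 ≤ x → x < D.ak → h2 x < h1 x
  · right
    refine ⟨h1, h2, hmem, m1, m2, b1, b2, hcase, hlt', ?_, ?_⟩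
    · rcases s2 with s2 | s2
      · exact s2
      · exfalso
        rcases s1 with s1 | s1
        · have := hcase D.a0 le_rfl hak
          have := b2 D.a0
          omega
        · have := key _ _ _ s1 s2 (by simp) (by simp; omega) (by simp) (by simp; omega)
          omega
    · rcases e1 with e1 | e1
      · exact e1
      · exfalso
        rcases e2 with e2 | e2
        · have := hcase (D.ak - 1) (by omega) (by omega)
          have := b1 (D.ak - 1)
          omega
        · have := key _ _ _ e1 e2 (by simp; omega) (by simp) (by simp; omega) (by simp)
          omega
  · left
    push Not at hcase
    obtain ⟨x, q1, q2, q3⟩ := hcase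
    have hone : D.ak = D.a0 + 1 := by
      by_contra hne
      by_cases hx : x + 1 < D.ak
      · have := hlt' x q1 hx
        have := m2 (show x ≤ x + 1 by omega)
        omega
      · have := hlt' (x - 1) (by omega) (by omega)
        have := m1 (show x - 1 ≤ x by omega)
        rw [sub_add_cancel] at *
        omega
    ext c
    rw [hmem]
    simp only [Set.mem_empty_iff_false, iff_false]
    rintro ⟨r1, r2, r3, r4⟩
    have : c.1 = x := by omega
    rw [this] at r3 r4
    omega


lemma mem_vertexSet_iff {P : Polyomino} {x y : ℤ} : (x, y) ∈ P.vertexSet ↔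
    (x, y) ∈ P.cells ∨ (x - 1, y) ∈ P.cells ∨ (x, y - 1) ∈ P.cells ∨
      (x - 1, y - 1) ∈ P.cells := by
  unfold Polyomino.vertexSet cellVertices
  simp only [Finset.mem_biUnion, Finset.mem_insert, Finset.mem_singleton]
  constructor
  · rintro ⟨⟨c1, c2⟩, hc, h | h | h | h⟩ <;> simp only [Prod.mk.injEq] at h <;>
      obtain ⟨rfl, rfl⟩ := h <;> simp [hc]
  · rintro (h | h | h | h)
    · exact ⟨_, h, by simp⟩
    · exact ⟨_, h, by simp⟩
    · exact ⟨_, h, by simp⟩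
    · exact ⟨_, h, by simp⟩

lemma rect_mem (K : Type) [Field K] {P : Polyomino} {v w u z : PVertex P}
    (hu : u.1 = (v.1.1, w.1.2)) (hz : z.1 = (w.1.1, v.1.2))
    (h : IsInnerInterval P (min v.1.1 w.1.1, min v.1.2 w.1.2)
      (max v.1.1 w.1.1, max v.1.2 w.1.2)) :
    (MvPolynomial.X v * MvPolynomial.X w - MvPolynomial.X u * MvPolynomial.X z :
      MvPolynomial (PVertex P) K) ∈ Ideal.span (innerMinors K P) := by
  obtain ⟨⟨v1, v2⟩, hv⟩ := v
  obtain ⟨⟨w1, w2⟩, hw⟩ := w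
  obtain ⟨⟨u1, u2⟩, hu'⟩ := u
  obtain ⟨⟨z1, z2⟩, hz'⟩ := z
  simp only [Prod.mk.injEq] at hu hz
  obtain ⟨rfl, rfl⟩ := hu
  obtain ⟨rfl, rfl⟩ := hz
  simp only at h
  have h1 := h.1
  have h2 := h.2.1
  simp only at h1 h2
  rcases le_total u1 z1 with i1 | i1 <;> rcases le_total z2 u2 with i2 | i2
  · rw [min_eq_left i1, min_eq_left i2, max_eq_right i1, max_eq_right i2] at h
    exact Ideal.subset_span ⟨⟨(u1, z2), hv⟩, ⟨(z1, u2), hw⟩, ⟨(u1, u2), hu'⟩, ⟨(z1, z2), hz'⟩,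
      h, rfl, rfl, rfl⟩
  · rw [min_eq_left i1, min_eq_right i2, max_eq_right i1, max_eq_left i2] at h
    rw [← neg_mem_iff, neg_sub]
    exact Ideal.subset_span ⟨⟨(u1, u2), hu'⟩, ⟨(z1, z2), hz'⟩, ⟨(u1, z2), hv⟩, ⟨(z1, u2), hw⟩,
      h, rfl, rfl, rfl⟩
  · rw [min_eq_right i1, min_eq_left i2, max_eq_left i1, max_eq_right i2] at h
    rw [← neg_mem_iff, neg_sub]
    refine Ideal.subset_span ⟨⟨(z1, z2), hz'⟩, ⟨(u1, u2), hu'⟩, ⟨(z1, u2), hw⟩, ⟨(u1, z2), hv⟩,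
      h, rfl, rfl, ?_⟩
    ring
  · rw [min_eq_right i1, min_eq_right i2, max_eq_left i1, max_eq_left i2] at h
    refine Ideal.subset_span ⟨⟨(z1, u2), hw⟩, ⟨(u1, z2), hv⟩, ⟨(z1, z2), hz'⟩, ⟨(u1, u2), hu'⟩,
      h, rfl, rfl, ?_⟩
    ring

section shape
variable {P : Polyomino} {D : FrameData} {h1 h2 : ℤ → ℤ}

lemma HoleShape.h2_left (H : HoleShape D h1 h2) {x : ℤ} (hx : x ≤ D.a0) : h2 x = D.b0 := by
  have := H.mono2 hx
  have := H.b2 x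
  have := H.start
  omega

lemma HoleShape.h1_right (H : HoleShape D h1 h2) {x : ℤ} (hx : D.ak - 1 ≤ x) : h1 x = D.bk := by
  have := H.mono1 hx
  have := H.b1 x
  have := H.fin
  omega

lemma HoleShape.h1_gt (H : HoleShape D h1 h2) {x : ℤ} (hx : D.a0 ≤ x) : D.b0 < h1 x := by
  have := H.mono1 hx
  have := H.start
  have := H.lt _ le_rfl D.hak
  omega

lemma HoleShape.h2_lt (H : HoleShape D h1 h2) {x : ℤ} (hx : x < D.ak) : h2 x < D.bk := by
  have := H.mono2 (show x ≤ D.ak - 1 by omega)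
  have := H.fin
  have := D.hak
  have := H.lt (D.ak - 1) (by omega) (by omega)
  omega

lemma mem_cells (hP : IsFrame P D) (H : HoleShape D h1 h2) {c : ℤ × ℤ} : c ∈ P.cells ↔
    (1 ≤ c.1 ∧ c.1 + 1 ≤ D.m ∧ 1 ≤ c.2 ∧ c.2 + 1 ≤ D.n) ∧
    ¬ (D.a0 ≤ c.1 ∧ c.1 < D.ak ∧ h2 c.1 ≤ c.2 ∧ c.2 < h1 c.1) := by
  rw [← Finset.mem_coe, hP, Set.mem_sdiff, H.mem]
  rfl

lemma mem_vert (hP : IsFrame P D) (H : HoleShape D h1 h2) {x y : ℤ} : (x, y) ∈ P.vertexSet ↔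
    (1 ≤ x ∧ x ≤ D.m ∧ 1 ≤ y ∧ y ≤ D.n) ∧
    (x ≤ D.a0 ∨ D.ak ≤ x ∨ h1 (x - 1) ≤ y ∨ y ≤ h2 x) := by
  rw [mem_vertexSet_iff]
  simp only [mem_cells hP H]
  have e1 := H.mono1 (show x - 1 ≤ x by omega)
  have e2 := H.mono2 (show x - 1 ≤ x by omega)
  have e3 := H.b1 x
  have e4 := H.b2 x
  have e5 := H.b1 (x - 1)
  have e6 := H.b2 (x - 1)
  have := D.ha0
  have := D.hak
  have := D.ham
  have := D.hb0
  have := D.hbk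
  have := D.hbn
  constructor
  · omega
  · intro h
    by_cases c1 : x ≤ D.a0
    · by_cases c2 : x = 1 <;> by_cases c3 : y = 1 <;> omega
    · by_cases c2 : x = D.m <;> by_cases c3 : y = 1 <;> omega

lemma inner_iff (hP : IsFrame P D) (H : HoleShape D h1 h2) {a b : ℤ × ℤ}
    (hab1 : a.1 < b.1) (hab2 : a.2 < b.2) (r1 : 1 ≤ a.1) (r2 : b.1 ≤ D.m) (r3 : 1 ≤ a.2)
    (r4 : b.2 ≤ D.n) : IsInnerInterval P a b ↔
      b.1 ≤ D.a0 ∨ D.ak ≤ a.1 ∨ b.2 ≤ h2 a.1 ∨ h1 (b.1 - 1) ≤ a.2 := by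
  unfold IsInnerInterval cellInInterval
  simp only [mem_cells hP H]
  constructor
  · rintro ⟨-, -, h⟩
    by_contra hc
    push Not at hc
    obtain ⟨c1, c2, c3, c4⟩ := hc
    have hl : h2 (max a.1 D.a0) < b.2 := by
      rcases le_total a.1 D.a0 with i | i
      · rw [max_eq_right i]
        have := H.h2_left i
        have := H.h2_left le_rfl
        omega
      · rwa [max_eq_left i]
    have hr : a.2 < h1 (min (b.1 - 1) (D.ak - 1)) := by
      rcases le_total (b.1 - 1) (D.ak - 1) with i | i
      · rwa [min_eq_left i]
      · rw [min_eq_right i]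
        have := H.h1_right i
        have := H.h1_right le_rfl
        omega
    have hak := D.hak
    have hall : ∀ x, max a.1 D.a0 ≤ x → x ≤ min (b.1 - 1) (D.ak - 1) → b.2 ≤ h2 x ∨ h1 x ≤ a.2 := by
      intro x i1 i2
      by_contra hn
      push Not at hn
      have := H.lt x (by omega) (by omega)
      exact (h (x, max a.2 (h2 x)) ⟨by simp only; omega, by simp only; omega,
        by simp only; omega, by simp only; omega⟩).2
        ⟨by simp only; omega, by simp only; omega, by simp only; omega, by simp only; omega⟩
    have hind : ∀ x, max a.1 D.a0 ≤ x → x ≤ min (b.1 - 1) (D.ak - 1) → h1 x ≤ a.2 := by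
      intro x hx
      induction x, hx using Int.leInduction with
      | base =>
        intro i
        rcases hall _ le_rfl i with q | q <;> omega
      | succ x hx ih =>
        intro i
        have j1 := ih (by omega)
        have j2 := H.lt' x (by omega) (by omega)
        rcases hall (x + 1) (by omega) i with q | q <;> omega
    have := hind (min (b.1 - 1) (D.ak - 1)) (by omega) le_rfl
    omega
  · intro h
    refine ⟨hab1, hab2, fun c hc => ⟨by omega, fun hh => ?_⟩⟩
    rcases h with h | h | h | h
    · omega
    · omega
    · have := H.mono2 hc.1
      omega
    · have := H.mono1 (show c.1 ≤ b.1 - 1 by omega)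
      omega

end shape

/-- coordinates on the universal strip -/
def frPsi (D : FrameData) (h1 : ℤ → ℤ) (v : ℤ × ℤ) : ℤ × ℤ :=
  if v.1 ≤ D.a0 ∧ v.2 ≤ D.b0 then (v.1, 1 - v.2)
  else if D.ak ≤ v.1 ∧ D.bk ≤ v.2 then (D.ak + D.m - v.1, v.2 - D.b0)
  else if v.1 < D.ak ∧ D.b0 < v.2 ∧ (v.1 ≤ D.a0 ∨ h1 (v.1 - 1) ≤ v.2) then (v.1, v.2 - D.b0)
  else (D.ak + D.m - v.1, D.n - D.b0 + D.bk - v.2)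

lemma psi_reg {P : Polyomino} {D : FrameData} {h1 h2 : ℤ → ℤ} (hP : IsFrame P D)
    (H : HoleShape D h1 h2) {v : ℤ × ℤ} (hv : v ∈ P.vertexSet) :
    (1 ≤ v.1 ∧ v.1 ≤ D.m ∧ 1 ≤ v.2 ∧ v.2 ≤ D.n) ∧
    ((v.1 ≤ D.a0 ∧ v.2 ≤ D.b0 ∧ (frPsi D h1 v).1 = v.1 ∧ (frPsi D h1 v).2 = 1 - v.2) ∨
     (D.ak ≤ v.1 ∧ D.bk ≤ v.2 ∧ (frPsi D h1 v).1 = D.ak + D.m - v.1 ∧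
        (frPsi D h1 v).2 = v.2 - D.b0) ∨
     (v.1 < D.ak ∧ D.b0 < v.2 ∧ (v.1 ≤ D.a0 ∨ h1 (v.1 - 1) ≤ v.2) ∧ (frPsi D h1 v).1 = v.1 ∧
        (frPsi D h1 v).2 = v.2 - D.b0) ∨
     (D.a0 < v.1 ∧ v.2 < D.bk ∧ (D.ak ≤ v.1 ∨ v.2 ≤ h2 v.1) ∧
        (frPsi D h1 v).1 = D.ak + D.m - v.1 ∧
        (frPsi D h1 v).2 = D.n - D.b0 + D.bk - v.2)) := by
  obtain ⟨x, y⟩ := v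
  have hr := (mem_vert hP H).1 hv
  refine ⟨hr.1, ?_⟩
  unfold frPsi
  simp only
  split_ifs with q1 q2 q3
  · exact Or.inl ⟨q1.1, q1.2, rfl, rfl⟩
  · exact Or.inr (Or.inl ⟨q2.1, q2.2, rfl, rfl⟩)
  · exact Or.inr (Or.inr (Or.inl ⟨q3.1, q3.2.1, q3.2.2, rfl, rfl⟩))
  · refine Or.inr (Or.inr (Or.inr ?_))
    have e3 := H.b1 (x - 1)
    have e4 := H.b2 x
    have g1 : D.a0 < x → D.b0 < h1 (x - 1) := fun h => H.h1_gt (by omega)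
    have g2 : x < D.ak → h2 x < D.bk := fun h => H.h2_lt h
    have := D.hak
    have := D.hbk
    refine ⟨?_, ?_, ?_, rfl, rfl⟩ <;> omega


section frame
variable (D : FrameData) (h1 h2 : ℤ → ℤ)

/-- lower boundary -/
def frLow (x : ℤ) : ℤ :=
  if x ≤ D.a0 then 1 - D.b0 else if x < D.ak then h1 (x - 1) - D.b0
  else if x ≤ D.m then D.bk - D.b0 else D.n - D.b0 + D.bk - h2 (D.ak + D.m - x)

/-- upper boundary -/
def frUp (x : ℤ) : ℤ := if x < D.ak then D.n - D.b0 else D.n - D.b0 + D.bk - 1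

lemma frP1 : (((D.ak - 1 + D.m - D.a0).toNat : ℕ) : ℤ) = D.ak - 1 + D.m - D.a0 := by
  have := D.ha0
  have := D.hak
  have := D.ham
  omega

lemma frP2 : (((D.n - D.b0 + D.bk - 1).toNat : ℕ) : ℤ) = D.n - D.b0 + D.bk - 1 := by
  have := D.hb0
  have := D.hbk
  have := D.hbn
  omega

variable {D h1 h2}

/-- the ladder attached to a frame -/
def frLadder (H : HoleShape D h1 h2) : Ladder :=
  Ladder.ofDom (D.ak - 1 + D.m - D.a0).toNat (D.n - D.b0 + D.bk - 1).toNat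
    (by have := frP1 D; have := D.ha0; have := D.hak; have := D.ham; omega)
    (by have := frP2 D; have := D.hb0; have := D.hbk; have := D.hbn; omega)
    (frLow D h1 h2) (frUp D)
    (by
      intro x
      have a1 := D.ha0; have a2 := D.hak; have a3 := D.ham
      have a4 := D.hb0; have a5 := D.hbk; have a6 := D.hbn
      rw [frP1]
      intro q1 q2
      have e1 := H.b1 (x + 1 - 1)
      have e2 := H.b1 (x - 1)
      have e3 := H.mono1 (show x - 1 ≤ x + 1 - 1 by omega)
      have e4 := H.b2 (D.ak + D.m - x)
      have e5 := H.b2 (D.ak + D.m - (x + 1))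
      have e6 := H.mono2 (show D.ak + D.m - (x + 1) ≤ D.ak + D.m - x by omega)
      unfold frLow
      split_ifs <;> omega)
    (by
      intro x
      have a1 := D.ha0; have a2 := D.hak; have a3 := D.ham
      have a4 := D.hb0; have a5 := D.hbk; have a6 := D.hbn
      intro q1 q2
      unfold frUp
      split_ifs <;> omega)
    (by
      have a1 := D.ha0; have a2 := D.hak; have a3 := D.ham
      have a4 := D.hb0; have a5 := D.hbk; have a6 := D.hbn
      rw [frP1, frP2]
      have e4 := H.b2 (D.ak + D.m - (D.ak - 1 + D.m - D.a0))
      unfold frLow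
      split_ifs <;> omega)
    (by
      have a1 := D.ha0; have a2 := D.hak; have a3 := D.ham
      have a4 := D.hb0; have a5 := D.hbk; have a6 := D.hbn
      rw [frP1, frP2]
      unfold frUp
      split_ifs <;> omega)
    (by
      intro x
      have a1 := D.ha0; have a2 := D.hak; have a3 := D.ham
      have a4 := D.hb0; have a5 := D.hbk; have a6 := D.hbn
      rw [frP1]
      intro q1 q2
      have e1 := H.b1 (x + 1 - 1)
      have e5 := H.b2 (D.ak + D.m - (x + 1))
      unfold frLow frUp
      split_ifs <;> omega)
    (by
      have a1 := D.ha0; have a2 := D.hak; have a3 := D.ham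
      have a4 := D.hb0; have a5 := D.hbk; have a6 := D.hbn
      rw [frP1, frP2]
      unfold frLow frUp
      split_ifs <;> omega)
    (by
      intro x
      have a1 := D.ha0; have a2 := D.hak; have a3 := D.ham
      have a4 := D.hb0; have a5 := D.hbk; have a6 := D.hbn
      rw [frP1, frP2]
      intro q1 q2
      have e1 := H.b1 (x - 1)
      have e4 := H.b2 (D.ak + D.m - x)
      unfold frLow frUp
      split_ifs <;> omega)

lemma frLadder_p2 (H : HoleShape D h1 h2) : ((frLadder H).p2 : ℤ) = D.n - D.b0 + D.bk - 1 :=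
  frP2 D

lemma mem_frLadder (H : HoleShape D h1 h2) (ω : ℤ × ℤ) : ω ∈ (frLadder H).Om ↔
    1 ≤ ω.1 ∧ ω.1 ≤ D.ak - 1 + D.m - D.a0 ∧ frLow D h1 h2 ω.1 ≤ ω.2 ∧ ω.2 ≤ frUp D ω.1 := by
  unfold frLadder
  rw [Ladder.mem_ofDom, frP1]

variable {P : Polyomino}

lemma fr_mem (hP : IsFrame P D) (H : HoleShape D h1 h2) {v : ℤ × ℤ} (hv : v ∈ P.vertexSet) :
    frPsi D h1 v ∈ (frLadder H).Om := by
  have a1 := D.ha0; have a2 := D.hak; have a3 := D.ham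
  have a4 := D.hb0; have a5 := D.hbk; have a6 := D.hbn
  rw [mem_frLadder]
  obtain ⟨r0, r | r | r | r⟩ := psi_reg hP H hv
  · rw [r.2.2.1, r.2.2.2]
    unfold frLow frUp
    split_ifs <;> omega
  · rw [r.2.2.1, r.2.2.2]
    unfold frLow frUp
    split_ifs <;> omega
  · rw [r.2.2.2.1, r.2.2.2.2]
    unfold frLow frUp
    split_ifs <;> omega
  · rw [r.2.2.2.1, r.2.2.2.2]
    have e : D.ak + D.m - (D.ak + D.m - v.1) = v.1 := by ring
    unfold frLow frUp
    rw [e]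
    split_ifs <;> omega

lemma fr_surj (hP : IsFrame P D) (H : HoleShape D h1 h2) {ω : ℤ × ℤ} (hω : ω ∈ (frLadder H).Om) :
    ∃ v ∈ P.vertexSet, frPsi D h1 v = ω := by
  have a1 := D.ha0; have a2 := D.hak; have a3 := D.ham
  have a4 := D.hb0; have a5 := D.hbk; have a6 := D.hbn
  rw [mem_frLadder] at hω
  obtain ⟨x, y⟩ := ω
  simp only at hω
  obtain ⟨q1, q2, q3, q4⟩ := hω
  unfold frLow at q3
  unfold frUp at q4
  have e1 := H.b1 (x - 1)
  have e2 := H.b2 x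
  have e3 := H.b1 (D.ak + D.m - x - 1)
  have e4 := H.b2 (D.ak + D.m - x)
  have g1 : D.a0 < x → D.b0 < h1 (x - 1) := fun h => H.h1_gt (by omega)
  have g2 : x < D.ak → h2 x < D.bk := fun h => H.h2_lt h
  have g3 : D.ak + D.m - x < D.ak → h2 (D.ak + D.m - x) < D.bk := fun h => H.h2_lt h
  have g4 : D.a0 < x → x < D.ak → h2 x < h1 (x - 1) := by
    intro i1 i2
    have := H.lt' (x - 1) (by omega) (by omega)
    rwa [sub_add_cancel] at this
  have g5 : D.a0 < D.ak + D.m - x → D.ak + D.m - x < D.ak →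
      h2 (D.ak + D.m - x) < h1 (D.ak + D.m - x - 1) := by
    intro i1 i2
    have := H.lt' (D.ak + D.m - x - 1) (by omega) (by omega)
    rwa [sub_add_cancel] at this
  have fin : ∀ s t : ℤ, (s, t) ∈ P.vertexSet → ((s, t) ∈ P.vertexSet →
      (frPsi D h1 (s, t)).1 = x ∧ (frPsi D h1 (s, t)).2 = y) →
      ∃ v ∈ P.vertexSet, frPsi D h1 v = (x, y) := by
    intro s t h h'
    exact ⟨_, h, Prod.ext (h' h).1 (h' h).2⟩
  by_cases c1 : x < D.ak
  · by_cases c2 : y ≤ 0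
    · apply fin x (1 - y)
      · rw [mem_vert hP H]
        split_ifs at q3 q4 <;> omega
      · intro h
        have := psi_reg hP H h
        simp only at this
        split_ifs at q3 q4 <;> omega
    · apply fin x (y + D.b0)
      · rw [mem_vert hP H]
        split_ifs at q3 q4 <;> omega
      · intro h
        have := psi_reg hP H h
        simp only at this
        split_ifs at q3 q4 <;> omega
  · by_cases c2 : y ≤ D.n - D.b0
    · apply fin (D.ak + D.m - x) (y + D.b0)
      · rw [mem_vert hP H]
        split_ifs at q3 q4 <;> omega
      · intro h
        have := psi_reg hP H h
        simp only at this
        split_ifs at q3 q4 <;> omega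
    · apply fin (D.ak + D.m - x) (D.n - D.b0 + D.bk - y)
      · rw [mem_vert hP H]
        split_ifs at q3 q4 <;> omega
      · intro h
        have := psi_reg hP H h
        simp only at this
        split_ifs at q3 q4 <;> omega

end frame


section frame
variable {D : FrameData} {h1 h2 : ℤ → ℤ} {P : Polyomino}

lemma fr_col (hP : IsFrame P D) (H : HoleShape D h1 h2) {v w : ℤ × ℤ} (hv : v ∈ P.vertexSet)
    (hw : w ∈ P.vertexSet) (h : (frPsi D h1 v).1 = (frPsi D h1 w).1) : v.1 = w.1 := by
  have a1 := D.ha0; have a2 := D.hak; have a3 := D.ham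
  obtain ⟨r0, r⟩ := psi_reg hP H hv
  obtain ⟨s0, s⟩ := psi_reg hP H hw
  rcases r with r | r | r | r <;> rcases s with s | s | s | s <;> omega

lemma fr_row (hP : IsFrame P D) (H : HoleShape D h1 h2) {v w : ℤ × ℤ} (hv : v ∈ P.vertexSet)
    (hw : w ∈ P.vertexSet) (h : (frPsi D h1 v).2 = (frPsi D h1 w).2) : v.2 = w.2 := by
  have a4 := D.hb0; have a5 := D.hbk; have a6 := D.hbn
  obtain ⟨r0, r⟩ := psi_reg hP H hv
  obtain ⟨s0, s⟩ := psi_reg hP H hw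
  rcases r with r | r | r | r <;> rcases s with s | s | s | s <;> omega

set_option maxHeartbeats 8000000 in
lemma fr_A (hP : IsFrame P D) (H : HoleShape D h1 h2) {a b c d : ℤ × ℤ} (ha : a ∈ P.vertexSet)
    (hb : b ∈ P.vertexSet) (hc : c ∈ P.vertexSet) (hd : d ∈ P.vertexSet)
    (hin : IsInnerInterval P a b) (ec : c = (a.1, b.2)) (ed : d = (b.1, a.2)) :
    (frPsi D h1 a).1 = (frPsi D h1 c).1 ∧ (frPsi D h1 b).1 = (frPsi D h1 d).1 ∧
    ∃ k : ℤ, (frPsi D h1 a).2 = (frPsi D h1 d).2 + k * (D.n - D.b0 + D.bk - 1) ∧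
      (frPsi D h1 b).2 = (frPsi D h1 c).2 - k * (D.n - D.b0 + D.bk - 1) := by
  have a1 := D.ha0; have a2 := D.hak; have a3 := D.ham
  have a4 := D.hb0; have a5 := D.hbk; have a6 := D.hbn
  obtain ⟨ra0, ra⟩ := psi_reg hP H ha
  obtain ⟨rb0, rb⟩ := psi_reg hP H hb
  obtain ⟨rc0, rc⟩ := psi_reg hP H hc
  obtain ⟨rd0, rd⟩ := psi_reg hP H hd
  have i1 := hin.1
  have i2 := hin.2.1
  have hi := (inner_iff hP H i1 i2 ra0.1 rb0.2.1 ra0.2.2.1 rb0.2.2.2).1 hin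
  have c1 : c.1 = a.1 := by rw [ec]
  have c2 : c.2 = b.2 := by rw [ec]
  have d1 : d.1 = b.1 := by rw [ed]
  have d2 : d.2 = a.2 := by rw [ed]
  rw [c1, c2] at rc rc0
  rw [d1, d2] at rd rd0
  clear ec ed hin c1 c2 d1 d2 ha hb hc hd
  have e1 := H.b1 (a.1 - 1)
  have e2 := H.b1 (b.1 - 1)
  have e3 := H.b2 a.1
  have e4 := H.b2 b.1
  have g1 : D.a0 < a.1 → D.b0 < h1 (a.1 - 1) := fun h => H.h1_gt (by omega)
  have g2 : D.a0 < b.1 → D.b0 < h1 (b.1 - 1) := fun h => H.h1_gt (by omega)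
  have g3 : a.1 < D.ak → h2 a.1 < D.bk := fun h => H.h2_lt h
  have g4 : b.1 < D.ak → h2 b.1 < D.bk := fun h => H.h2_lt h
  have g5 : a.1 ≤ D.a0 → h2 a.1 = D.b0 := fun h => H.h2_left h
  have g6 : D.ak ≤ b.1 → h1 (b.1 - 1) = D.bk := fun h => H.h1_right (by omega)
  have g7 : D.a0 < a.1 → a.1 < D.ak → h2 a.1 < h1 (a.1 - 1) := by
    intro i1 i2
    have := H.lt' (a.1 - 1) (by omega) (by omega)
    rwa [sub_add_cancel] at this
  have g8 : D.a0 < b.1 → b.1 < D.ak → h2 b.1 < h1 (b.1 - 1) := by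
    intro i1 i2
    have := H.lt' (b.1 - 1) (by omega) (by omega)
    rwa [sub_add_cancel] at this
  have m1 := H.mono1 (show a.1 - 1 ≤ b.1 - 1 by omega)
  have m2 := H.mono2 (show a.1 ≤ b.1 by omega)
  generalize h1 (a.1 - 1) = A1 at *
  generalize h1 (b.1 - 1) = B1 at *
  generalize h2 a.1 = A2 at *
  generalize h2 b.1 = B2 at *
  generalize frPsi D h1 a = pa at *
  generalize frPsi D h1 b = pb at *
  generalize frPsi D h1 c = pc at *
  generalize frPsi D h1 d = pd at *
  have key : (pa.1 = pc.1 ∧ pb.1 = pd.1) ∧ ((pa.2 = pd.2 ∧ pb.2 = pc.2) ∨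
      (pa.2 = pd.2 - (D.n - D.b0 + D.bk - 1) ∧ pb.2 = pc.2 + (D.n - D.b0 + D.bk - 1))) := by
    rcases ra with r | r | r | r <;> rcases rc with t | t | t | t <;>
      first
      | (exfalso; clear rb rd; omega)
      | (rcases rd with u | u | u | u <;>
          first
          | (exfalso; clear rb; omega)
          | (rcases rb with s | s | s | s <;> omega))
  refine ⟨key.1.1, key.1.2, ?_⟩
  rcases key.2 with ⟨k1, k2⟩ | ⟨k1, k2⟩
  · exact ⟨0, by omega, by omega⟩
  · exact ⟨-1, by omega, by omega⟩

lemma fr_B1 (hP : IsFrame P D) (H : HoleShape D h1 h2) {v w : ℤ × ℤ} (hv : v ∈ P.vertexSet)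
    (hw : w ∈ P.vertexSet) (l1 : (frPsi D h1 v).1 < (frPsi D h1 w).1)
    (l2 : (frPsi D h1 w).2 < (frPsi D h1 v).2) :
    IsInnerInterval P (min v.1 w.1, min v.2 w.2) (max v.1 w.1, max v.2 w.2) := by
  have a1 := D.ha0; have a2 := D.hak; have a3 := D.ham
  have a4 := D.hb0; have a5 := D.hbk; have a6 := D.hbn
  obtain ⟨r0, r⟩ := psi_reg hP H hv
  obtain ⟨s0, s⟩ := psi_reg hP H hw
  have hne1 : v.1 ≠ w.1 := by
    intro h
    rcases r with r | r | r | r <;> rcases s with s | s | s | s <;> omega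
  have hne2 : v.2 ≠ w.2 := by
    intro h
    rcases r with r | r | r | r <;> rcases s with s | s | s | s <;> omega
  rw [inner_iff hP H (by simp only; omega) (by simp only; omega) (by simp only; omega)
    (by simp only; omega) (by simp only; omega) (by simp only; omega)]
  simp only
  have e1 := H.b1 (max v.1 w.1 - 1)
  rcases r with r | r | r | r <;> rcases s with s | s | s | s <;> try omega
  · rw [max_eq_right (show v.1 ≤ w.1 by omega)]
    omega
  · rw [min_eq_right (show w.1 ≤ v.1 by omega)]
    omega

theorem frame_case (K : Type) [Field K] (hP : IsFrame P D) (H : HoleShape D h1 h2) :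
    IsDomain (CoordRing K P) ∧ IsIntegrallyClosed (CoordRing K P) ∧ IsCMCoordRing K P := by
  have a1 := D.ha0; have a2 := D.hak; have a3 := D.ham
  have a4 := D.hb0; have a5 := D.hbk; have a6 := D.hbn
  refine Ladder.main (frLadder H) (V := PVertex P) (fun v => frPsi D h1 v.1) ?_ ?_ ?_ K
    (innerMinors K P) ?_ ?_ ?_
  · intro v w h
    simp only at h
    exact Subtype.ext (Prod.ext (fr_col hP H v.2 w.2 (by rw [h]))
      (fr_row hP H v.2 w.2 (by rw [h])))
  · intro v
    exact fr_mem hP H v.2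
  · intro ω hω
    obtain ⟨v, hv, h⟩ := fr_surj hP H hω
    exact ⟨⟨v, hv⟩, h⟩
  · rintro f ⟨a, b, c, d, hin, hc, hd, rfl⟩
    obtain ⟨q1, q2, k, q3, q4⟩ := fr_A hP H a.2 b.2 c.2 d.2 hin hc hd
    refine ⟨a, b, c, d, k, rfl, q1, q2, ?_, ?_⟩
    · rw [frLadder_p2]; exact q3
    · rw [frLadder_p2]; exact q4
  · intro v w u z l1 l2 hu hz
    have k1 : u.1.1 = v.1.1 := fr_col hP H u.2 v.2 (by rw [hu])
    have k2 : u.1.2 = w.1.2 := fr_row hP H u.2 w.2 (by rw [hu])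
    have k3 : z.1.1 = w.1.1 := fr_col hP H z.2 w.2 (by rw [hz])
    have k4 : z.1.2 = v.1.2 := fr_row hP H z.2 v.2 (by rw [hz])
    exact rect_mem K (Prod.ext k1 k2) (Prod.ext k3 k4) (fr_B1 hP H v.2 w.2 l1 l2)
  · intro v w u z l1 l2 hu hz
    rw [frLadder_p2] at l2 hu hz
    obtain ⟨r0, r⟩ := psi_reg hP H v.2
    obtain ⟨s0, s⟩ := psi_reg hP H w.2
    have hu1 : u.1.1 = w.1.1 := fr_col hP H u.2 w.2 (by simp only [hu])
    have hz1 : z.1.1 = v.1.1 := fr_col hP H z.2 v.2 (by simp only [hz])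
    obtain ⟨t0, t⟩ := psi_reg hP H u.2
    obtain ⟨p0, p⟩ := psi_reg hP H z.2
    rw [hu] at t
    rw [hz] at p
    simp only at t p
    have hr : v.1.1 ≤ D.a0 ∧ v.1.2 ≤ D.b0 ∧ (frPsi D h1 v.1).2 = 1 - v.1.2 := by
      rcases s with s | s | s | s <;> omega
    have hs : D.a0 < w.1.1 ∧ (frPsi D h1 w.1).2 = D.n - D.b0 + D.bk - w.1.2 := by
      rcases s with s | s | s | s <;> omega
    clear r s
    have hu2 : u.1.2 = v.1.2 := by
      rcases t with t | t | t | t <;> omega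
    have hz2 : z.1.2 = w.1.2 := by
      rcases p with t | t | t | t <;> omega
    rw [mul_comm (MvPolynomial.X u)]
    apply rect_mem K (v := v) (w := w) (Prod.ext hz1 hz2) (Prod.ext hu1 hu2)
    rw [inner_iff hP H (by simp only; omega) (by simp only; omega) (by simp only; omega)
      (by simp only; omega) (by simp only; omega) (by simp only; omega)]
    right; right; left
    simp only
    have := H.b2 (min v.1.1 w.1.1)
    omega

end frame

section rect
variable {D : FrameData} {P : Polyomino}

lemma rc_cells (hP : IsFrame P D) (H : D.holeCells = ∅) {c : ℤ × ℤ} : c ∈ P.cells ↔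
    (1 ≤ c.1 ∧ c.1 + 1 ≤ D.m ∧ 1 ≤ c.2 ∧ c.2 + 1 ≤ D.n) := by
  rw [← Finset.mem_coe, hP, H, Set.sdiff_empty]
  rfl

lemma rc_vert (hP : IsFrame P D) (H : D.holeCells = ∅) {v : ℤ × ℤ} : v ∈ P.vertexSet ↔
    (1 ≤ v.1 ∧ v.1 ≤ D.m ∧ 1 ≤ v.2 ∧ v.2 ≤ D.n) := by
  obtain ⟨x, y⟩ := v
  rw [mem_vertexSet_iff]
  simp only [rc_cells hP H]
  have a1 := D.ha0; have a2 := D.hak; have a3 := D.ham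
  have a4 := D.hb0; have a5 := D.hbk; have a6 := D.hbn
  omega

theorem rect_case (K : Type) [Field K] (hP : IsFrame P D) (H : D.holeCells = ∅) :
    IsDomain (CoordRing K P) ∧ IsIntegrallyClosed (CoordRing K P) ∧ IsCMCoordRing K P := by
  have a1 := D.ha0; have a2 := D.hak; have a3 := D.ham
  have a4 := D.hb0; have a5 := D.hbk; have a6 := D.hbn
  obtain ⟨p1, hp1⟩ : ∃ p1 : ℕ, (p1 : ℤ) = D.m := ⟨D.m.toNat, by omega⟩
  obtain ⟨p2, hp2⟩ : ∃ p2 : ℕ, (p2 : ℤ) = D.n - 1 := ⟨(D.n - 1).toNat, by omega⟩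
  let L : Ladder := Ladder.ofDom p1 p2 (by omega) (by omega) (fun _ => 1) (fun _ => D.n)
    (by intros; simp) (by intros; simp) (by omega) (by omega) (by intros; omega) (by omega)
    (by intros; omega)
  have hL : ∀ ω, ω ∈ L.Om ↔ 1 ≤ ω.1 ∧ ω.1 ≤ p1 ∧ 1 ≤ ω.2 ∧ ω.2 ≤ D.n := by
    intro ω
    exact Ladder.mem_ofDom ..
  have hLp : (L.p2 : ℤ) = D.n - 1 := hp2
  refine Ladder.main L (V := PVertex P) (fun v => v.1) Subtype.val_injective ?_ ?_ K
    (innerMinors K P) ?_ ?_ ?_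
  · intro v
    have := (rc_vert hP H).1 v.2
    rw [hL, hp1]
    exact this
  · intro ω hω
    rw [hL, hp1] at hω
    exact ⟨⟨ω, (rc_vert hP H).2 hω⟩, rfl⟩
  · rintro f ⟨a, b, c, d, hin, hc, hd, rfl⟩
    refine ⟨a, b, c, d, 0, rfl, ?_, ?_, ?_, ?_⟩ <;> simp [hc, hd]
  · intro v w u z l1 l2 hu hz
    have hv := (rc_vert hP H).1 v.2
    have hw := (rc_vert hP H).1 w.2
    apply rect_mem K hu hz
    refine ⟨by simp only; omega, by simp only; omega, fun c hc => (rc_cells hP H).2 ?_⟩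
    unfold cellInInterval at hc
    simp only at hc
    omega
  · intro v w u z l1 l2 hu hz
    exfalso
    rw [hLp] at l2
    have hv := (rc_vert hP H).1 v.2
    have hw := (rc_vert hP H).1 w.2
    omega

end rect

theorem frame_normal_CM_domain (K : Type) [Field K] (P : Polyomino)
    (D : FrameData) (hP : IsFrame P D) :
    IsDomain (CoordRing K P) ∧ IsIntegrallyClosed (CoordRing K P) ∧ IsCMCoordRing K P := by
  rcases frame_shape D with H | ⟨h1, h2, H⟩
  · exact rect_case K hP H
  · exact frame_case K hP H
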